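/- Let n ≥ 3 and let Ω ⊂ ℂⁿ be a bounded strongly pseudoconvex domain with defining function ρ of class C⁴ on an open set U ⊇ closure(Ω). Let f₀ : ℂ → ℂⁿ be continuous on the closed unit disc closure(𝔻), holomorphic on 𝔻, with f₀(closure(𝔻)) ⊆ Ω, let K ⊆ 𝔻 be compact and ε > 0. Then there exists f : closure(𝔻) → ℂⁿ, continuous on closure(𝔻) and holomorphic on 𝔻, with f(𝔻) ⊆ Ω, ρ(f(ζ)) = 0 for |ζ| = 1, sup_K |f − f₀| < ε, such that the complex derivative f′ extends continuously to closure(𝔻) and this extension is nonvanishing at every point of closure(𝔻) (so f is an immersion up to the boundary). If moreover n ≥ 4, then f can in addition be chosen injective on closure(𝔻) (an embedding up to the boundary). -/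

import Mathlib

open Complex Metric Set Bornology

/-- Second real Fréchet derivative. -/
noncomputable def D2 {E : Type*} [NormedAddCommGroup E] [NormedSpace ℝ E]
    (ρ : E → ℝ) (z w v : E) : ℝ := fderiv ℝ (fderiv ℝ ρ) z w v

/-- The Levi form `L_ρ(z,w) = (1/4)(D²ρ(z)(w,w) + D²ρ(z)(iw,iw))`. -/
noncomputable def levi {E : Type*} [NormedAddCommGroup E] [NormedSpace ℂ E]
    (ρ : E → ℝ) (z w : E) : ℝ :=
  (1/4) * (D2 ρ z w w + D2 ρ z (Complex.I • w) (Complex.I • w))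

/-- The complex differential `∂ρ(z)(w) = (1/2)(Dρ(z)(w) − i·Dρ(z)(iw))`. -/
noncomputable def cdiff {E : Type*} [NormedAddCommGroup E] [NormedSpace ℂ E]
    (ρ : E → ℝ) (z w : E) : ℂ :=
  (1/2 : ℂ) * ((fderiv ℝ ρ z w : ℂ) - Complex.I * (fderiv ℝ ρ z (Complex.I • w) : ℂ))

section CircleSeries

open MeasureTheory AddCircle

instance fact_two_pi_pos : Fact (0 < 2 * Real.pi) := ⟨Real.two_pi_pos⟩

theorem continuousOn_powerSeries {c : ℕ → ℂ} (hc : Summable fun k => ‖c k‖) :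
    ContinuousOn (fun z : ℂ => ∑' k, c k * z ^ k) (closedBall 0 1) := by
  refine continuousOn_tsum (fun k => by fun_prop) hc fun k z hz => ?_
  rw [norm_mul, norm_pow]
  exact mul_le_of_le_one_right (norm_nonneg _)
    (pow_le_one₀ (norm_nonneg _) (by simpa using hz))

theorem differentiableOn_powerSeries {c : ℕ → ℂ} (hc : Summable fun k => ‖c k‖) :
    DifferentiableOn ℂ (fun z : ℂ => ∑' k, c k * z ^ k) (ball 0 1) := by
  refine differentiableOn_tsum_of_summable_norm hc (fun k => by fun_prop) isOpen_ball
    fun k z hz => ?_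
  rw [norm_mul, norm_pow]
  exact mul_le_of_le_one_right (norm_nonneg _)
    (pow_le_one₀ (norm_nonneg _) (by simpa using (ball_subset_closedBall hz)))

theorem norm_toLp_sq (f : C(AddCircle (2 * Real.pi), ℂ)) :
    ‖ContinuousMap.toLp (E := ℂ) 2 haarAddCircle ℂ f‖ ^ 2 = ∫ x, ‖f x‖ ^ 2 ∂haarAddCircle := by
  set F := ContinuousMap.toLp (E := ℂ) 2 haarAddCircle ℂ f with hF
  have H₃ := congr_arg RCLike.re (@L2.inner_def (AddCircle (2 * Real.pi)) ℂ ℂ _ _ _ _ _ F F)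
  rw [← integral_re (L2.integrable_inner F F)] at H₃
  simp only [← norm_sq_eq_re_inner] at H₃
  rw [H₃]
  refine integral_congr_ae ?_
  filter_upwards [ContinuousMap.coeFn_toLp (E := ℂ) (p := 2) (𝕜 := ℂ) haarAddCircle f] with x hx
  rw [hF, hx]

theorem sum_sq_fourierCoeff_le (f : C(AddCircle (2 * Real.pi), ℂ)) (s : Finset ℤ) :
    ∑ k ∈ s, ‖fourierCoeff f k‖ ^ 2 ≤ ∫ x, ‖f x‖ ^ 2 ∂haarAddCircle := by
  have h := hasSum_sq_fourierCoeff (ContinuousMap.toLp (E := ℂ) 2 haarAddCircle ℂ f)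
  have h2 : ∫ t, ‖(ContinuousMap.toLp (E := ℂ) 2 haarAddCircle ℂ f) t‖ ^ 2 ∂haarAddCircle =
      ∫ x, ‖f x‖ ^ 2 ∂haarAddCircle := by
    refine integral_congr_ae ?_
    filter_upwards [ContinuousMap.coeFn_toLp (E := ℂ) (p := 2) (𝕜 := ℂ) haarAddCircle f] with x hx
    rw [hx]
  rw [h2] at h
  simp_rw [fourierCoeff_toLp] at h
  exact sum_le_hasSum s (fun _ _ => by positivity) h

theorem fourierCoeff_comp_add_right (f : AddCircle (2 * Real.pi) → ℂ)
    (s : AddCircle (2 * Real.pi)) (k : ℤ) :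
    fourierCoeff (fun x => f (x + s)) k = fourier k s * fourierCoeff f k := by
  unfold fourierCoeff
  rw [← integral_const_mul]
  rw [← integral_add_right_eq_self (fun t => fourier k s * fourier (-k) t • f t) s]
  refine integral_congr_ae (Filter.Eventually.of_forall fun t => ?_)
  have h1 : fourier k s * fourier (-k) s = 1 := by
    rw [← fourier_add]; simp
  have h2 : fourier (-k) (t + s) = fourier (-k) t * fourier (-k) s := by
    simp [fourier_apply, smul_add, toCircle_add]
  simp only [smul_eq_mul, h2]
  linear_combination (-(fourier (-k) t * f (t + s))) * h1

theorem norm_fourier_sub_one_le (k : ℤ) (s : ℝ) :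
    ‖fourier k (s : AddCircle (2 * Real.pi)) - 1‖ ≤ |(k : ℝ)| * |s| := by
  have := Real.norm_exp_I_mul_ofReal_sub_one_le (x := (k : ℝ) * s)
  rw [fourier_coe_apply]
  rw [Real.norm_eq_abs, abs_mul] at this
  convert this using 4
  push_cast
  have : (Real.pi : ℂ) ≠ 0 := by exact_mod_cast Real.pi_ne_zero
  field_simp

theorem fourier_norm_apply (k : ℤ) (x : AddCircle (2 * Real.pi)) : ‖fourier k x‖ = 1 := by
  rw [fourier_apply, Circle.norm_coe]

/-- The boundary values `∑ c k * exp (i (k + 1) x)` of a power series without constant term. -/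
noncomputable def circSeries (c : ℕ → ℂ) : C(AddCircle (2 * Real.pi), ℂ) :=
  ∑' k : ℕ, c k • fourier ((k : ℤ) + 1)

variable {c : ℕ → ℂ}

theorem hasSum_circSeries (hc : Summable fun k => ‖c k‖) :
    HasSum (fun k : ℕ => c k • (fourier ((k : ℤ) + 1) : C(AddCircle (2 * Real.pi), ℂ)))
      (circSeries c) := by
  refine (Summable.of_norm ?_).hasSum
  simpa [norm_smul, fourier_norm] using hc

theorem hasSum_circSeries_apply (hc : Summable fun k => ‖c k‖) (x : AddCircle (2 * Real.pi)) :
    HasSum (fun k : ℕ => c k * fourier ((k : ℤ) + 1) x) (circSeries c x) := by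
  have := (ContinuousMap.evalCLM ℂ x).hasSum (hasSum_circSeries hc)
  convert! this using 2

theorem integral_norm_circSeries_sq_le (hc : Summable fun k => ‖c k‖) {S : ℝ}
    (hS : ∀ s : Finset ℕ, ∑ k ∈ s, ‖c k‖ ^ 2 ≤ S) :
    ∫ x, ‖circSeries c x‖ ^ 2 ∂haarAddCircle ≤ S := by
  rw [← norm_toLp_sq]
  have h1 := (ContinuousMap.toLp (E := ℂ) 2 haarAddCircle ℂ).hasSum (hasSum_circSeries hc)
  have h2 := (h1.norm.pow 2)
  refine le_of_tendsto h2 (Filter.Eventually.of_forall fun s => ?_)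
  have hon : Orthonormal ℂ (fun k : ℕ => @fourierLp (2 * Real.pi) _ 2 _ ((k : ℤ) + 1)) :=
    orthonormal_fourier.comp (fun k : ℕ => (k : ℤ) + 1) (fun a b h => by simpa using h)
  refine le_trans (le_of_eq ?_) (hS s)
  have h3 := hon.inner_sum c c s
  have h4 := inner_self_eq_norm_sq_to_K (𝕜 := ℂ)
      (∑ i ∈ s, c i • @fourierLp (2 * Real.pi) _ 2 _ ((i : ℤ) + 1))
  rw [h3] at h4
  have h5 : ∀ i, (starRingEnd ℂ) (c i) * c i = ((‖c i‖ ^ 2 : ℝ) : ℂ) := by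
    intro i; rw [mul_comm, Complex.mul_conj, Complex.normSq_eq_norm_sq]
  simp_rw [h5] at h4
  have h6 : ‖∑ i ∈ s, c i • @fourierLp (2 * Real.pi) _ 2 _ ((i : ℤ) + 1)‖ ^ 2 =
      ∑ i ∈ s, ‖c i‖ ^ 2 := by
    apply Complex.ofReal_injective
    push_cast at h4 ⊢
    exact h4.symm
  rw [← h6]
  simp only [map_smul]

end CircleSeries

section Theodorsen

open MeasureTheory AddCircle

theorem summable_norm_of_sobolev {c : ℕ → ℂ} {B : ℝ}
    (hc : ∀ s : Finset ℕ, ∑ k ∈ s, ((k : ℝ) + 1) ^ 2 * ‖c k‖ ^ 2 ≤ B) :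
    Summable fun k => ‖c k‖ := by
  have h1 : Summable fun k : ℕ => ((k : ℝ) + 1) ^ 2 * ‖c k‖ ^ 2 :=
    summable_of_sum_le (fun k => by positivity) hc
  have h2 : Summable fun k : ℕ => (1 : ℝ) / ((k : ℝ) + 1) ^ 2 := by
    have := (summable_nat_add_iff 1).2 (Real.summable_one_div_nat_pow.2 (one_lt_two))
    simpa using this
  refine Summable.of_nonneg_of_le (fun k => norm_nonneg _) (fun k => ?_) (h1.add h2)
  have hk : (0 : ℝ) < (k : ℝ) + 1 := by positivity
  have h3 : ‖c k‖ = (((k : ℝ) + 1) * ‖c k‖) * (1 / ((k : ℝ) + 1)) := by field_simp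
  have h4 : (1 : ℝ) / ((k : ℝ) + 1) ^ 2 = (1 / ((k : ℝ) + 1)) ^ 2 := by field_simp
  rw [h4, ← mul_pow]
  nlinarith [sq_nonneg (((k : ℝ) + 1) * ‖c k‖ - 1 / ((k : ℝ) + 1)),
    sq_nonneg (((k : ℝ) + 1) * ‖c k‖), sq_nonneg (1 / ((k : ℝ) + 1))]

theorem integral_norm_circSeries_shift_sq_le {c : ℕ → ℂ} {B : ℝ}
    (hc : ∀ s : Finset ℕ, ∑ k ∈ s, ((k : ℝ) + 1) ^ 2 * ‖c k‖ ^ 2 ≤ B) (s : ℝ) :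
    ∫ x, ‖circSeries c (x + (s : AddCircle (2 * Real.pi))) - circSeries c x‖ ^ 2
      ∂haarAddCircle ≤ B * s ^ 2 := by
  have hs := summable_norm_of_sobolev hc
  set c' : ℕ → ℂ := fun k => c k * (fourier ((k : ℤ) + 1) (s : AddCircle (2 * Real.pi)) - 1)
  have hb : ∀ k, ‖c' k‖ ≤ ((k : ℝ) + 1) * ‖c k‖ * |s| := by
    intro k
    have := norm_fourier_sub_one_le ((k : ℤ) + 1) s
    rw [show |(((k : ℤ) + 1 : ℤ) : ℝ)| = (k : ℝ) + 1 by
      push_cast; exact abs_of_nonneg (by positivity)] at this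
    calc ‖c' k‖ = ‖c k‖ * _ := norm_mul _ _
      _ ≤ ‖c k‖ * (((k : ℝ) + 1) * |s|) := by gcongr
      _ = _ := by ring
  have hs' : Summable fun k => ‖c' k‖ := by
    refine Summable.of_nonneg_of_le (fun k => norm_nonneg _) (fun k => ?_) (hs.mul_right 2)
    rw [norm_mul]
    gcongr
    refine (norm_sub_le _ _).trans ?_
    rw [fourier_norm_apply]; norm_num
  have heq : ∀ x, circSeries c (x + (s : AddCircle (2 * Real.pi))) - circSeries c x =
      circSeries c' x := by
    intro x
    have h1 := (hasSum_circSeries_apply hs (x + s)).sub (hasSum_circSeries_apply hs x)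
    refine h1.unique ?_
    have hX := hasSum_circSeries_apply hs' x
    refine cast (congrArg (fun u => HasSum u (circSeries c' x)) (funext ?_)) hX
    intro k
    simp only [c']
    have : fourier ((k : ℤ) + 1) (x + (s : AddCircle (2 * Real.pi))) =
      fourier ((k : ℤ) + 1) x * fourier ((k : ℤ) + 1) (s : AddCircle (2 * Real.pi)) := by
      simp only [fourier_apply, smul_add, toCircle_add, Circle.coe_mul]
    rw [this]; ring
  simp_rw [heq]
  refine integral_norm_circSeries_sq_le hs' fun F => ?_
  calc ∑ k ∈ F, ‖c' k‖ ^ 2 ≤ ∑ k ∈ F, (((k : ℝ) + 1) ^ 2 * ‖c k‖ ^ 2) * s ^ 2 := by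
        refine Finset.sum_le_sum fun k _ => ?_
        calc ‖c' k‖ ^ 2 ≤ (((k : ℝ) + 1) * ‖c k‖ * |s|) ^ 2 := by gcongr; exact hb k
          _ = _ := by rw [mul_pow, mul_pow, sq_abs]
    _ ≤ _ := by
        rw [← Finset.sum_mul]
        exact mul_le_mul_of_nonneg_right (hc F) (sq_nonneg s)

theorem sum_sq_mul_fourierCoeff_le (f : C(AddCircle (2 * Real.pi), ℂ)) {B : ℝ}
    (hf : ∀ s : ℝ, ∫ x, ‖f (x + (s : AddCircle (2 * Real.pi))) - f x‖ ^ 2 ∂haarAddCircle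
      ≤ B * s ^ 2) (F : Finset ℤ) :
    ∑ k ∈ F, (k : ℝ) ^ 2 * ‖fourierCoeff f k‖ ^ 2 ≤ B := by
  have h1 : ∀ s : ℝ, s ≠ 0 → ∑ k ∈ F,
      ‖s⁻¹ • (fourier k ((0 + s : ℝ) : AddCircle (2 * Real.pi)) -
        fourier k ((0 : ℝ) : AddCircle (2 * Real.pi)))‖ ^ 2 * ‖fourierCoeff f k‖ ^ 2 ≤ B := by
    intro s hs
    set g : C(AddCircle (2 * Real.pi), ℂ) :=
      ⟨fun x => f (x + (s : AddCircle (2 * Real.pi))) - f x, by fun_prop⟩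
    have h2 := sum_sq_fourierCoeff_le g F
    have h3 : ∀ k, fourierCoeff g k = (fourier k (s : AddCircle (2 * Real.pi)) - 1) *
        fourierCoeff f k := by
      intro k
      have h4 := fourierCoeff_comp_add_right f s k
      rw [sub_mul, one_mul, ← h4]
      unfold fourierCoeff
      rw [← integral_sub]
      · simp [g, mul_sub]
      · exact Continuous.integrable_of_hasCompactSupport (by fun_prop)
            (HasCompactSupport.of_compactSpace _)
      · exact Continuous.integrable_of_hasCompactSupport (by fun_prop)
            (HasCompactSupport.of_compactSpace _)
    have h5 := h2.trans (hf s)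
    simp_rw [h3, norm_mul, mul_pow] at h5
    have hs2 : 0 < s ^ 2 := by positivity
    calc _ = (∑ k ∈ F, ‖fourier k (s : AddCircle (2 * Real.pi)) - 1‖ ^ 2 *
          ‖fourierCoeff f k‖ ^ 2) / s ^ 2 := by
          rw [Finset.sum_div]
          refine Finset.sum_congr rfl fun k _ => ?_
          rw [norm_smul, mul_pow, norm_inv, Real.norm_eq_abs, inv_pow, sq_abs]
          simp only [zero_add, coe_zero, fourier_eval_zero]
          ring
      _ ≤ B := by rw [div_le_iff₀ hs2]; exact h5
  have h2 : Filter.Tendsto (fun s : ℝ => ∑ k ∈ F,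
      ‖s⁻¹ • (fourier k ((0 + s : ℝ) : AddCircle (2 * Real.pi)) -
        fourier k ((0 : ℝ) : AddCircle (2 * Real.pi)))‖ ^ 2 * ‖fourierCoeff f k‖ ^ 2)
      (nhdsWithin 0 {0}ᶜ) (nhds (∑ k ∈ F, (k : ℝ) ^ 2 * ‖fourierCoeff f k‖ ^ 2)) := by
    refine tendsto_finsetSum _ fun k _ => ?_
    have h3 := (hasDerivAt_iff_tendsto_slope_zero.1 (hasDerivAt_fourier (2 * Real.pi) k 0))
    convert (h3.norm.pow 2).mul_const (‖fourierCoeff f k‖ ^ 2) using 2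
    have : ‖2 * Real.pi * I * (k : ℂ) / ((2 * Real.pi : ℝ) : ℂ) *
        fourier k ((0 : ℝ) : AddCircle (2 * Real.pi))‖ = |(k : ℝ)| := by
      have hpi : (Real.pi : ℂ) ≠ 0 := by exact_mod_cast Real.pi_ne_zero
      rw [norm_mul, fourier_norm_apply, mul_one]
      rw [show 2 * Real.pi * I * (k : ℂ) / ((2 * Real.pi : ℝ) : ℂ) = I * k by
        push_cast; field_simp]
      simp
    rw [this, sq_abs]
  exact le_of_tendsto h2 (Filter.eventually_of_mem self_mem_nhdsWithin h1)

end Theodorsen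

section TheodorsenFixedPoint

open MeasureTheory AddCircle

/-- The function `x ↦ H (x + Im C(x))`, where `C` is the boundary series of `c`. -/
noncomputable def displaced (H : C(AddCircle (2 * Real.pi), ℝ)) (c : ℕ → ℂ) :
    C(AddCircle (2 * Real.pi), ℂ) where
  toFun x := (H (x + ((circSeries c x).im : ℝ)) : ℝ)
  continuous_toFun := by
    refine continuous_ofReal.comp (H.continuous.comp (continuous_id.add ?_))
    exact (AddCircle.continuous_mk' (2 * Real.pi)).comp
      (Complex.continuous_im.comp (circSeries c).continuous)

variable {H : C(AddCircle (2 * Real.pi), ℝ)} {θ : ℝ}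

theorem integrable_of_continuous {f : AddCircle (2 * Real.pi) → ℝ} (hf : Continuous f) :
    Integrable f haarAddCircle :=
  hf.integrable_of_hasCompactSupport (HasCompactSupport.of_compactSpace _)

theorem integral_displaced_shift_sq_le
    (hH : ∀ (x : AddCircle (2 * Real.pi)) (a b : ℝ), |H (x + a) - H (x + b)| ≤ θ * |a - b|)
    {c : ℕ → ℂ} (hc : ∀ s : Finset ℕ, ∑ k ∈ s, ((k : ℝ) + 1) ^ 2 * ‖c k‖ ^ 2 ≤ 1) (s : ℝ) :
    ∫ x, ‖displaced H c (x + (s : AddCircle (2 * Real.pi))) - displaced H c x‖ ^ 2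
      ∂haarAddCircle ≤ (4 * θ ^ 2) * s ^ 2 := by
  have h1 := integral_norm_circSeries_shift_sq_le hc s
  have hpt : ∀ x : AddCircle (2 * Real.pi),
      ‖displaced H c (x + (s : AddCircle (2 * Real.pi))) - displaced H c x‖ ^ 2 ≤
      2 * θ ^ 2 * (s ^ 2 + ‖circSeries c (x + (s : AddCircle (2 * Real.pi))) -
        circSeries c x‖ ^ 2) := by
    intro x
    set p := circSeries c (x + (s : AddCircle (2 * Real.pi)))
    set q := circSeries c x
    have h2 := hH x (s + p.im) q.im
    have h3 : |(p - q).im| ≤ ‖p - q‖ := Complex.abs_im_le_norm _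
    have h4 : ‖displaced H c (x + (s : AddCircle (2 * Real.pi))) - displaced H c x‖ =
        |H (x + ((s + p.im : ℝ) : AddCircle (2 * Real.pi))) - H (x + q.im)| := by
      simp only [displaced, ContinuousMap.coe_mk]
      rw [← ofReal_sub, norm_real, Real.norm_eq_abs, AddCircle.coe_add, ← add_assoc]
    rw [h4]
    calc _ ≤ (θ * |s + p.im - q.im|) ^ 2 := by gcongr
      _ = θ ^ 2 * (s + (p - q).im) ^ 2 := by rw [mul_pow, sq_abs, sub_im]; ring
      _ ≤ θ ^ 2 * (2 * (s ^ 2 + (p - q).im ^ 2)) := by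
          gcongr; nlinarith [sq_nonneg (s - (p - q).im)]
      _ ≤ θ ^ 2 * (2 * (s ^ 2 + ‖p - q‖ ^ 2)) := by
          refine mul_le_mul_of_nonneg_left ?_ (sq_nonneg θ)
          have := sq_le_sq' (by linarith [abs_le.1 h3]) ((abs_le.1 h3).2)
          linarith
      _ = _ := by ring
  calc _ ≤ ∫ x, 2 * θ ^ 2 * (s ^ 2 + ‖circSeries c (x + (s : AddCircle (2 * Real.pi))) -
        circSeries c x‖ ^ 2) ∂haarAddCircle := by
        refine integral_mono (integrable_of_continuous (by fun_prop))
          (integrable_of_continuous (by fun_prop)) hpt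
    _ = 2 * θ ^ 2 * (s ^ 2 + ∫ x, ‖circSeries c (x + (s : AddCircle (2 * Real.pi))) -
        circSeries c x‖ ^ 2 ∂haarAddCircle) := by
        rw [integral_const_mul, integral_add (integrable_const _)
          (integrable_of_continuous (by fun_prop))]
        simp
    _ ≤ 2 * θ ^ 2 * (s ^ 2 + 1 * s ^ 2) := by gcongr
    _ = _ := by ring

theorem sum_sq_fourierCoeff_displaced_le (hθ : 0 ≤ θ) (hθ1 : θ ≤ 1 / 8)
    (hH : ∀ (x : AddCircle (2 * Real.pi)) (a b : ℝ), |H (x + a) - H (x + b)| ≤ θ * |a - b|)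
    {c : ℕ → ℂ} (hc : ∀ s : Finset ℕ, ∑ k ∈ s, ((k : ℝ) + 1) ^ 2 * ‖c k‖ ^ 2 ≤ 1)
    (s : Finset ℕ) :
    ∑ k ∈ s, ((k : ℝ) + 1) ^ 2 * ‖2 * fourierCoeff (displaced H c) ((k : ℤ) + 1)‖ ^ 2 ≤ 1 := by
  have h := sum_sq_mul_fourierCoeff_le (displaced H c) (integral_displaced_shift_sq_le hH hc)
    (s.map ⟨fun k : ℕ => (k : ℤ) + 1, fun a b h => by simpa using h⟩)
  rw [Finset.sum_map] at h
  calc _ = 4 * ∑ k ∈ s, (((k : ℤ) + 1 : ℤ) : ℝ) ^ 2 *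
        ‖fourierCoeff (displaced H c) ((k : ℤ) + 1)‖ ^ 2 := by
        rw [Finset.mul_sum]
        refine Finset.sum_congr rfl fun k _ => ?_
        rw [norm_mul]; push_cast; simp; ring
    _ ≤ 4 * (4 * θ ^ 2) := by gcongr; exact h
    _ ≤ 1 := by nlinarith

theorem memℓp_fourierCoeff (f : C(AddCircle (2 * Real.pi), ℂ)) :
    Memℓp (fun k : ℕ => 2 * fourierCoeff f ((k : ℤ) + 1)) 2 := by
  refine memℓp_gen' (C := 4 * ∫ x, ‖f x‖ ^ 2 ∂haarAddCircle) fun s => ?_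
  have h := sum_sq_fourierCoeff_le f
    (s.map ⟨fun k : ℕ => (k : ℤ) + 1, fun a b h => by simpa using h⟩)
  rw [Finset.sum_map] at h
  calc _ = 4 * ∑ k ∈ s, ‖fourierCoeff f ((k : ℤ) + 1)‖ ^ 2 := by
        rw [Finset.mul_sum]
        refine Finset.sum_congr rfl fun k _ => ?_
        rw [norm_mul]; simp; ring
    _ ≤ _ := by gcongr; exact h

/-- The map whose fixed points solve Theodorsen's equation. -/
noncomputable def theodorsenMap (H : C(AddCircle (2 * Real.pi), ℝ)) (c : lp (fun _ : ℕ => ℂ) 2) :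
    lp (fun _ : ℕ => ℂ) 2 :=
  ⟨fun k => 2 * fourierCoeff (displaced H c) ((k : ℤ) + 1), memℓp_fourierCoeff _⟩

theorem dist_theodorsenMap_le (hθ : 0 ≤ θ)
    (hH : ∀ (x : AddCircle (2 * Real.pi)) (a b : ℝ), |H (x + a) - H (x + b)| ≤ θ * |a - b|)
    {c d : lp (fun _ : ℕ => ℂ) 2} (hc : Summable fun k => ‖c k‖) (hd : Summable fun k => ‖d k‖) :
    dist (theodorsenMap H c) (theodorsenMap H d) ≤ 2 * θ * dist c d := by
  rw [dist_eq_norm, dist_eq_norm]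
  have hcd : Summable fun k => ‖c k - d k‖ :=
    Summable.of_nonneg_of_le (fun _ => norm_nonneg _) (fun _ => norm_sub_le _ _) (hc.add hd)
  have h0 : ∀ s : Finset ℕ, ∑ k ∈ s, ‖c k - d k‖ ^ 2 ≤ ‖c - d‖ ^ 2 := by
    intro s
    have := lp.sum_rpow_le_norm_rpow (p := 2) (by norm_num) (c - d) s
    simpa using this
  have h1 := integral_norm_circSeries_sq_le hcd h0
  refine lp.norm_le_of_forall_sum_le (by norm_num) (by positivity) fun s => ?_
  set f : C(AddCircle (2 * Real.pi), ℂ) := displaced H c - displaced H d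
  have h := sum_sq_fourierCoeff_le f
    (s.map ⟨fun k : ℕ => (k : ℤ) + 1, fun a b h => by simpa using h⟩)
  rw [Finset.sum_map] at h
  have h2 : ∫ x, ‖f x‖ ^ 2 ∂haarAddCircle ≤ θ ^ 2 * ‖c - d‖ ^ 2 := by
    calc ∫ x, ‖f x‖ ^ 2 ∂haarAddCircle ≤
        ∫ x, θ ^ 2 * ‖circSeries (fun k => c k - d k) x‖ ^ 2 ∂haarAddCircle := by
          refine integral_mono (integrable_of_continuous (by fun_prop))
            (integrable_of_continuous (by fun_prop)) fun x => ?_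
          have h3 : circSeries (fun k => c k - d k) x = circSeries c x - circSeries d x := by
            refine (hasSum_circSeries_apply hcd x).unique ?_
            have := (hasSum_circSeries_apply hc x).sub (hasSum_circSeries_apply hd x)
            simpa only [sub_mul] using this
          have h4 := hH x (circSeries c x).im (circSeries d x).im
          have h5 : ‖f x‖ = |H (x + (circSeries c x).im) - H (x + (circSeries d x).im)| := by
            simp only [f, displaced, ContinuousMap.sub_apply, ContinuousMap.coe_mk]
            rw [← ofReal_sub, norm_real, Real.norm_eq_abs]
          simp only
          rw [h5, h3, ← mul_pow]
          gcongr
          refine h4.trans ?_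
          gcongr
          rw [← sub_im]
          exact Complex.abs_im_le_norm _
      _ = θ ^ 2 * ∫ x, ‖circSeries (fun k => c k - d k) x‖ ^ 2 ∂haarAddCircle :=
          integral_const_mul _ _
      _ ≤ _ := by gcongr
  calc _ = 4 * ∑ k ∈ s, ‖fourierCoeff f ((k : ℤ) + 1)‖ ^ 2 := by
        rw [Finset.mul_sum]
        refine Finset.sum_congr rfl fun k _ => ?_
        have h3 : fourierCoeff f ((k : ℤ) + 1) = fourierCoeff (displaced H c) ((k : ℤ) + 1) -
            fourierCoeff (displaced H d) ((k : ℤ) + 1) := by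
          unfold fourierCoeff
          rw [← integral_sub]
          · simp [f, mul_sub]
          · exact Continuous.integrable_of_hasCompactSupport (by fun_prop)
              (HasCompactSupport.of_compactSpace _)
          · exact Continuous.integrable_of_hasCompactSupport (by fun_prop)
              (HasCompactSupport.of_compactSpace _)
        rw [h3]
        simp only [theodorsenMap, lp.coeFn_sub, Pi.sub_apply]
        rw [← mul_sub, norm_mul]; simp; ring
    _ ≤ 4 * (θ ^ 2 * ‖c - d‖ ^ 2) := by gcongr; exact h.trans h2
    _ = _ := by simp; ring

theorem exists_theodorsen_fixedPoint (hθ : 0 ≤ θ) (hθ1 : θ ≤ 1 / 8)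
    (hH : ∀ (x : AddCircle (2 * Real.pi)) (a b : ℝ), |H (x + a) - H (x + b)| ≤ θ * |a - b|) :
    ∃ c : ℕ → ℂ, (∀ s : Finset ℕ, ∑ k ∈ s, ((k : ℝ) + 1) ^ 2 * ‖c k‖ ^ 2 ≤ 1) ∧
      ∀ k, c k = 2 * fourierCoeff (displaced H c) ((k : ℤ) + 1) := by
  set X : Set (lp (fun _ : ℕ => ℂ) 2) :=
    {c | ∀ s : Finset ℕ, ∑ k ∈ s, ((k : ℝ) + 1) ^ 2 * ‖c k‖ ^ 2 ≤ 1} with hX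
  have hcl : IsClosed X := by
    have : X = ⋂ s : Finset ℕ, {c : lp (fun _ : ℕ => ℂ) 2 |
        ∑ k ∈ s, ((k : ℝ) + 1) ^ 2 * ‖c k‖ ^ 2 ≤ 1} := by
      ext c; simp [X]
    rw [this]
    refine isClosed_iInter fun s => isClosed_le ?_ continuous_const
    refine continuous_finsetSum _ fun k _ => continuous_const.mul ((Continuous.norm ?_).pow 2)
    exact (continuous_apply k).comp (lp.uniformContinuous_coe (p := 2)).continuous
  have hmaps : MapsTo (theodorsenMap H) X X := fun c hc =>
    sum_sq_fourierCoeff_displaced_le hθ hθ1 hH hc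
  have hcontr : ContractingWith (1 / 2) (hmaps.restrict (theodorsenMap H) X X) := by
    refine ⟨by norm_num, LipschitzWith.of_dist_le_mul fun c d => ?_⟩
    refine (dist_theodorsenMap_le hθ hH (summable_norm_of_sobolev c.2)
      (summable_norm_of_sobolev d.2)).trans ?_
    rw [Subtype.dist_eq]
    gcongr
    push_cast; linarith
  obtain ⟨c, hc, hfix, -⟩ := ContractingWith.exists_fixedPoint' (x := (0 : lp (fun _ : ℕ => ℂ) 2))
    hcl.isComplete hmaps hcontr
    (by intro s; simp) (edist_ne_top _ _)
  exact ⟨c, hc, fun k => (congrArg (fun d : lp (fun _ : ℕ => ℂ) 2 => d k) hfix.symm)⟩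

end TheodorsenFixedPoint

section RealCompletion

open MeasureTheory AddCircle

theorem fourierCoeff_neg_of_real {f : AddCircle (2 * Real.pi) → ℂ} (hf : ∀ x, (f x).im = 0)
    (k : ℤ) : fourierCoeff f (-k) = (starRingEnd ℂ) (fourierCoeff f k) := by
  unfold fourierCoeff
  rw [← integral_conj]
  refine integral_congr_ae (Filter.Eventually.of_forall fun x => ?_)
  simp only [smul_eq_mul, map_mul, neg_neg]
  rw [Complex.conj_eq_iff_im.2 (hf x), ← fourier_neg, neg_neg]

theorem fourierCoeff_zero_im {f : AddCircle (2 * Real.pi) → ℂ} (hf : ∀ x, (f x).im = 0) :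
    (fourierCoeff f 0).im = 0 := by
  have := fourierCoeff_neg_of_real hf 0
  rw [neg_zero] at this
  exact Complex.conj_eq_iff_im.1 this.symm

theorem eq_re_circSeries_of_real (f : C(AddCircle (2 * Real.pi), ℂ)) (hf : ∀ x, (f x).im = 0)
    (hs : Summable fun k : ℕ => ‖2 * fourierCoeff f ((k : ℤ) + 1)‖)
    (x : AddCircle (2 * Real.pi)) :
    (f x).re = (fourierCoeff f 0).re +
      (circSeries (fun k => 2 * fourierCoeff f ((k : ℤ) + 1)) x).re := by
  have h1 : Summable fun k : ℕ => ‖fourierCoeff f ((k : ℤ) + 1)‖ := by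
    have := hs.mul_left (1 / 2)
    refine this.congr fun k => ?_
    rw [norm_mul]; simp
  have hsum : Summable (fourierCoeff f) := by
    refine Summable.of_add_one_of_neg_add_one h1.of_norm ?_
    refine Summable.of_norm (h1.congr fun k => ?_)
    rw [fourierCoeff_neg_of_real hf, RCLike.norm_conj]
  have h2 := has_pointwise_sum_fourier_series_of_summable hsum x
  have h3 := hasSum_circSeries_apply hs x
  set S := circSeries (fun k => 2 * fourierCoeff f ((k : ℤ) + 1)) x
  have h4 : HasSum (fun k : ℕ => fourierCoeff f ((k : ℤ) + 1) • fourier ((k : ℤ) + 1) x)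
      (S / 2) := by
    refine cast (congrArg (fun u => HasSum u (S / 2)) (funext fun k => ?_)) (h3.div_const 2)
    simp only [smul_eq_mul]; ring
  have h5 : HasSum (fun k : ℕ => fourierCoeff f (-((k : ℤ) + 1)) • fourier (-((k : ℤ) + 1)) x)
      ((starRingEnd ℂ) (S / 2)) := by
    have h6 := h4.map (starRingEnd ℂ) Complex.continuous_conj
    refine cast (congrArg (fun u => HasSum u _) (funext fun k => ?_)) h6
    simp only [Function.comp, smul_eq_mul, map_mul]
    rw [fourierCoeff_neg_of_real hf, fourier_neg]
  have h7 := h2.unique (HasSum.of_add_one_of_neg_add_one (f := fun n : ℤ =>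
    fourierCoeff f n • fourier n x) h4 h5)
  have h8 : (S / 2).re = S.re / 2 := Complex.div_ofNat_re S 2
  rw [h7, add_re, add_re, Complex.conj_re, smul_eq_mul, fourier_zero, mul_one, h8]
  ring

/-- The analytic extension `a + ∑ c k * z ^ (k + 1)` to the disc. -/
noncomputable def discExt (a : ℂ) (c : ℕ → ℂ) (z : ℂ) : ℂ := a + z * ∑' k, c k * z ^ k

theorem continuousOn_discExt {c : ℕ → ℂ} (a : ℂ) (hc : Summable fun k => ‖c k‖) :
    ContinuousOn (discExt a c) (closedBall 0 1) :=
  continuousOn_const.add (continuousOn_id.mul (continuousOn_powerSeries hc))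

theorem differentiableOn_discExt {c : ℕ → ℂ} (a : ℂ) (hc : Summable fun k => ‖c k‖) :
    DifferentiableOn ℂ (discExt a c) (ball 0 1) :=
  (differentiableOn_const _).add (differentiableOn_id.mul (differentiableOn_powerSeries hc))

theorem discExt_zero (a : ℂ) (c : ℕ → ℂ) : discExt a c 0 = a := by simp [discExt]

theorem discExt_exp {c : ℕ → ℂ} (a : ℂ) (hc : Summable fun k => ‖c k‖) (t : ℝ) :
    discExt a c (exp (t * I)) = a + circSeries c (t : AddCircle (2 * Real.pi)) := by
  have h := (hasSum_circSeries_apply hc (t : AddCircle (2 * Real.pi))).tsum_eq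
  rw [discExt, ← h, ← tsum_mul_left]
  congr 2
  ext k
  have hf : fourier ((k : ℤ) + 1) (t : AddCircle (2 * Real.pi)) = exp (t * I) ^ (k + 1) := by
    rw [fourier_coe_apply, ← Complex.exp_nat_mul]
    congr 1
    have : (Real.pi : ℂ) ≠ 0 := by exact_mod_cast Real.pi_ne_zero
    push_cast
    field_simp
  rw [hf]; ring

theorem norm_discExt_le {c : ℕ → ℂ} {a : ℂ} {η : ℝ} (ha : ‖a‖ ≤ η) (hc : ∀ k, ‖c k‖ ≤ 2 * η)
    {z : ℂ} (hz : ‖z‖ < 1) : ‖discExt a c z‖ ≤ η * (1 + 2 / (1 - ‖z‖)) := by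
  have hη : 0 ≤ η := (norm_nonneg _).trans ha
  have h1 : ‖∑' k, c k * z ^ k‖ ≤ 2 * η * (1 - ‖z‖)⁻¹ := by
    refine tsum_of_norm_bounded ((hasSum_geometric_of_lt_one (norm_nonneg _) hz).mul_left (2 * η))
      fun k => ?_
    rw [norm_mul, norm_pow]
    gcongr
    exact hc k
  have h2 : 0 < 1 - ‖z‖ := by linarith
  calc ‖discExt a c z‖ ≤ ‖a‖ + ‖z‖ * ‖∑' k, c k * z ^ k‖ := by
        rw [← norm_mul]; exact norm_add_le _ _
    _ ≤ η + 1 * (2 * η * (1 - ‖z‖)⁻¹) := by gcongr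
    _ = _ := by field_simp

theorem norm_fourierCoeff_le {f : AddCircle (2 * Real.pi) → ℂ} {C : ℝ} (hf : ∀ x, ‖f x‖ ≤ C)
    (k : ℤ) : ‖fourierCoeff f k‖ ≤ C := by
  unfold fourierCoeff
  refine (norm_integral_le_of_norm_le_const (C := C)
    (Filter.Eventually.of_forall fun x => ?_)).trans (by simp)
  rw [norm_smul, fourier_norm_apply, one_mul]
  exact hf x

end RealCompletion

section Boundary

open MeasureTheory AddCircle

theorem integral_haarAddCircle_eq (f : AddCircle (2 * Real.pi) → ℝ) :
    ∫ x, f x ∂haarAddCircle =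
      (2 * Real.pi)⁻¹ * ∫ t in (0 : ℝ)..2 * Real.pi, f (t : AddCircle (2 * Real.pi)) := by
  have h := AddCircle.intervalIntegral_preimage (2 * Real.pi) 0 f
  rw [zero_add] at h
  rw [integral_haarAddCircle, h, smul_eq_mul]

/-- The continuous function on the circle induced by a continuous periodic function. -/
noncomputable def periodicLift {X : Type*} [TopologicalSpace X] (f : ℝ → X) (hf : Continuous f)
    (hp : Function.Periodic f (2 * Real.pi)) : C(AddCircle (2 * Real.pi), X) where
  toFun := hp.lift
  continuous_toFun := by
    refine (QuotientAddGroup.isQuotientMap_mk (N := AddSubgroup.zmultiples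
        (2 * Real.pi))).continuous_iff.2 ?_
    exact hf

theorem exists_theodorsen {h : ℝ → ℝ} {η : ℝ} (hp : Function.Periodic h (2 * Real.pi))
    (hl : ∀ a b, |h a - h b| ≤ 1 / 8 * |a - b|) (hη : ∀ t, |h t| ≤ η) :
    ∃ g : ℂ → ℂ, ContinuousOn g (closedBall 0 1) ∧ DifferentiableOn ℂ g (ball 0 1) ∧
      (∀ t : ℝ, (g (exp (t * I))).re = h (t + (g (exp (t * I))).im)) ∧
      (∀ z, ‖z‖ < 1 → ‖g z‖ ≤ η * (1 + 2 / (1 - ‖z‖))) ∧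
      ∀ s : ℝ, (2 * Real.pi)⁻¹ * ∫ t in (0 : ℝ)..2 * Real.pi,
        ‖g (exp ((t + s : ℝ) * I)) - g (exp (t * I))‖ ^ 2 ≤ s ^ 2 := by
  have hcont : Continuous h := by
    refine (LipschitzWith.of_dist_le_mul (K := 1 / 8) fun a b => ?_).continuous
    simpa [Real.dist_eq] using hl a b
  set H := periodicLift h hcont hp
  have hH : ∀ (x : AddCircle (2 * Real.pi)) (a b : ℝ),
      |H (x + a) - H (x + b)| ≤ 1 / 8 * |a - b| := by
    intro x a b
    induction x using QuotientAddGroup.induction_on with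
    | H t =>
      have := hl (t + a) (t + b)
      rw [add_sub_add_left_eq_sub] at this
      exact this
  obtain ⟨c, hc, hfix⟩ := exists_theodorsen_fixedPoint (by norm_num) le_rfl hH
  have hs := summable_norm_of_sobolev hc
  set f := displaced H c with hf
  have him : ∀ x, (f x).im = 0 := fun x => ofReal_im _
  have hcf : (fun k : ℕ => 2 * fourierCoeff f ((k : ℤ) + 1)) = c := funext fun k => (hfix k).symm
  have hre := eq_re_circSeries_of_real f him (by simpa only [← hfix] using hs)
  rw [hcf] at hre
  have hfη : ∀ x, ‖f x‖ ≤ η := by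
    intro x
    induction x using QuotientAddGroup.induction_on with
    | H t =>
      have := hη (t + (circSeries c (t : AddCircle (2 * Real.pi))).im)
      rw [hf]
      simp only [displaced, ContinuousMap.coe_mk, norm_real, Real.norm_eq_abs]
      exact this
  have h0im : (fourierCoeff f 0).im = 0 := fourierCoeff_zero_im him
  refine ⟨discExt (fourierCoeff f 0) c, continuousOn_discExt _ hs, differentiableOn_discExt _ hs,
    fun t => ?_, fun z hz => norm_discExt_le (norm_fourierCoeff_le hfη 0) (fun k => ?_) hz,
    fun s => ?_⟩
  · rw [discExt_exp _ hs, add_re, add_im, h0im, zero_add, ← hre]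
    rfl
  · rw [hfix, norm_mul]
    simpa using norm_fourierCoeff_le hfη ((k : ℤ) + 1)
  · have h1 := integral_norm_circSeries_shift_sq_le hc s
    rw [integral_haarAddCircle_eq, one_mul] at h1
    refine le_trans (le_of_eq ?_) h1
    congr 1
    refine intervalIntegral.integral_congr fun t _ => ?_
    simp only [discExt_exp _ hs, add_sub_add_left_eq_sub, AddCircle.coe_add]

theorem exists_disc_of_im {a : ℝ → ℝ} (ha : Continuous a)
    (hp : Function.Periodic a (2 * Real.pi)) {C : ℝ}
    (hC : ∀ s : ℝ, (2 * Real.pi)⁻¹ * ∫ t in (0 : ℝ)..2 * Real.pi, |a (t + s) - a t| ^ 2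
      ≤ C * s ^ 2) :
    ∃ q : ℂ → ℂ, ContinuousOn q (closedBall 0 1) ∧ DifferentiableOn ℂ q (ball 0 1) ∧
      (q 0).re = 0 ∧ ∀ t : ℝ, (q (exp (t * I))).im = a t := by
  set f : C(AddCircle (2 * Real.pi), ℂ) :=
    periodicLift (fun t => (a t : ℂ)) (continuous_ofReal.comp ha) (fun t => by simp [hp t])
  have him : ∀ x, (f x).im = 0 := by
    intro x
    induction x using QuotientAddGroup.induction_on with
    | H t => exact ofReal_im _
  have hshift : ∀ s : ℝ, ∫ x, ‖f (x + (s : AddCircle (2 * Real.pi))) - f x‖ ^ 2 ∂haarAddCircle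
      ≤ C * s ^ 2 := by
    intro s
    rw [integral_haarAddCircle_eq]
    refine le_trans (le_of_eq ?_) (hC s)
    congr 1
    refine intervalIntegral.integral_congr fun t _ => ?_
    change ‖((a (t + s) : ℝ) : ℂ) - ((a t : ℝ) : ℂ)‖ ^ 2 = _
    rw [← ofReal_sub, norm_real, Real.norm_eq_abs]
  have hsum := sum_sq_mul_fourierCoeff_le f hshift
  set c : ℕ → ℂ := fun k => 2 * fourierCoeff f ((k : ℤ) + 1)
  have hs : Summable fun k => ‖c k‖ := by
    refine summable_norm_of_sobolev (B := 4 * C) fun s => ?_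
    have h := hsum (s.map ⟨fun k : ℕ => (k : ℤ) + 1, fun a b h => by simpa using h⟩)
    rw [Finset.sum_map] at h
    calc _ = 4 * ∑ k ∈ s, (((k : ℤ) + 1 : ℤ) : ℝ) ^ 2 * ‖fourierCoeff f ((k : ℤ) + 1)‖ ^ 2 := by
          rw [Finset.mul_sum]
          refine Finset.sum_congr rfl fun k _ => ?_
          rw [norm_mul]; push_cast; simp; ring
      _ ≤ 4 * C := by gcongr; exact h
  have hre := eq_re_circSeries_of_real f him hs
  refine ⟨fun z => I * discExt (fourierCoeff f 0) c z,
    continuousOn_const.mul (continuousOn_discExt _ hs),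
    (differentiableOn_const _).mul (differentiableOn_discExt _ hs), ?_, fun t => ?_⟩
  · simp [discExt_zero, fourierCoeff_zero_im him]
  · have h1 := hre (t : AddCircle (2 * Real.pi))
    change (I * discExt (fourierCoeff f 0) c (exp (t * I))).im = a t
    rw [I_mul_im, discExt_exp _ hs, add_re]
    rw [← h1]
    exact ofReal_re _

theorem norm_sub_conj_le {F : ℂ → ℂ} (hF : ContinuousOn F (closedBall 0 1))
    (hd : DifferentiableOn ℂ F (ball 0 1)) {w : ℂ} (hw : ‖w‖ < 1) :
    ‖F w - (starRingEnd ℂ) (F 0)‖ ≤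
      2 / (1 - ‖w‖) * ((2 * Real.pi)⁻¹ * ∫ t in (0 : ℝ)..2 * Real.pi,
        |(F (exp (t * I))).im|) := by
  have hF' : DiffContOnCl ℂ F (ball 0 |1|) :=
    ⟨by simpa using hd, by simpa [closure_ball] using hF⟩
  have hwpos : 0 < 1 - ‖w‖ := by linarith
  have hE : ∀ t : ℝ, ‖exp (t * I)‖ = 1 := Complex.norm_exp_ofReal_mul_I
  have hconjE : ∀ t : ℝ, (starRingEnd ℂ) (exp (t * I)) * exp (t * I) = 1 := by
    intro t
    rw [mul_comm, Complex.mul_conj, Complex.normSq_eq_norm_sq, hE]; simp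
  have hne : ∀ t : ℝ, exp (t * I) - w ≠ 0 := by
    intro t h
    have := congrArg norm (sub_eq_zero.1 h)
    rw [hE] at this; linarith
  have hne2 : ∀ z : ℂ, ‖z‖ ≤ 1 → 1 - (starRingEnd ℂ) w * z ≠ 0 := by
    intro z hz h
    have := congrArg norm (sub_eq_zero.1 h)
    rw [norm_one, norm_mul, RCLike.norm_conj] at this
    nlinarith [norm_nonneg w]
  have hFc : Continuous fun t : ℝ => F (exp (t * I)) :=
    hF.comp_continuous (by fun_prop) (fun t => by simp [hE])
  have hquot : Continuous fun t : ℝ => exp (t * I) / (exp (t * I) - w) :=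
    Continuous.div (by fun_prop) (by fun_prop) hne
  have e1 : (2 * Real.pi)⁻¹ • ∫ t in (0 : ℝ)..2 * Real.pi,
      (exp (t * I) / (exp (t * I) - w)) * F (exp (t * I)) = F w := by
    have := hF'.circleAverage_smul_div (w := w) (by simpa using hw)
    rw [Real.circleAverage_def] at this
    simpa [circleMap_zero] using this
  have e2 : (2 * Real.pi)⁻¹ • ∫ t in (0 : ℝ)..2 * Real.pi,
      F (exp (t * I)) / (1 - (starRingEnd ℂ) w * exp (t * I)) = F 0 := by
    have hG : DiffContOnCl ℂ (fun z => F z / (1 - (starRingEnd ℂ) w * z)) (ball 0 |1|) := by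
      refine ⟨?_, ?_⟩
      · rw [abs_one]
        exact hd.fun_div (by fun_prop) fun z hz => hne2 z
            (by simpa using (ball_subset_closedBall hz))
      · rw [abs_one, closure_ball _ one_ne_zero]
        exact hF.div (by fun_prop) fun z hz => hne2 z (by simpa using hz)
    have := hG.circleAverage
    rw [Real.circleAverage_def] at this
    simpa [circleMap_zero] using this
  have e3 : (2 * Real.pi)⁻¹ • ∫ t in (0 : ℝ)..2 * Real.pi,
      (exp (t * I) / (exp (t * I) - w)) * (starRingEnd ℂ) (F (exp (t * I))) =
      (starRingEnd ℂ) (F 0) := by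
    rw [← e2, Complex.real_smul, Complex.real_smul, map_mul, Complex.conj_ofReal]
    congr 1
    simp only [intervalIntegral.integral_of_le Real.two_pi_pos.le]
    rw [← integral_conj]
    simp only [← intervalIntegral.integral_of_le Real.two_pi_pos.le]
    refine intervalIntegral.integral_congr fun t _ => ?_
    simp only [map_div₀, map_sub, map_one, map_mul, Complex.conj_conj]
    have h1 : 1 - w * (starRingEnd ℂ) (exp (t * I)) ≠ 0 := by
      intro h
      apply hne t
      linear_combination exp (t * I) * h + w * hconjE t
    rw [div_mul_eq_mul_div, div_eq_div_iff (hne t) h1]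
    linear_combination (starRingEnd ℂ) (F (exp (t * I))) * (- w * hconjE t)
  rw [← e1, ← e3, ← smul_sub, ← intervalIntegral.integral_sub]
  · rw [norm_smul, Real.norm_of_nonneg (by positivity)]
    rw [mul_left_comm]
    refine mul_le_mul_of_nonneg_left ?_ (by positivity)
    rw [← intervalIntegral.integral_const_mul]
    refine intervalIntegral.norm_integral_le_of_norm_le (by positivity)
      (Filter.Eventually.of_forall fun t _ => ?_) ?_
    · rw [← mul_sub, norm_mul, Complex.sub_conj, norm_mul, norm_real, norm_div, hE]
      have h1 : 1 - ‖w‖ ≤ ‖exp (t * I) - w‖ := by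
        have := norm_sub_norm_le (exp (t * I)) w
        rwa [hE] at this
      simp only [norm_I, Real.norm_eq_abs, abs_mul, mul_one]
      rw [abs_of_pos (by norm_num : (0 : ℝ) < 2), ← mul_assoc]
      gcongr ?_ * _
      rw [div_mul_eq_mul_div, one_mul]
      gcongr
    · exact (continuous_const.mul (Complex.continuous_im.comp hFc).abs).intervalIntegrable _ _
  · exact (hquot.mul hFc).intervalIntegrable _ _
  · exact (Continuous.intervalIntegrable
      (hquot.mul (Complex.continuous_conj.comp hFc)) _ _)

end Boundary

section ConformalMap

open MeasureTheory

theorem abs_arctan_sub_le (x y : ℝ) : |Real.arctan x - Real.arctan y| ≤ |x - y| := by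
  have := Convex.norm_image_sub_le_of_norm_deriv_le (f := Real.arctan) (C := 1) (s := univ)
    (x := y) (y := x) (fun z _ => Real.differentiableAt_arctan z) (fun z _ => ?_) convex_univ
    (mem_univ _) (mem_univ _)
  · simpa using this
  · rw [Real.deriv_arctan, Real.norm_of_nonneg (by positivity), div_le_one (by positivity)]
    nlinarith [sq_nonneg z]

theorem exists_exp_eq_of_norm_eq_one {z : ℂ} (hz : ‖z‖ = 1) : ∃ t : ℝ, exp (t * I) = z := by
  refine ⟨arg z, ?_⟩
  have := Complex.norm_mul_exp_arg_mul_I z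
  rwa [hz, ofReal_one, one_mul] at this

theorem abs_im_le_of_boundary {q : ℂ → ℂ} (hq : ContinuousOn q (closedBall 0 1))
    (hqd : DifferentiableOn ℂ q (ball 0 1)) {C : ℝ}
    (hC : ∀ t : ℝ, |(q (exp (t * I))).im| ≤ C) {z : ℂ} (hz : ‖z‖ ≤ 1) : |(q z).im| ≤ C := by
  have key : ∀ σ : ℝ, |σ| = 1 → σ * (q z).im ≤ C := by
    intro σ hσ
    have hn : ∀ w, ‖exp (-(σ : ℂ) * I * q w)‖ = Real.exp (σ * (q w).im) := by
      intro w
      rw [norm_exp]; simp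
    have hD : DiffContOnCl ℂ (fun w => exp (-(σ : ℂ) * I * q w)) (ball 0 1) := by
      refine ⟨(hqd.const_mul _).cexp, ?_⟩
      rw [closure_ball _ one_ne_zero]
      exact (continuousOn_const.mul hq).cexp
    have := Complex.norm_le_of_forall_mem_frontier_norm_le isBounded_ball hD (C := Real.exp C)
      (fun w hw => ?_) (z := z) (by rw [closure_ball _ one_ne_zero]; simpa using hz)
    · rw [hn] at this
      exact Real.exp_le_exp.1 this
    · rw [frontier_ball _ one_ne_zero] at hw
      obtain ⟨t, rfl⟩ := exists_exp_eq_of_norm_eq_one (by simpa using hw)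
      rw [hn, Real.exp_le_exp]
      refine (le_abs_self _).trans ?_
      rw [abs_mul, hσ, one_mul]
      exact hC t
  rw [abs_le]
  have h1 := key 1 (by simp)
  have h2 := key (-1) (by simp)
  constructor <;> linarith

theorem exists_conformal_straightening {h k : ℝ → ℝ} {η M : ℝ}
    (hp : Function.Periodic h (2 * Real.pi)) (hkp : Function.Periodic k (2 * Real.pi))
    (hl : ∀ a b, |h a - h b| ≤ 1 / 8 * |a - b|) (hη : ∀ t, |h t| ≤ η)
    (hk : ∀ t, |k t| ≤ 1 / 8) (hM : 0 ≤ M) (hkM : ∀ a b, |k a - k b| ≤ M * |a - b|)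
    (hhk : ∀ a b, |h b - h a - k a * (b - a)| ≤ M * (b - a) ^ 2) :
    ∃ g G : ℂ → ℂ, ContinuousOn g (closedBall 0 1) ∧ DifferentiableOn ℂ g (ball 0 1) ∧
      ContinuousOn G (closedBall 0 1) ∧
      (∀ z, ‖z‖ < 1 → 1 + z * deriv g z = G z) ∧
      (∀ z, ‖z‖ ≤ 1 → 0 < (G z).re ∧ |(G z).im| ≤ (G z).re) ∧
      (∀ t : ℝ, (g (exp (t * I))).re = h (t + (g (exp (t * I))).im)) ∧
      (∀ z, ‖z‖ < 1 → ‖g z‖ ≤ η * (1 + 2 / (1 - ‖z‖))) := by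
  obtain ⟨g, hgc, hgd, hgb, hgn, hgs⟩ := exists_theodorsen hp hl hη
  have hE : ∀ t : ℝ, ‖exp (t * I)‖ = 1 := Complex.norm_exp_ofReal_mul_I
  set γ : ℝ → ℂ := fun t => g (exp (t * I)) with hγ
  have hγc : Continuous γ := hgc.comp_continuous (by fun_prop) (fun t => by simp [hE])
  have hγp : ∀ t, γ (t + 2 * Real.pi) = γ t := by
    intro t
    simp only [hγ]
    congr 1
    push_cast
    rw [add_mul, Complex.exp_periodic]
  set T : ℝ → ℝ := fun t => t + (γ t).im with hT
  have hTc : Continuous T := by fun_prop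
  have hTp : ∀ t, T (t + 2 * Real.pi) = T t + 2 * Real.pi := by
    intro t; simp only [hT, hγp]; ring
  have hTs : ∀ s : ℝ, (2 * Real.pi)⁻¹ * ∫ t in (0 : ℝ)..2 * Real.pi, (T (t + s) - T t) ^ 2
      ≤ 4 * s ^ 2 := by
    intro s
    have h1 := hgs s
    have hpt : ∀ t, (T (t + s) - T t) ^ 2 ≤ 2 * s ^ 2 + 2 * ‖γ (t + s) - γ t‖ ^ 2 := by
      intro t
      have h3 : |(γ (t + s) - γ t).im| ≤ ‖γ (t + s) - γ t‖ := Complex.abs_im_le_norm _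
      have h4 := sq_le_sq' (by linarith [abs_le.1 h3]) ((abs_le.1 h3).2)
      have h5 : T (t + s) - T t = s + (γ (t + s) - γ t).im := by
        simp only [hT, sub_im]; ring
      rw [h5]
      nlinarith [sq_nonneg (s - (γ (t + s) - γ t).im)]
    have h2 : ∫ t in (0 : ℝ)..2 * Real.pi, (T (t + s) - T t) ^ 2 ≤
        ∫ t in (0 : ℝ)..2 * Real.pi, (2 * s ^ 2 + 2 * ‖γ (t + s) - γ t‖ ^ 2) :=
      intervalIntegral.integral_mono_on Real.two_pi_pos.le
        (Continuous.intervalIntegrable (by fun_prop) _ _)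
        (Continuous.intervalIntegrable (by fun_prop) _ _) (fun t _ => hpt t)
    rw [intervalIntegral.integral_add (Continuous.intervalIntegrable (by fun_prop) _ _)
      (Continuous.intervalIntegrable (by fun_prop) _ _), intervalIntegral.integral_const_mul,
      intervalIntegral.integral_const_mul, intervalIntegral.integral_const, sub_zero, smul_eq_mul]
          at h2
    have hpi := Real.two_pi_pos
    calc _ ≤ (2 * Real.pi)⁻¹ * (2 * Real.pi * (2 * s ^ 2) +
          2 * ∫ t in (0 : ℝ)..2 * Real.pi, ‖γ (t + s) - γ t‖ ^ 2) := by gcongr; linarith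
      _ = 2 * s ^ 2 + 2 * ((2 * Real.pi)⁻¹ *
          ∫ t in (0 : ℝ)..2 * Real.pi, ‖γ (t + s) - γ t‖ ^ 2) := by
          rw [mul_add, ← mul_assoc, inv_mul_cancel₀ hpi.ne']; ring
      _ ≤ 2 * s ^ 2 + 2 * s ^ 2 := by gcongr
      _ = _ := by ring
  have hkc : Continuous k := by
    refine (LipschitzWith.of_dist_le_mul (K := M.toNNReal) fun a b => ?_).continuous
    simpa [Real.dist_eq, hM] using hkM a b
  set a : ℝ → ℝ := fun t => -Real.arctan (k (T t)) with ha
  have hac : Continuous a := by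
    have := Real.continuous_arctan
    fun_prop
  have ha8 : ∀ t, |a t| ≤ 1 / 8 := by
    intro t
    have := abs_arctan_sub_le (k (T t)) 0
    rw [Real.arctan_zero, sub_zero, sub_zero] at this
    simp only [ha, abs_neg]
    exact this.trans (hk _)
  have hash : ∀ s : ℝ, (2 * Real.pi)⁻¹ * ∫ t in (0 : ℝ)..2 * Real.pi, |a (t + s) - a t| ^ 2
      ≤ (M ^ 2 * 4) * s ^ 2 := by
    intro s
    have hpt : ∀ t, |a (t + s) - a t| ^ 2 ≤ M ^ 2 * (T (t + s) - T t) ^ 2 := by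
      intro t
      have h1 := abs_arctan_sub_le (k (T t)) (k (T (t + s)))
      have h2 := hkM (T t) (T (t + s))
      have h3 : |a (t + s) - a t| ≤ M * |T (t + s) - T t| := by
        rw [abs_sub_comm (T (t + s))]
        refine le_trans (le_of_eq ?_) (h1.trans h2)
        simp only [ha]; congr 1; ring
      calc _ ≤ (M * |T (t + s) - T t|) ^ 2 := by gcongr
        _ = _ := by rw [mul_pow, sq_abs]
    calc _ ≤ (2 * Real.pi)⁻¹ * ∫ t in (0 : ℝ)..2 * Real.pi, M ^ 2 * (T (t + s) - T t) ^ 2 := by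
          gcongr
          exact intervalIntegral.integral_mono_on Real.two_pi_pos.le
            (Continuous.intervalIntegrable (by fun_prop) _ _)
            (Continuous.intervalIntegrable (by fun_prop) _ _) (fun t _ => hpt t)
      _ = M ^ 2 * ((2 * Real.pi)⁻¹ * ∫ t in (0 : ℝ)..2 * Real.pi, (T (t + s) - T t) ^ 2) := by
          rw [intervalIntegral.integral_const_mul]; ring
      _ ≤ M ^ 2 * (4 * s ^ 2) :=
          mul_le_mul_of_nonneg_left (hTs s) (by positivity)
      _ = _ := by ring
  obtain ⟨q, hqc, hqd, hq0, hqa⟩ := exists_disc_of_im hac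
    (fun t => by simp only [ha, hTp, hkp (T t)]) hash
  have hqim : ∀ z, ‖z‖ ≤ 1 → |(q z).im| ≤ 1 / 8 := fun z hz =>
    abs_im_le_of_boundary hqc hqd (fun t => by rw [hqa]; exact ha8 t) hz
  obtain ⟨B, hB⟩ := (isCompact_closedBall (0 : ℂ) 1).exists_bound_of_continuousOn hqc
  set F : ℝ → ℂ → ℂ := fun s z =>
    (1 + (g (z * exp (s * I)) - g z) / (s * I)) * exp (-q z) with hF
  have hrotc : ∀ s : ℝ, ContinuousOn (fun z => g (z * exp (s * I))) (closedBall 0 1) := fun s =>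
    hgc.comp (by fun_prop) fun z hz => by simpa [hE] using hz
  have hrotd : ∀ s : ℝ, DifferentiableOn ℂ (fun z => g (z * exp (s * I))) (ball 0 1) := fun s =>
    hgd.comp (by fun_prop) fun z hz => by simpa [hE] using hz
  have hFc : ∀ s, ContinuousOn (F s) (closedBall 0 1) := fun s =>
    (continuousOn_const.add (((hrotc s).sub hgc).div_const _)).mul hqc.neg.cexp
  have hFd : ∀ s, DifferentiableOn ℂ (F s) (ball 0 1) := fun s =>
    ((differentiableOn_const _).add (((hrotd s).sub hgd).div_const _)).mul hqd.neg.cexp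
  have hFim : ∀ s : ℝ, 0 < s → ∀ t : ℝ, |(F s (exp (t * I))).im| ≤
      (M * Real.exp B / s) * (T (t + s) - T t) ^ 2 := by
    intro s hs t
    set κ := k (T t)
    set r := h (T (t + s)) - h (T t) - κ * (T (t + s) - T t) with hr
    have hrb : |r| ≤ M * (T (t + s) - T t) ^ 2 := hhk _ _
    have hu : -(q (exp (t * I))).re ≤ B :=
      (neg_le_abs _).trans ((Complex.abs_re_le_norm _).trans (hB _ (by simp [hE])))
    have hrot : g (exp (t * I) * exp (s * I)) = γ (t + s) := by
      rw [← Complex.exp_add]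
      simp only [hγ]; congr 2; push_cast; ring
    have h1 : 1 + (g (exp (t * I) * exp (s * I)) - g (exp (t * I))) / (s * I) =
        (((T (t + s) - T t : ℝ) : ℂ) * (1 - κ * I) - r * I) / s := by
      rw [hrot]
      have e1 : γ (t + s) = (h (T (t + s)) : ℝ) + ((γ (t + s)).im : ℝ) * I := by
        have : (γ (t + s)).re = h (T (t + s)) := hgb (t + s)
        rw [← this]; exact (Complex.re_add_im _).symm
      have e2 : g (exp (t * I)) = (h (T t) : ℝ) + ((γ t).im : ℝ) * I := by
        have : (γ t).re = h (T t) := hgb t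
        rw [← this]; exact (Complex.re_add_im _).symm
      rw [e1, e2]
      have hs' : (s : ℂ) ≠ 0 := by exact_mod_cast hs.ne'
      have hT1 : (γ (t + s)).im = T (t + s) - t - s := by simp only [hT]; ring
      have hT2 : (γ t).im = T t - t := by simp only [hT]; ring
      rw [hT1, hT2, hr]
      push_cast
      field_simp
      ring_nf
      simp only [I_sq]
      ring
    have h2 : exp (-q (exp (t * I))) =
        ((Real.exp (-(q (exp (t * I))).re) * Real.cos (Real.arctan κ) : ℝ) : ℂ) *
          (1 + κ * I) := by
      have e1 : -q (exp (t * I)) = ((-(q (exp (t * I))).re : ℝ) : ℂ) +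
          ((Real.arctan κ : ℝ) : ℂ) * I := by
        have : (q (exp (t * I))).im = -Real.arctan κ := hqa t
        apply Complex.ext
        · simp [-ofReal_arctan]
        · simp [-ofReal_arctan, this]
      have e3 : Real.sin (Real.arctan κ) = κ * Real.cos (Real.arctan κ) := by
        have h1 := Real.tan_arctan κ
        rw [Real.tan_eq_sin_div_cos, div_eq_iff (Real.cos_arctan_pos κ).ne'] at h1
        exact h1
      rw [e1, Complex.exp_add, Complex.exp_mul_I ((Real.arctan κ : ℝ) : ℂ), ← ofReal_cos, ←
          ofReal_sin, e3, ← ofReal_exp]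
      push_cast; ring
    have h3 : (F s (exp (t * I))).im =
        -(r * (Real.exp (-(q (exp (t * I))).re) * Real.cos (Real.arctan κ))) / s := by
      simp only [hF]
      rw [h1, h2]
      set E := Real.exp (-(q (exp (t * I))).re) * Real.cos (Real.arctan κ)
      have : (((T (t + s) - T t : ℝ) : ℂ) * (1 - κ * I) - r * I) / s * ((E : ℂ) * (1 + κ * I)) =
          (((T (t + s) - T t) * (1 + κ ^ 2) * E / s + r * E * κ / s : ℝ) : ℂ) +
          ((-(r * E) / s : ℝ) : ℂ) * I := by
        have hs' : (s : ℂ) ≠ 0 := by exact_mod_cast hs.ne'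
        push_cast
        field_simp
        ring_nf
        simp only [I_sq]
        ring
      rw [this, add_im, ofReal_im, zero_add, Complex.mul_I_im, ofReal_re]
    rw [h3, abs_div, abs_neg, abs_mul, abs_mul, abs_of_pos hs, abs_of_pos (Real.exp_pos _),
      abs_of_pos (Real.cos_arctan_pos κ)]
    have hexp : Real.exp (-(q (exp (t * I))).re) * Real.cos (Real.arctan κ) ≤ Real.exp B * 1 :=
      mul_le_mul (Real.exp_le_exp.2 hu) (Real.cos_le_one _) (Real.cos_arctan_pos κ).le
        (Real.exp_pos _).le
    calc _ ≤ (M * (T (t + s) - T t) ^ 2) * (Real.exp B * 1) / s := by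
          have := (Real.cos_arctan_pos κ).le
          gcongr
      _ = _ := by ring
  have hFavg : ∀ s : ℝ, 0 < s → (2 * Real.pi)⁻¹ * ∫ t in (0 : ℝ)..2 * Real.pi,
      |(F s (exp (t * I))).im| ≤ 4 * M * Real.exp B * s := by
    intro s hs
    have hFcc : Continuous fun t : ℝ => F s (exp (t * I)) :=
      (hFc s).comp_continuous (by fun_prop) (fun t => by simp [hE])
    calc _ ≤ (2 * Real.pi)⁻¹ * ∫ t in (0 : ℝ)..2 * Real.pi,
          (M * Real.exp B / s) * (T (t + s) - T t) ^ 2 := by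
          gcongr
          exact intervalIntegral.integral_mono_on Real.two_pi_pos.le
            (Continuous.intervalIntegrable (Complex.continuous_im.comp hFcc).abs _ _)
            (Continuous.intervalIntegrable (by fun_prop) _ _) (fun t _ => hFim s hs t)
      _ = (M * Real.exp B / s) * ((2 * Real.pi)⁻¹ *
          ∫ t in (0 : ℝ)..2 * Real.pi, (T (t + s) - T t) ^ 2) := by
          rw [intervalIntegral.integral_const_mul]; ring
      _ ≤ (M * Real.exp B / s) * (4 * s ^ 2) :=
          mul_le_mul_of_nonneg_left (hTs s) (by positivity)
      _ = _ := by field_simp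
  have hlim : ∀ w : ℂ, ‖w‖ < 1 →
      (1 + w * deriv g w) * exp (-q w) = (starRingEnd ℂ) (exp (-q 0)) := by
    intro w hw
    have hF0 : ∀ s, F s 0 = exp (-q 0) := by intro s; simp [hF]
    have hder : HasDerivAt (fun s : ℝ => g (w * exp (s * I))) (deriv g w * (w * I)) 0 := by
      have h1 : HasDerivAt g (deriv g w) (w * exp ((0 : ℝ) * I)) := by
        have : DifferentiableAt ℂ g w := (hgd w (by simpa using hw)).differentiableAt
          (isOpen_ball.mem_nhds (by simpa using hw))
        simpa using this.hasDerivAt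
      have h2 : HasDerivAt (fun s : ℝ => w * exp (s * I)) (w * I) 0 := by
        have h3 : HasDerivAt (fun s : ℝ => (s : ℂ) * I) I 0 := by
          simpa using (Complex.ofRealCLM.hasDerivAt (x := 0)).mul_const I
        have := (h3.cexp).const_mul w
        simpa using this
      exact h1.comp (0 : ℝ) h2
    have hten : Filter.Tendsto (fun s => F s w) (nhdsWithin 0 (Ioi 0))
        (nhds ((1 + w * deriv g w) * exp (-q w))) := by
      have h1 := (hasDerivAt_iff_tendsto_slope_zero.1 hder).mono_left
        (nhdsWithin_mono 0 (fun s (hs : 0 < s) => hs.ne'))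
      refine Filter.Tendsto.mul_const _ (tendsto_const_nhds.add ?_)
      have h2 := h1.div_const I
      have h3 : deriv g w * (w * I) / I = w * deriv g w := by
        field_simp
      rw [h3] at h2
      refine h2.congr fun s => ?_
      simp only [zero_add, ofReal_zero, zero_mul, Complex.exp_zero, mul_one, Complex.real_smul]
      rw [ofReal_inv, div_mul_eq_div_div, inv_mul_eq_div]
    have hbd : Filter.Tendsto (fun s : ℝ => 2 / (1 - ‖w‖) * (4 * M * Real.exp B * s))
        (nhdsWithin 0 (Ioi 0)) (nhds 0) := by
      have : Filter.Tendsto (fun s : ℝ => 2 / (1 - ‖w‖) * (4 * M * Real.exp B * s)) (nhds 0)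
          (nhds (2 / (1 - ‖w‖) * (4 * M * Real.exp B * 0))) :=
        Continuous.tendsto (by fun_prop) 0
      rw [mul_zero, mul_zero] at this
      exact this.mono_left nhdsWithin_le_nhds
    have hzero : Filter.Tendsto (fun s => F s w - (starRingEnd ℂ) (exp (-q 0)))
        (nhdsWithin 0 (Ioi 0)) (nhds 0) := by
      refine squeeze_zero_norm' (Filter.eventually_of_mem self_mem_nhdsWithin fun s hs => ?_) hbd
      have h1 := norm_sub_conj_le (hFc s) (hFd s) hw
      rw [hF0] at h1
      refine h1.trans ?_
      have : 0 < 1 - ‖w‖ := by linarith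
      exact mul_le_mul_of_nonneg_left (hFavg s hs) (by positivity)
    have h1 := tendsto_nhds_unique (hten.sub_const ((starRingEnd ℂ) (exp (-q 0)))) hzero
    exact sub_eq_zero.1 h1
  have hq00 : q 0 = 0 := by
    have h1 := hlim 0 (by simp)
    rw [zero_mul, add_zero, one_mul] at h1
    have h2 := Complex.conj_eq_iff_im.1 h1.symm
    have h3 : |(q 0).im| ≤ 1 / 8 := hqim 0 (by simp)
    rw [Complex.exp_im, neg_re, hq0, neg_im, neg_zero, Real.exp_zero, one_mul, Real.sin_neg,
      neg_eq_zero] at h2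
    have hpi := Real.pi_gt_three
    have h4 := (Real.sin_eq_zero_iff_of_lt_of_lt (by linarith [abs_le.1 h3])
      (by linarith [abs_le.1 h3])).1 h2
    exact Complex.ext hq0 h4
  refine ⟨g, fun z => exp (q z), hgc, hgd, hqc.cexp, fun z hz => ?_, fun z hz => ?_, hgb, hgn⟩
  · have h1 := hlim z hz
    rw [hq00, neg_zero, Complex.exp_zero, map_one, Complex.exp_neg,
      mul_inv_eq_one₀ (Complex.exp_ne_zero _)] at h1
    exact h1
  · have h1 := hqim z hz
    have hcos := Real.one_sub_sq_div_two_le_cos (x := (q z).im)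
    have hsin := Real.abs_sin_le_abs (x := (q z).im)
    have hsq : (q z).im ^ 2 ≤ 1 / 64 := by
      have := abs_le.1 h1; nlinarith
    have he := Real.exp_pos (q z).re
    rw [Complex.exp_re, Complex.exp_im, abs_mul, abs_of_pos he]
    refine ⟨mul_pos he (by linarith), mul_le_mul_of_nonneg_left (by linarith) he.le⟩

theorem exists_re_mul_sub_eq {g G : ℂ → ℂ} (hgd : DifferentiableOn ℂ g (ball 0 1))
    (hG : ∀ z, ‖z‖ < 1 → 1 + z * deriv g z = G z) {a b : ℂ} (ha : a.re < 0) (hb : b.re < 0)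
    (c : ℂ) : ∃ ξ : ℂ, ‖ξ‖ < 1 ∧
      (c * ((b + g (exp b)) - (a + g (exp a)))).re = (c * ((b - a) * G ξ)).re := by
  set p : ℝ → ℂ := fun τ => a + τ * (b - a)
  have hp : ∀ τ ∈ Icc (0 : ℝ) 1, ‖exp (p τ)‖ < 1 := by
    intro τ hτ
    rw [norm_exp, Real.exp_lt_one_iff]
    have : (p τ).re = (1 - τ) * a.re + τ * b.re := by simp [p]; ring
    rw [this]
    rcases eq_or_lt_of_le hτ.1 with h | h
    · rw [← h]; simpa using ha
    · nlinarith [hτ.2, mul_nonneg (sub_nonneg.2 hτ.2) (neg_pos.2 ha).le, mul_pos h (neg_pos.2 hb)]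
  have hder : ∀ τ ∈ Icc (0 : ℝ) 1, HasDerivAt (fun τ : ℝ => (c * (p τ + g (exp (p τ)))).re)
      (c * ((b - a) * G (exp (p τ)))).re τ := by
    intro τ hτ
    have h1 : HasDerivAt p (b - a) τ := by
      have := (Complex.ofRealCLM.hasDerivAt (x := τ)).mul_const (b - a)
      simp only [ofRealCLM_apply, ofReal_one, one_mul] at this
      exact this.const_add a
    have h2 : HasDerivAt g (deriv g (exp (p τ))) (exp (p τ)) :=
      ((hgd _ (by simpa using hp τ hτ)).differentiableAt
        (isOpen_ball.mem_nhds (by simpa using hp τ hτ))).hasDerivAt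
    have h3 := h2.comp τ h1.cexp
    have h4 := (h1.add h3).const_mul c
    have h5 := Complex.reCLM.hasFDerivAt.comp_hasDerivAt τ h4
    rw [← hG _ (hp τ hτ)]
    convert! h5 using 1
    simp only [reCLM_apply]
    congr 1
    ring
  obtain ⟨τ, hτ, h⟩ := exists_hasDerivAt_eq_slope
    (fun τ : ℝ => (c * (p τ + g (exp (p τ)))).re) (fun τ => (c * ((b - a) * G (exp (p τ)))).re)
    zero_lt_one (fun τ hτ => (hder τ hτ).continuousAt.continuousWithinAt)
    (fun τ hτ => hder τ (Ioo_subset_Icc_self hτ))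
  refine ⟨exp (p τ), hp τ (Ioo_subset_Icc_self hτ), ?_⟩
  rw [h]
  simp [p]
  ring

theorem le_re_mul_sub {g G : ℂ → ℂ} (hgc : ContinuousOn g (closedBall 0 1))
    (hgd : DifferentiableOn ℂ g (ball 0 1))
    (hG : ∀ z, ‖z‖ < 1 → 1 + z * deriv g z = G z) {a b : ℂ} (ha : a.re ≤ 0) (hb : b.re ≤ 0)
    {c : ℂ} {m : ℝ} (hm : ∀ ξ, ‖ξ‖ < 1 → m ≤ (c * ((b - a) * G ξ)).re) :
    m ≤ (c * ((b + g (exp b)) - (a + g (exp a)))).re := by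
  have hcont : ∀ a : ℂ, a.re ≤ 0 → Filter.Tendsto (fun δ : ℝ => (a - δ) + g (exp (a - δ)))
      (nhdsWithin 0 (Ioi 0)) (nhds (a + g (exp a))) := by
    intro a ha
    have h1 : ContinuousOn (fun δ : ℝ => (a - δ) + g (exp (a - δ))) (Ici 0) := by
      refine ContinuousOn.add (by fun_prop) (hgc.comp (by fun_prop) fun δ hδ => ?_)
      rw [mem_closedBall_zero_iff, norm_exp, Real.exp_le_one_iff, sub_re, ofReal_re]
      linarith [mem_Ici.1 hδ]
    have h2 := (h1 0 self_mem_Ici).tendsto.mono_left (nhdsWithin_mono 0 Ioi_subset_Ici_self)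
    simpa using h2
  have hlim := ((hcont b hb).sub (hcont a ha)).const_mul c
  refine ge_of_tendsto ((Complex.continuous_re.tendsto _).comp hlim)
    (Filter.eventually_of_mem self_mem_nhdsWithin fun δ hδ => ?_)
  obtain ⟨ξ, hξ, h⟩ := exists_re_mul_sub_eq hgd hG (a := a - δ) (b := b - δ)
    (by rw [sub_re, ofReal_re]; linarith [mem_Ioi.1 hδ])
    (by rw [sub_re, ofReal_re]; linarith [mem_Ioi.1 hδ]) c
  simp only [Function.comp]
  rw [h, sub_sub_sub_cancel_right]
  exact hm ξ hξ

theorem exists_conformal_map {h k : ℝ → ℝ} {η M : ℝ}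
    (hp : Function.Periodic h (2 * Real.pi)) (hkp : Function.Periodic k (2 * Real.pi))
    (hl : ∀ a b, |h a - h b| ≤ 1 / 8 * |a - b|) (hη : ∀ t, |h t| ≤ η)
    (hk : ∀ t, |k t| ≤ 1 / 8) (hM : 0 ≤ M) (hkM : ∀ a b, |k a - k b| ≤ M * |a - b|)
    (hhk : ∀ a b, |h b - h a - k a * (b - a)| ≤ M * (b - a) ^ 2) :
    ∃ φ ψ g : ℂ → ℂ, ContinuousOn φ (closedBall 0 1) ∧ ContinuousOn ψ (closedBall 0 1) ∧
      (∀ z, ‖z‖ < 1 → HasDerivAt φ (ψ z) z) ∧ (∀ z, ‖z‖ ≤ 1 → ψ z ≠ 0) ∧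
      InjOn φ (closedBall 0 1) ∧
      (∀ z, ‖z‖ = 1 → ∃ t : ℝ, φ z = exp (h t + t * I)) ∧
      (∀ z, ‖z‖ < 1 → φ z = 0 ∨ ∃ x t : ℝ, x < h t ∧ φ z = exp (x + t * I)) ∧
      (∀ z, φ z = z * exp (g z)) ∧
      (∀ z, ‖z‖ < 1 → ‖g z‖ ≤ η * (1 + 2 / (1 - ‖z‖))) := by
  obtain ⟨g, G, hgc, hgd, hGc, hG, hGre, hgb, hgn⟩ :=
    exists_conformal_straightening hp hkp hl hη hk hM hkM hhk
  obtain ⟨ξ₀, hξ₀, hmin⟩ := (isCompact_closedBall (0 : ℂ) 1).exists_isMinOn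
    ⟨0, by simp⟩ (Complex.continuous_re.comp_continuousOn hGc)
  set m := (G ξ₀).re with hm
  have hmpos : 0 < m := (hGre ξ₀ (by simpa using hξ₀)).1
  have hmle : ∀ ξ, ‖ξ‖ < 1 → m ≤ (G ξ).re := fun ξ hξ => hmin (by simpa using hξ.le)
  have hφexp : ∀ s : ℂ, exp s * exp (g (exp s)) = exp (s + g (exp s)) := fun s =>
    (Complex.exp_add _ _).symm
  have hlog : ∀ z : ℂ, ‖z‖ ≤ 1 → (log z).re ≤ 0 := fun z hz => by
    rw [log_re]; exact Real.log_nonpos (norm_nonneg _) hz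
  have hinj : ∀ a b : ℂ, a.re ≤ 0 → b.re ≤ 0 → a + g (exp a) = b + g (exp b) → a = b := by
    intro a b ha hb hab
    have h1 := le_re_mul_sub hgc hgd hG ha hb (c := (starRingEnd ℂ) (b - a))
      (m := m * ‖b - a‖ ^ 2) (fun ξ hξ => by
        rw [← mul_assoc, mul_comm _ (b - a), Complex.mul_conj, Complex.normSq_eq_norm_sq,
          Complex.re_ofReal_mul, mul_comm]
        exact mul_le_mul_of_nonneg_left (hmle ξ hξ) (sq_nonneg _))
    rw [hab, sub_self, mul_zero, zero_re] at h1
    have h2 : ‖b - a‖ ^ 2 ≤ 0 := by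
      by_contra! h3
      nlinarith [mul_pos hmpos h3]
    have h3 : ‖b - a‖ = 0 := by nlinarith [norm_nonneg (b - a)]
    exact (sub_eq_zero.1 (norm_eq_zero.1 h3)).symm
  refine ⟨fun z => z * exp (g z), fun z => exp (g z) * G z, g, continuousOn_id.mul hgc.cexp,
    hgc.cexp.mul hGc, fun z hz => ?_, fun z hz => ?_, ?_, fun z hz => ?_, fun z hz => ?_,
    fun _ => rfl, hgn⟩
  · have h1 : HasDerivAt g (deriv g z) z := ((hgd z (by simpa using hz)).differentiableAt
      (isOpen_ball.mem_nhds (by simpa using hz))).hasDerivAt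
    have h2 := (hasDerivAt_id z).mul h1.cexp
    change HasDerivAt _ (exp (g z) * G z) z
    rw [← hG z hz]
    convert! h2 using 1
    simp only [id]
    ring
  · refine mul_ne_zero (Complex.exp_ne_zero _) fun h0 => ?_
    have := (hGre z hz).1
    rw [h0, zero_re] at this
    exact this.false
  · intro z hz w hw hzw
    simp only at hzw
    have hz' : ‖z‖ ≤ 1 := by simpa using hz
    have hw' : ‖w‖ ≤ 1 := by simpa using hw
    rcases eq_or_ne z 0 with rfl | hz0
    · rw [zero_mul, eq_comm, mul_eq_zero] at hzw
      exact (hzw.resolve_right (Complex.exp_ne_zero _)).symm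
    have hw0 : w ≠ 0 := by
      rintro rfl
      rw [zero_mul, mul_eq_zero] at hzw
      exact hzw.elim hz0 (Complex.exp_ne_zero _)
    have h1 : exp (log z + g (exp (log z))) = exp (log w + g (exp (log w))) := by
      rw [← hφexp, ← hφexp, exp_log hz0, exp_log hw0, hzw]
    obtain ⟨n, hn⟩ := Complex.exp_eq_exp_iff_exists_int.1 h1
    have hper : exp (log w + n * (2 * Real.pi * I)) = exp (log w) :=
      Complex.exp_eq_exp_iff_exists_int.2 ⟨n, rfl⟩
    have h2 := hinj (log z) (log w + n * (2 * Real.pi * I)) (hlog z hz')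
      (by simpa using hlog w hw') (by rw [hper, hn]; ring)
    rw [← exp_log hz0, h2, hper, exp_log hw0]
  · obtain ⟨t, rfl⟩ := exists_exp_eq_of_norm_eq_one hz
    refine ⟨t + (g (exp (t * I))).im, ?_⟩
    change exp (t * I) * exp (g (exp (t * I))) = _
    rw [← hgb t, hφexp]
    congr 1
    conv_lhs => rw [← Complex.re_add_im (g (exp (t * I)))]
    push_cast; ring
  · rcases eq_or_ne z 0 with rfl | hz0
    · left; simp
    right
    set s := log z with hs
    set t := s.im
    set Z := s + g (exp s) with hZ
    have hsre : s.re < 0 := by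
      rw [hs, log_re]; exact Real.log_neg (norm_pos_iff.2 hz0) hz
    refine ⟨Z.re, Z.im, ?_, by
      simp only
      rw [Complex.re_add_im, hZ, ← hφexp, exp_log hz0]⟩
    set W := (t : ℂ) * I + g (exp (t * I)) with hW
    have hst : (t : ℂ) * I - s = ((-s.re : ℝ) : ℂ) := by
      apply Complex.ext <;> simp [t]
    have hstep : ∀ (c : ℂ) (m' : ℝ), (∀ ξ, ‖ξ‖ < 1 → m' ≤ -s.re * (c * G ξ).re) →
        m' ≤ (c * (W - Z)).re := by
      intro c m' hm'
      refine le_re_mul_sub hgc hgd hG hsre.le (by simp) fun ξ hξ => ?_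
      rw [hst, mul_left_comm, Complex.re_ofReal_mul]
      exact hm' ξ hξ
    have h1 := hstep 1 (-s.re * m) fun ξ hξ => by
      rw [one_mul]; exact mul_le_mul_of_nonneg_left (hmle ξ hξ) (by linarith)
    have h2 := hstep (1 + I) 0 fun ξ hξ => by
      refine mul_nonneg (by linarith) ?_
      have := (hGre ξ hξ.le).2
      rw [add_mul, one_mul, add_re, I_mul_re]
      linarith [abs_le.1 this]
    have h3 := hstep (1 - I) 0 fun ξ hξ => by
      refine mul_nonneg (by linarith) ?_
      have := (hGre ξ hξ.le).2
      rw [sub_mul, one_mul, sub_re, I_mul_re]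
      linarith [abs_le.1 this]
    rw [one_mul, sub_re] at h1
    rw [add_mul, one_mul, add_re, I_mul_re, sub_re, sub_im] at h2
    rw [sub_mul, one_mul, sub_re, I_mul_re, sub_re, sub_im] at h3
    have h4 : W.re = h W.im := by
      have := hgb t
      simpa [hW] using this
    have h5 := hl W.im Z.im
    have h6 : |W.im - Z.im| ≤ W.re - Z.re := abs_le.2 ⟨by linarith, by linarith⟩
    have h7 := mul_pos (neg_pos.2 hsre) hmpos
    have h8 := (abs_le.1 h5).2
    rw [← h4] at h8
    linarith

end ConformalMap

section LevelSet

theorem convex_abs_re_le (η : ℝ) : Convex ℝ {s : ℂ | |s.re| ≤ η} := by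
  have : {s : ℂ | |s.re| ≤ η} = Complex.reLm ⁻¹' Icc (-η) η := by
    ext s; simp [abs_le]
  rw [this]
  exact (convex_Icc _ _).linear_preimage _

theorem exists_mem_segment_fderiv_eq {σ : ℂ → ℝ} {S : Set ℂ} (hS : Convex ℝ S)
    (hσ : ∀ s ∈ S, DifferentiableAt ℝ σ s) {a b : ℂ} (ha : a ∈ S) (hb : b ∈ S) :
    ∃ ξ ∈ S, ‖ξ - a‖ ≤ ‖b - a‖ ∧
      σ b - σ a = (b - a).re * fderiv ℝ σ ξ 1 + (b - a).im * fderiv ℝ σ ξ I := by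
  have hmem : ∀ τ ∈ Icc (0 : ℝ) 1, a + τ • (b - a) ∈ S := fun τ hτ =>
    hS.add_smul_sub_mem ha hb hτ
  have hder : ∀ τ ∈ Icc (0 : ℝ) 1, HasDerivAt (fun τ : ℝ => σ (a + τ • (b - a)))
      (fderiv ℝ σ (a + τ • (b - a)) (b - a)) τ := fun τ hτ => by
    have h1 : HasDerivAt (fun τ : ℝ => a + τ • (b - a)) ((1 : ℝ) • (b - a)) τ :=
      ((hasDerivAt_id τ).smul_const (b - a)).const_add a
    rw [one_smul] at h1
    exact (hσ _ (hmem τ hτ)).hasFDerivAt.comp_hasDerivAt τ h1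
  obtain ⟨τ, hτ, h⟩ := exists_hasDerivAt_eq_slope (fun τ : ℝ => σ (a + τ • (b - a)))
    (fun τ => fderiv ℝ σ (a + τ • (b - a)) (b - a)) zero_lt_one
    (fun τ hτ => (hder τ hτ).continuousAt.continuousWithinAt)
    (fun τ hτ => hder τ (Ioo_subset_Icc_self hτ))
  refine ⟨a + τ • (b - a), hmem τ (Ioo_subset_Icc_self hτ), ?_, ?_⟩
  · rw [add_sub_cancel_left, norm_smul, Real.norm_of_nonneg hτ.1.le]
    exact mul_le_of_le_one_left (norm_nonneg _) hτ.2.le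
  · have h2 : (b - a) = (b - a).re • (1 : ℂ) + (b - a).im • I := by
      conv_lhs => rw [← Complex.re_add_im (b - a)]
      simp
    have h3 : fderiv ℝ σ (a + τ • (b - a)) (b - a) =
        (b - a).re * fderiv ℝ σ (a + τ • (b - a)) 1 + (b - a).im * fderiv ℝ σ (a + τ • (b - a)) I
            := by
      conv_lhs => rw [h2]
      rw [map_add, map_smul, map_smul, ← h2, smul_eq_mul, smul_eq_mul]
    rw [← h3, h]
    simp

theorem exists_bound_of_periodic {F : Type*} [SeminormedAddCommGroup F] {u : ℂ → F} {η : ℝ}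
    (hu : ∀ s : ℂ, |s.re| ≤ η → ContinuousAt u s) (hp : Function.Periodic u (2 * Real.pi * I)) :
    ∃ C, ∀ s : ℂ, |s.re| ≤ η → ‖u s‖ ≤ C := by
  have hK : IsCompact (Icc (-η) η ×ℂ Icc 0 (2 * Real.pi)) := isCompact_Icc.reProdIm isCompact_Icc
  obtain ⟨C, hC⟩ := hK.exists_bound_of_continuousOn (f := u) fun s hs =>
    (hu s (abs_le.2 hs.1)).continuousWithinAt
  refine ⟨C, fun s hs => ?_⟩
  have h2 := hp.sub_zsmul_eq (x := s) (toIcoDiv Real.two_pi_pos 0 s.im)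
  rw [← h2]
  refine hC _ ⟨?_, ?_⟩
  · have : (s - toIcoDiv Real.two_pi_pos 0 s.im • (2 * Real.pi * I)).re = s.re := by simp
    rw [mem_preimage, this]
    exact abs_le.1 hs
  · have : (s - toIcoDiv Real.two_pi_pos 0 s.im • (2 * Real.pi * I)).im
        = toIcoMod Real.two_pi_pos 0 s.im := by
      rw [toIcoMod]; simp
    rw [mem_preimage, this]
    have := toIcoMod_mem_Ico Real.two_pi_pos 0 s.im
    rw [zero_add] at this
    exact Ico_subset_Icc_self this

theorem exists_level_graph {σ : ℂ → ℝ} {η : ℝ} (hη : 0 < η)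
    (hσ : ∀ s : ℂ, |s.re| ≤ η → ContDiffAt ℝ 2 σ s) (hper : Function.Periodic σ (2 * Real.pi * I))
    (hcone : ∀ s : ℂ, |s.re| ≤ η → 8 * |fderiv ℝ σ s I| < fderiv ℝ σ s 1)
    (hneg : ∀ t : ℝ, σ (-η + t * I) < 0) (hpos : ∀ t : ℝ, 0 < σ (η + t * I)) :
    ∃ (h k : ℝ → ℝ) (M : ℝ), Function.Periodic h (2 * Real.pi) ∧
      Function.Periodic k (2 * Real.pi) ∧ (∀ a b, |h a - h b| ≤ 1 / 8 * |a - b|) ∧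
      (∀ t, |h t| ≤ η) ∧ (∀ t, |k t| ≤ 1 / 8) ∧ 0 ≤ M ∧ (∀ a b, |k a - k b| ≤ M * |a - b|) ∧
      (∀ a b, |h b - h a - k a * (b - a)| ≤ M * (b - a) ^ 2) ∧
      (∀ t : ℝ, σ (h t + t * I) = 0) ∧
      (∀ x t : ℝ, -η ≤ x → x < h t → σ (x + t * I) < 0) := by
  have hS := convex_abs_re_le η
  have hd : ∀ s ∈ {s : ℂ | |s.re| ≤ η}, DifferentiableAt ℝ σ s := fun s hs =>
    (hσ s hs).differentiableAt (by norm_num)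
  have hre : ∀ x t : ℝ, ((x : ℂ) + t * I).re = x := by simp
  have hdiff : ∀ x y t u : ℝ, ((x : ℂ) + t * I) - (y + u * I) = ((x - y : ℝ) : ℂ) + (t - u : ℝ) * I
      :=
    fun x y t u => by push_cast; ring
  have hmono : ∀ x y t : ℝ, |x| ≤ η → |y| ≤ η → x < y → σ (x + t * I) < σ (y + t * I) := by
    intro x y t hx hy hxy
    obtain ⟨ξ, hξ, -, h⟩ := exists_mem_segment_fderiv_eq hS hd (a := x + t * I) (b := y + t * I)
      (by simpa using hx) (by simpa using hy)
    rw [hdiff] at h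
    simp at h
    have h1 : 0 < fderiv ℝ σ ξ 1 := (by positivity : 0 ≤ 8 * |fderiv ℝ σ ξ I|).trans_lt (hcone ξ hξ)
    nlinarith [mul_pos (sub_pos.2 hxy) h1]
  have hex : ∀ t : ℝ, ∃ x : ℝ, |x| ≤ η ∧ σ (x + t * I) = 0 := by
    intro t
    have hc : ContinuousOn (fun x : ℝ => σ (x + t * I)) (Icc (-η) η) := fun x hx =>
      ContinuousAt.continuousWithinAt <|
        ContinuousAt.comp (f := fun x : ℝ => (x : ℂ) + t * I) (g := σ)
          (hd (x + t * I) (by rw [mem_ofPred_eq, hre]; exact abs_le.2 hx)).continuousAt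
              (by fun_prop)
    obtain ⟨x, hx, h⟩ := intermediate_value_Icc (by linarith) hc (show (0 : ℝ) ∈ _ from
      ⟨by simpa using (hneg t).le, (hpos t).le⟩)
    exact ⟨x, abs_le.2 hx, h⟩
  choose h hh h0 using hex
  have huniq : ∀ x t : ℝ, |x| ≤ η → σ (x + t * I) = 0 → x = h t := by
    intro x t hx hx0
    by_contra hne
    rcases lt_or_gt_of_ne hne with hlt | hlt
    · have := hmono _ _ t hx (hh t) hlt
      rw [hx0, h0] at this; exact this.false
    · have := hmono _ _ t (hh t) hx hlt
      rw [hx0, h0] at this; exact this.false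
  have hσp : ∀ x t : ℝ, σ (x + ((t + 2 * Real.pi : ℝ) : ℂ) * I) = σ (x + t * I) := fun x t => by
    rw [← hper (x + t * I)]
    congr 1; push_cast; ring
  set κ : ℂ → ℝ := fun s => -(fderiv ℝ σ s I) / fderiv ℝ σ s 1 with hκ
  have hpp : ∀ s ∈ {s : ℂ | |s.re| ≤ η}, 0 < fderiv ℝ σ s 1 := fun s hs =>
    (by positivity : 0 ≤ 8 * |fderiv ℝ σ s I|).trans_lt (hcone s hs)
  have hκ8 : ∀ s ∈ {s : ℂ | |s.re| ≤ η}, |κ s| ≤ 1 / 8 := by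
    intro s hs
    rw [hκ, abs_div, abs_neg, abs_of_pos (hpp s hs), div_le_iff₀ (hpp s hs)]
    linarith [hcone s hs]
  have hκd : ∀ s ∈ {s : ℂ | |s.re| ≤ η}, ContDiffAt ℝ 1 κ s := by
    intro s hs
    have h1 : ContDiffAt ℝ 1 (fderiv ℝ σ) s := (hσ s hs).fderiv_right (by norm_num)
    exact ContDiffAt.div (h1.clm_apply contDiffAt_const).neg (h1.clm_apply contDiffAt_const)
      (hpp s hs).ne'
  have hfp : Function.Periodic (fderiv ℝ σ) (2 * Real.pi * I) := fun s => by
    rw [← fderiv_comp_add_right]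
    congr 1; funext s; exact hper s
  have hκp : Function.Periodic κ (2 * Real.pi * I) := fun s => by simp only [hκ, hfp s]
  obtain ⟨C, hC⟩ := exists_bound_of_periodic (u := fderiv ℝ κ) (η := η)
    (fun s hs => ((hκd s hs).fderiv_right (m := 0) (by norm_num)).continuousAt) (fun s => by
      rw [← fderiv_comp_add_right]
      congr 1; funext s; exact hκp s)
  have hC0 : 0 ≤ C := (norm_nonneg _).trans (hC 0 (by simpa using hη.le))
  have hκL : ∀ a ∈ {s : ℂ | |s.re| ≤ η}, ∀ b ∈ {s : ℂ | |s.re| ≤ η}, |κ b - κ a| ≤ C * ‖b - a‖ :=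
    fun a ha b hb => hS.norm_image_sub_le_of_norm_fderiv_le
      (fun s hs => (hκd s hs).differentiableAt one_ne_zero) (fun s hs => hC s hs) ha hb
  have hmem : ∀ t : ℝ, ((h t : ℂ) + t * I) ∈ {s : ℂ | |s.re| ≤ η} := fun t => by
    rw [mem_ofPred_eq, hre]; exact hh t
  have hseg : ∀ a b : ℝ, ∃ ξ ∈ {s : ℂ | |s.re| ≤ η},
      ‖ξ - (h a + a * I)‖ ≤ ‖((h b : ℂ) + b * I) - (h a + a * I)‖ ∧
      h b - h a = κ ξ * (b - a) := by
    intro a b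
    obtain ⟨ξ, hξ, hn, he⟩ := exists_mem_segment_fderiv_eq hS hd (hmem a) (hmem b)
    refine ⟨ξ, hξ, hn, ?_⟩
    rw [h0, h0, hdiff] at he
    simp at he
    rw [hκ, div_mul_eq_mul_div, eq_div_iff (hpp ξ hξ).ne']
    linarith
  have hlip : ∀ a b, |h b - h a| ≤ 1 / 8 * |b - a| := fun a b => by
    obtain ⟨ξ, hξ, -, he⟩ := hseg a b
    rw [he, abs_mul]
    exact mul_le_mul_of_nonneg_right (hκ8 ξ hξ) (abs_nonneg _)
  have hn : ∀ a b : ℝ, ‖((h b : ℂ) + b * I) - (h a + a * I)‖ ≤ 9 / 8 * |b - a| := fun a b => by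
    rw [hdiff]
    refine (norm_add_le _ _).trans ?_
    rw [norm_mul, norm_I, mul_one, norm_real, norm_real, Real.norm_eq_abs, Real.norm_eq_abs]
    linarith [hlip a b]
  refine ⟨h, fun t => κ (h t + t * I), C * (9 / 8), fun t => ?_, fun t => ?_, fun a b => hlip b a,
      hh,
    fun t => hκ8 _ (hmem t), by positivity, fun a b => ?_, fun a b => ?_, h0, fun x t hx hxh => ?_⟩
  · refine huniq _ _ (hh _) ?_
    rw [← hσp, h0]
  · have : h (t + 2 * Real.pi) = h t := huniq _ _ (hh _) (by rw [← hσp, h0])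
    simp only
    rw [this, ← hκp (h t + t * I)]
    congr 1; push_cast; ring
  · refine (hκL _ (hmem b) _ (hmem a)).trans ?_
    rw [mul_assoc]
    exact mul_le_mul_of_nonneg_left (hn b a) hC0
  · obtain ⟨ξ, hξ, hξn, he⟩ := hseg a b
    rw [he, ← sub_mul, abs_mul, ← sq_abs (b - a), pow_two, ← mul_assoc]
    refine mul_le_mul_of_nonneg_right ?_ (abs_nonneg _)
    refine (hκL _ (hmem a) _ hξ).trans ?_
    rw [mul_assoc]
    exact mul_le_mul_of_nonneg_left (hξn.trans (hn a b)) hC0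
  · rw [← h0 t]
    exact hmono x (h t) t (abs_le.2 ⟨hx, hxh.le.trans (abs_le.1 (hh t)).2⟩) (hh t) hxh

end LevelSet

section LevelDisc

theorem exists_reparametrization {E : Type*} [NormedAddCommGroup E] [NormedSpace ℂ E]
    [CompleteSpace E] {U : Set E} (hU : IsOpen U) {ρ : E → ℝ} (hρ : ContDiffOn ℝ 2 ρ U)
    {F : ℂ → E} (hF : Differentiable ℂ F) {η : ℝ} (hη : 0 < η)
    (hFU : ∀ s : ℂ, |s.re| ≤ η → F (exp s) ∈ U)
    (hcone : ∀ s : ℂ, |s.re| ≤ η →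
      8 * |fderiv ℝ ρ (F (exp s)) (I • exp s • deriv F (exp s))| <
        fderiv ℝ ρ (F (exp s)) (exp s • deriv F (exp s)))
    (hin : ∀ z : ℂ, ‖z‖ ≤ Real.exp (-η) → F z ∈ U ∧ ρ (F z) < 0)
    (hpos : ∀ z : ℂ, ‖z‖ = Real.exp η → 0 < ρ (F z)) :
    ∃ φ ψ g : ℂ → ℂ, ContinuousOn φ (closedBall 0 1) ∧ ContinuousOn ψ (closedBall 0 1) ∧
      (∀ z, ‖z‖ < 1 → HasDerivAt φ (ψ z) z) ∧ (∀ z, ‖z‖ ≤ 1 → ψ z ≠ 0) ∧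
      InjOn φ (closedBall 0 1) ∧ (∀ z, ‖z‖ = 1 → ρ (F (φ z)) = 0) ∧
      (∀ z, ‖z‖ < 1 → F (φ z) ∈ U ∧ ρ (F (φ z)) < 0) ∧
      (∀ z, φ z = z * exp (g z)) ∧ (∀ z, ‖z‖ < 1 → ‖g z‖ ≤ η * (1 + 2 / (1 - ‖z‖))) := by
  set σ : ℂ → ℝ := fun s => ρ (F (exp s)) with hσ
  have hρat : ∀ s : ℂ, |s.re| ≤ η → ContDiffAt ℝ 2 ρ (F (exp s)) := fun s hs =>
    hρ.contDiffAt (hU.mem_nhds (hFU s hs))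
  have hFe : ContDiff ℝ 2 fun s => F (exp s) :=
    (ContDiff.comp hF.contDiff Complex.contDiff_exp).restrict_scalars ℝ
  have hσd : ∀ s : ℂ, |s.re| ≤ η → ContDiffAt ℝ 2 σ s := fun s hs =>
    ContDiffAt.comp s (hρat s hs) hFe.contDiffAt
  have hfd : ∀ s : ℂ, |s.re| ≤ η → ∀ v : ℂ,
      fderiv ℝ σ s v = fderiv ℝ ρ (F (exp s)) (v • exp s • deriv F (exp s)) := by
    intro s hs v
    have h1 : HasDerivAt (fun s => F (exp s)) (exp s • deriv F (exp s)) s :=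
      HasDerivAt.scomp s (hF _).hasDerivAt (Complex.hasDerivAt_exp s)
    have h2 := ((hρat s hs).differentiableAt (by norm_num)).hasFDerivAt.comp s
      (h1.hasFDerivAt.restrictScalars ℝ)
    rw [show fderiv ℝ σ s = _ from h2.fderiv]
    simp
  have hexpper : Function.Periodic σ (2 * Real.pi * I) := fun s => by
    simp only [hσ, Complex.exp_periodic s]
  obtain ⟨h, k, M, hp, hkp, hl, hhη, hk, hM, hkM, hhk, h0, hneg⟩ :=
    exists_level_graph hη hσd hexpper (fun s hs => by
      rw [hfd s hs, hfd s hs, one_smul]; exact hcone s hs)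
      (fun t => (hin _ (by rw [norm_exp]; simp)).2) (fun t => hpos _ (by rw [norm_exp]; simp))
  obtain ⟨φ, ψ, g, hφc, hψc, hφd, hψ0, hφi, hφb, hφin, hφg, hg⟩ :=
    exists_conformal_map hp hkp hl hhη hk hM hkM hhk
  refine ⟨φ, ψ, g, hφc, hψc, hφd, hψ0, hφi, fun z hz => ?_, fun z hz => ?_, hφg, hg⟩
  · obtain ⟨t, ht⟩ := hφb z hz
    rw [ht]; exact h0 t
  · rcases hφin z hz with h | ⟨x, t, hx, h⟩
    · rw [h]; exact hin 0 (by simpa using (Real.exp_pos _).le)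
    rcases lt_or_ge x (-η) with hxη | hxη
    · rw [h]; exact hin _ (by rw [norm_exp]; simpa using hxη.le)
    · rw [h]
      exact ⟨hFU _ (by simpa using abs_le.2 ⟨hxη, hx.le.trans (abs_le.1 (hhη t)).2⟩), hneg x t hxη
          hx⟩

end LevelDisc

section HolomorphicParts

variable {E : Type*} [NormedAddCommGroup E] [NormedSpace ℂ E]

/-- The complex linear form with real part `T`. -/
noncomputable def holPart (T : E →L[ℝ] ℝ) (v : E) : ℂ := T v - I * T (I • v)

/-- The complex bilinear part of a real symmetric bilinear form, normalised so that
`H v v = 2 L(v) + Re (holHess H v v)` where `L` is the Levi part. -/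
noncomputable def holHess (H : E →L[ℝ] E →L[ℝ] ℝ) (v w : E) : ℂ :=
  (1 / 2) * (holPart (H v) w - I * holPart (H (I • v)) w)

theorem smul_eq_re_smul_add_im_smul (c : ℂ) (v : E) : c • v = c.re • v + c.im • (I • v) := by
  conv_lhs => rw [← Complex.re_add_im c, add_smul, mul_smul]
  simp only [Complex.coe_smul]

theorem I_smul_smul (c : ℂ) (v : E) : I • (c • v) = c.re • (I • v) - c.im • v := by
  rw [smul_smul, smul_eq_re_smul_add_im_smul]
  simp
  abel

theorem holPart_add (T : E →L[ℝ] ℝ) (v w : E) : holPart T (v + w) = holPart T v + holPart T w := by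
  simp [holPart]; ring

theorem holPart_smul (T : E →L[ℝ] ℝ) (c : ℂ) (v : E) : holPart T (c • v) = c * holPart T v := by
  simp only [holPart]
  rw [I_smul_smul, smul_eq_re_smul_add_im_smul c v]
  simp only [map_add, map_sub, map_smul, smul_eq_mul]
  apply Complex.ext
  · simp
  · simp; ring

theorem re_mul_holPart (T : E →L[ℝ] ℝ) (c : ℂ) (v : E) : (c * holPart T v).re = T (c • v) := by
  rw [← holPart_smul]; simp [holPart]

theorem norm_holPart_le (T : E →L[ℝ] ℝ) (v : E) : ‖holPart T v‖ ≤ 2 * ‖T‖ * ‖v‖ := by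
  have h1 := T.le_opNorm v
  have h2 := T.le_opNorm (I • v)
  rw [norm_smul, norm_I, one_mul] at h2
  refine (norm_sub_le _ _).trans ?_
  rw [norm_mul, norm_I, one_mul, norm_real, norm_real]
  linarith

theorem norm_holHess_le (H : E →L[ℝ] E →L[ℝ] ℝ) (v : E) :
    ‖holHess H v v‖ ≤ 2 * ‖H‖ * ‖v‖ ^ 2 := by
  have h1 := (norm_holPart_le (H v) v).trans (mul_le_mul_of_nonneg_right
    (mul_le_mul_of_nonneg_left (H.le_opNorm v) zero_le_two) (norm_nonneg v))
  have h2 := (norm_holPart_le (H (I • v)) v).trans (mul_le_mul_of_nonneg_right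
    (mul_le_mul_of_nonneg_left (H.le_opNorm (I • v)) zero_le_two) (norm_nonneg v))
  rw [norm_smul, norm_I, one_mul] at h2
  rw [holHess, norm_mul]
  have h3 := norm_sub_le (holPart (H v) v) (I * holPart (H (I • v)) v)
  rw [norm_mul, norm_I, one_mul] at h3
  have : ‖(1 / 2 : ℂ)‖ = 1 / 2 := by norm_num
  rw [this]
  nlinarith

theorem apply_smul_smul {H : E →L[ℝ] E →L[ℝ] ℝ} (hH : ∀ v w, H v w = H w v) (α β : ℂ) (A : E) :
    H (α • A) (β • A) = (α.re * β.re + α.im * β.im) * ((1 / 2) * (H A A + H (I • A) (I • A))) +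
      (α * β * holHess H A A).re := by
  rw [smul_eq_re_smul_add_im_smul α, smul_eq_re_smul_add_im_smul β]
  simp only [holHess, holPart, map_add, map_smul, _root_.add_apply,
    _root_.smul_apply, smul_eq_mul, hH A (I • A)]
  simp
  ring

theorem holHess_symm {H : E →L[ℝ] E →L[ℝ] ℝ} (hH : ∀ v w, H v w = H w v) (v w : E) :
    holHess H v w = holHess H w v := by
  simp only [holHess, holPart, hH w, hH (I • w)]
  ring

theorem holHess_add_right (H : E →L[ℝ] E →L[ℝ] ℝ) (u v w : E) :
    holHess H u (v + w) = holHess H u v + holHess H u w := by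
  simp only [holHess, holPart_add]; ring

theorem holHess_smul_right (H : E →L[ℝ] E →L[ℝ] ℝ) (u v : E) (c : ℂ) :
    holHess H u (c • v) = c * holHess H u v := by
  simp only [holHess, holPart_smul]; ring

theorem holHess_smul_smul {H : E →L[ℝ] E →L[ℝ] ℝ} (hH : ∀ v w, H v w = H w v) (c : ℂ) (v : E) :
    holHess H (c • v) (c • v) = c ^ 2 * holHess H v v := by
  rw [holHess_smul_right, holHess_symm hH, holHess_smul_right]; ring

theorem holHess_lincomb {H : E →L[ℝ] E →L[ℝ] ℝ} (hH : ∀ v w, H v w = H w v) (x y : ℂ) (u v : E) :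
    holHess H (x • u + y • v) (x • u + y • v) =
      x ^ 2 * holHess H u u + 2 * (x * y) * holHess H u v + y ^ 2 * holHess H v v := by
  rw [holHess_add_right, holHess_smul_right, holHess_smul_right, holHess_symm hH _ u,
    holHess_symm hH _ v, holHess_add_right, holHess_add_right, holHess_smul_right,
    holHess_smul_right, holHess_smul_right, holHess_smul_right, holHess_symm hH v u]
  ring

end HolomorphicParts

section UniformTaylor

variable {E : Type*} [NormedAddCommGroup E] [NormedSpace ℝ E]

theorem exists_uniform_taylor {U C : Set E} (hU : IsOpen U) (hC : IsCompact C) (hCU : C ⊆ U)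
    {ρ : E → ℝ} (hρ : ContDiffOn ℝ 2 ρ U) {κ : ℝ} (hκ : 0 < κ) :
    ∃ r > 0, ∀ p ∈ C, ∀ v : E, ‖v‖ ≤ r → p + v ∈ U ∧
      |ρ (p + v) - ρ p - fderiv ℝ ρ p v - (1 / 2) * fderiv ℝ (fderiv ℝ ρ) p v v| ≤ κ * ‖v‖ ^ 2 ∧
      ∀ u, |fderiv ℝ ρ (p + v) u - fderiv ℝ ρ p u - fderiv ℝ (fderiv ℝ ρ) p v u|
        ≤ κ * ‖v‖ * ‖u‖ := by
  have hat : ∀ p ∈ U, ContDiffAt ℝ 2 ρ p := fun p hp => hρ.contDiffAt (hU.mem_nhds hp)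
  have hat1 : ∀ p ∈ U, ContDiffAt ℝ 1 (fderiv ℝ ρ) p := fun p hp =>
    (hat p hp).fderiv_right (by norm_num)
  obtain ⟨r₁, hr₁, hrU⟩ := hC.exists_cthickening_subset_open hU hCU
  have hunif := hC.uniformContinuousAt_of_continuousAt (fderiv ℝ (fderiv ℝ ρ))
    (fun p hp => ((hat1 p (hCU hp)).fderiv_right (m := 0) (by norm_num)).continuousAt)
    (r := {q : (E →L[ℝ] E →L[ℝ] ℝ) × (E →L[ℝ] E →L[ℝ] ℝ) | dist q.1 q.2 < κ})
    (Metric.dist_mem_uniformity (α := E →L[ℝ] E →L[ℝ] ℝ) hκ)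
  obtain ⟨r₂, hr₂, hr⟩ := Metric.mem_uniformity_dist.1 hunif
  refine ⟨min r₁ (r₂ / 2), lt_min hr₁ (half_pos hr₂), fun p hp v hv => ?_⟩
  have hball : ∀ q ∈ closedBall p ‖v‖, q ∈ U ∧
      ‖fderiv ℝ (fderiv ℝ ρ) q - fderiv ℝ (fderiv ℝ ρ) p‖ ≤ κ := by
    intro q hq
    have hq' : dist q p ≤ min r₁ (r₂ / 2) := (mem_closedBall.1 hq).trans hv
    refine ⟨hrU (mem_cthickening_of_dist_le q p _ C hp (hq'.trans (min_le_left _ _))), ?_⟩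
    have := hr (a := p) (b := q) (by
      rw [dist_comm]; exact (hq'.trans (min_le_right _ _)).trans_lt (half_lt_self hr₂)) hp
    rw [mem_ofPred_eq, dist_comm] at this
    exact ((dist_eq_norm (fderiv ℝ (fderiv ℝ ρ) q) (fderiv ℝ (fderiv ℝ ρ) p)).symm.trans_lt
      this).le
  have h1 : ∀ w : E, ‖w‖ ≤ ‖v‖ →
      ‖fderiv ℝ ρ (p + w) - fderiv ℝ ρ p - fderiv ℝ (fderiv ℝ ρ) p w‖ ≤ κ * ‖w‖ := by
    intro w hw
    have := (convex_closedBall p ‖v‖).norm_image_sub_le_of_norm_hasFDerivWithin_le'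
      (f := fderiv ℝ ρ) (φ := fderiv ℝ (fderiv ℝ ρ) p) (C := κ) (x := p) (y := p + w)
      (fun q hq => ((hat1 q (hball q hq).1).differentiableAt
          one_ne_zero).hasFDerivAt.hasFDerivWithinAt)
      (fun q hq => (hball q hq).2) (mem_closedBall_self (norm_nonneg _)) (by simpa using hw)
    simpa using this
  refine ⟨(hball _ (by simp)).1, ?_, fun u => ?_⟩
  · have hmem : ∀ τ ∈ Icc (0 : ℝ) 1, ‖τ • v‖ ≤ ‖v‖ := fun τ hτ => by
      rw [norm_smul, Real.norm_of_nonneg hτ.1]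
      exact mul_le_of_le_one_left (norm_nonneg _) hτ.2
    have hder : ∀ τ ∈ Icc (0 : ℝ) 1, HasDerivAt (fun τ : ℝ => ρ (p + τ • v) - τ * fderiv ℝ ρ p v -
        (1 / 2) * τ ^ 2 * fderiv ℝ (fderiv ℝ ρ) p v v)
        (fderiv ℝ ρ (p + τ • v) v - fderiv ℝ ρ p v - τ * fderiv ℝ (fderiv ℝ ρ) p v v) τ := by
      intro τ hτ
      have h2 : HasDerivAt (fun τ : ℝ => p + τ • v) ((1 : ℝ) • v) τ :=
        ((hasDerivAt_id τ).smul_const v).const_add p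
      rw [one_smul] at h2
      have h3 := ((hat (p + τ • v) (hball _ (by simpa using hmem τ hτ)).1).differentiableAt
        (by norm_num)).hasFDerivAt.comp_hasDerivAt τ h2
      have h4 := (hasDerivAt_id τ).mul_const (fderiv ℝ ρ p v)
      have h5 := ((hasDerivAt_pow 2 τ).const_mul (1 / 2)).mul_const (fderiv ℝ (fderiv ℝ ρ) p v v)
      convert! (h3.sub h4).sub h5 using 1
      simp
    have := (convex_Icc (0 : ℝ) 1).norm_image_sub_le_of_norm_hasDerivWithin_le
      (C := κ * ‖v‖ ^ 2) (x := 0) (y := 1) (fun τ hτ => (hder τ hτ).hasDerivWithinAt)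
      (fun τ hτ => ?_) (by simp) (by simp)
    · simp at this
      convert this using 2
      ring_nf
    · have h2 := h1 (τ • v) (hmem τ hτ)
      have h3 := ContinuousLinearMap.le_opNorm
        (fderiv ℝ ρ (p + τ • v) - fderiv ℝ ρ p - fderiv ℝ (fderiv ℝ ρ) p (τ • v)) v
      simp only [map_smul, _root_.sub_apply, _root_.smul_apply,
        smul_eq_mul] at h3
      refine h3.trans ?_
      rw [← map_smul, pow_two, ← mul_assoc]
      exact mul_le_mul_of_nonneg_right (h2.trans (mul_le_mul_of_nonneg_left (hmem τ hτ) hκ.le))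
        (norm_nonneg _)
  · have h3 := ContinuousLinearMap.le_opNorm
      (fderiv ℝ ρ (p + v) - fderiv ℝ ρ p - fderiv ℝ (fderiv ℝ ρ) p v) u
    exact h3.trans (mul_le_mul_of_nonneg_right (h1 v le_rfl) (norm_nonneg _))

end UniformTaylor

section LeviBounds

theorem exists_norm_bound_of_continuousOn {X F : Type*} [TopologicalSpace X]
    [SeminormedAddCommGroup F] {C : Set X}
    (hC : IsCompact C) {u : X → F} (hu : ContinuousOn u C) :
    ∃ b > 0, ∀ p ∈ C, ‖u p‖ ≤ b := by
  obtain ⟨b, hb⟩ := hC.exists_bound_of_continuousOn hu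
  exact ⟨max b 1, by positivity, fun p hp => (hb p hp).trans (le_max_left _ _)⟩

variable {E : Type*} [NormedAddCommGroup E] [NormedSpace ℂ E]

theorem levi_eq (ρ : E → ℝ) (z w : E) : levi ρ z w = (1 / 4) *
    (fderiv ℝ (fderiv ℝ ρ) z w w + fderiv ℝ (fderiv ℝ ρ) z (I • w) (I • w)) := rfl

theorem levi_real_smul (ρ : E → ℝ) (z w : E) (r : ℝ) : levi ρ z (r • w) = r ^ 2 * levi ρ z w := by
  simp only [levi_eq, smul_comm I r w, map_smul, _root_.smul_apply, smul_eq_mul]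
  ring

theorem continuousOn_fderiv_fderiv {U : Set E} (hU : IsOpen U) {ρ : E → ℝ}
    (hρ : ContDiffOn ℝ 2 ρ U) : ContinuousOn (fderiv ℝ (fderiv ℝ ρ)) U := fun p hp =>
  ((((hρ.contDiffAt (hU.mem_nhds hp)).fderiv_right (m := 1) (by norm_num)).fderiv_right (m := 0)
    (by norm_num)).continuousAt).continuousWithinAt

theorem continuousOn_fderiv {U : Set E} (hU : IsOpen U) {ρ : E → ℝ}
    (hρ : ContDiffOn ℝ 2 ρ U) : ContinuousOn (fderiv ℝ ρ) U := fun p hp =>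
  ((hρ.contDiffAt (hU.mem_nhds hp)).fderiv_right (m := 1)
    (by norm_num)).continuousAt.continuousWithinAt

theorem fderiv_fderiv_symm {U : Set E} (hU : IsOpen U) {ρ : E → ℝ}
    (hρ : ContDiffOn ℝ 2 ρ U) {p : E} (hp : p ∈ U) (v w : E) :
    fderiv ℝ (fderiv ℝ ρ) p v w = fderiv ℝ (fderiv ℝ ρ) p w v :=
  (hρ.contDiffAt (hU.mem_nhds hp)).isSymmSndFDerivAt (by simp) v w

theorem exists_levi_lower_bound [FiniteDimensional ℂ E] {U C : Set E} (hU : IsOpen U)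
    (hC : IsCompact C) (hCU : C ⊆ U) {ρ : E → ℝ} (hρ : ContDiffOn ℝ 2 ρ U)
    (hpsh : ∀ z ∈ U, ∀ w : E, w ≠ 0 → 0 < levi ρ z w) :
    ∃ l > 0, ∀ p ∈ C, ∀ v, l * ‖v‖ ^ 2 ≤ levi ρ p v := by
  have : ProperSpace E := FiniteDimensional.proper ℂ E
  have hK : IsCompact (C ×ˢ sphere (0 : E) 1) := hC.prod (isCompact_sphere 0 1)
  have h2 : ContinuousOn (fun x : E × E => fderiv ℝ (fderiv ℝ ρ) x.1) (C ×ˢ sphere (0 : E) 1) :=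
    (continuousOn_fderiv_fderiv hU hρ).comp continuousOn_fst fun x hx => hCU hx.1
  have hI : ContinuousOn (fun x : E × E => I • x.2) (C ×ˢ sphere (0 : E) 1) := by fun_prop
  have hc : ContinuousOn (fun x : E × E => levi ρ x.1 x.2) (C ×ˢ sphere (0 : E) 1) := by
    simp only [levi_eq]
    exact (((h2.clm_apply continuousOn_snd).clm_apply continuousOn_snd).add
      ((h2.clm_apply hI).clm_apply hI)).const_mul _
  obtain ⟨l, hl, h⟩ := hK.exists_forall_le' hc (a := 0) fun x hx =>
    hpsh _ (hCU hx.1) _ (ne_of_mem_sphere hx.2 one_ne_zero)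
  refine ⟨l, hl, fun p hp v => ?_⟩
  rcases eq_or_ne v 0 with rfl | hv
  · simp [levi_eq]
  have hv' := norm_pos_iff.2 hv
  have h3 := h (p, ‖v‖⁻¹ • v) ⟨hp, by simp [norm_smul, hv'.ne']⟩
  have h4 : v = ‖v‖ • (‖v‖⁻¹ • v) := by rw [smul_smul, mul_inv_cancel₀ hv'.ne', one_smul]
  conv_rhs => rw [h4, levi_real_smul]
  nlinarith [mul_le_mul_of_nonneg_left h3 (sq_nonneg ‖v‖)]

end LeviBounds

section DiscExpansion

variable {E : Type*} [NormedAddCommGroup E] [NormedSpace ℂ E]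

theorem abs_sub_levi_le {ρ : E → ℝ} {p A : E} {r κ : ℝ} {ξ : ℂ}
    (hsym : ∀ v w, fderiv ℝ (fderiv ℝ ρ) p v w = fderiv ℝ (fderiv ℝ ρ) p w v)
    (hT : ∀ v : E, ‖v‖ ≤ r →
      |ρ (p + v) - ρ p - fderiv ℝ ρ p v - (1 / 2) * fderiv ℝ (fderiv ℝ ρ) p v v| ≤ κ * ‖v‖ ^ 2)
    (hκ : 0 ≤ κ) (hA : ‖A‖ ≤ r) (hξ : ‖ξ‖ ≤ 1) :
    |ρ (p + ξ • A) - ρ p - ‖ξ‖ ^ 2 * levi ρ p A| ≤ ‖holPart (fderiv ℝ ρ p) A‖ +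
      1 / 2 * ‖holHess (fderiv ℝ (fderiv ℝ ρ) p) A A‖ + κ * ‖A‖ ^ 2 := by
  have hn : ‖ξ • A‖ ≤ ‖A‖ := by
    rw [norm_smul]; exact mul_le_of_le_one_left (norm_nonneg _) hξ
  have h1 := hT (ξ • A) (hn.trans hA)
  have h2 := apply_smul_smul hsym ξ ξ A
  have h3 := re_mul_holPart (fderiv ℝ ρ p) ξ A
  have h4 : κ * ‖ξ • A‖ ^ 2 ≤ κ * ‖A‖ ^ 2 := by gcongr
  have h5 : |(ξ * holPart (fderiv ℝ ρ p) A).re| ≤ ‖holPart (fderiv ℝ ρ p) A‖ := by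
    refine (abs_re_le_norm _).trans ?_
    rw [norm_mul]; exact mul_le_of_le_one_left (norm_nonneg _) hξ
  have h6 : |(ξ * ξ * holHess (fderiv ℝ (fderiv ℝ ρ) p) A A).re| ≤
      ‖holHess (fderiv ℝ (fderiv ℝ ρ) p) A A‖ := by
    refine (abs_re_le_norm _).trans ?_
    rw [norm_mul, norm_mul]
    exact mul_le_of_le_one_left (norm_nonneg _) (mul_le_one₀ hξ (norm_nonneg _) hξ)
  have h7 : ξ.re * ξ.re + ξ.im * ξ.im = ‖ξ‖ ^ 2 := by
    rw [← Complex.normSq_eq_norm_sq, Complex.normSq_apply]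
  rw [h2, h7, ← h3] at h1
  rw [levi_eq]
  rw [abs_le] at h1 h5 h6 ⊢
  constructor <;> nlinarith

set_option maxHeartbeats 800000 in
theorem quadratic_disc_estimates {ρ : E → ℝ} {p A B : E} {r R κ κ' Λ s : ℝ} {ξ : ℂ}
    (hsym : ∀ v w, fderiv ℝ (fderiv ℝ ρ) p v w = fderiv ℝ (fderiv ℝ ρ) p w v)
    (hΛ : ‖fderiv ℝ (fderiv ℝ ρ) p‖ ≤ Λ) (hκ : 0 ≤ κ)
    (hT : ∀ v : E, ‖v‖ ≤ R →
      |ρ (p + v) - ρ p - fderiv ℝ ρ p v - (1 / 2) * fderiv ℝ (fderiv ℝ ρ) p v v| ≤ κ * ‖v‖ ^ 2 ∧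
      ∀ u, |fderiv ℝ ρ (p + v) u - fderiv ℝ ρ p u - fderiv ℝ (fderiv ℝ ρ) p v u|
        ≤ κ * ‖v‖ * ‖u‖)
    (hr : 0 ≤ r) (hA : ‖A‖ = r) (hB : ‖B‖ ≤ s * r) (hs0 : 0 ≤ s) (hs : s ≤ 1 / 4) (hR : 3 * r ≤ R)
    (haA : ‖holPart (fderiv ℝ ρ p) A‖ ≤ κ' * r ^ 2)
    (haB : holPart (fderiv ℝ ρ p) B = -(1 / 2) * holHess (fderiv ℝ (fderiv ℝ ρ) p) A A)
    (hξ : ‖ξ‖ ≤ 2) :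
    ‖ξ • A + ξ ^ 2 • B‖ ≤ R ∧
    |ρ (p + (ξ • A + ξ ^ 2 • B)) - ρ p - ‖ξ‖ ^ 2 * levi ρ p A| ≤
      (2 * κ' + 12 * κ + 32 * Λ * s) * r ^ 2 ∧
    ∀ e : ℂ, ‖e‖ ≤ 1 → |fderiv ℝ ρ (p + (ξ • A + ξ ^ 2 • B)) (e • (ξ • A + (2 * ξ ^ 2) • B)) -
      2 * e.re * ‖ξ‖ ^ 2 * levi ρ p A| ≤ (2 * κ' + 12 * κ + 32 * Λ * s) * r ^ 2 := by
  set T := fderiv ℝ ρ p with hTdef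
  set H := fderiv ℝ (fderiv ℝ ρ) p with hHdef
  have hΛ0 : 0 ≤ Λ := (norm_nonneg H).trans hΛ
  have hH : ∀ (v w : E) (a b : ℝ), ‖v‖ ≤ a → ‖w‖ ≤ b → |H v w| ≤ Λ * a * b := fun v w a b hv hw =>
    (H.le_opNorm₂ v w).trans (mul_le_mul (mul_le_mul hΛ hv (norm_nonneg _) hΛ0) hw (norm_nonneg _)
      (mul_nonneg hΛ0 ((norm_nonneg v).trans hv)))
  have hξ2 : ‖ξ ^ 2‖ ≤ 4 := by
    rw [norm_pow]; nlinarith [norm_nonneg ξ]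
  have hnA : ‖ξ • A‖ ≤ 2 * r := by
    rw [norm_smul, hA]; exact mul_le_mul_of_nonneg_right hξ hr
  have hnB : ‖ξ ^ 2 • B‖ ≤ 4 * (s * r) := by
    rw [norm_smul]; exact mul_le_mul hξ2 hB (norm_nonneg _) (by norm_num)
  have hsr : s * r ≤ 1 / 4 * r := mul_le_mul_of_nonneg_right hs hr
  have hv : ‖ξ • A + ξ ^ 2 • B‖ ≤ 3 * r := (norm_add_le _ _).trans (by linarith)
  have hvR := hv.trans hR
  have h7 : ‖ξ‖ ^ 2 = ξ.re * ξ.re + ξ.im * ξ.im := by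
    rw [← Complex.normSq_eq_norm_sq, Complex.normSq_apply]
  have hκ' : ∀ e : ℂ, ‖e‖ ≤ 1 → |(e * ξ * holPart T A).re| ≤ 2 * κ' * r ^ 2 := fun e he => by
    refine (abs_re_le_norm _).trans ?_
    rw [norm_mul, norm_mul]
    have : ‖e‖ * ‖ξ‖ ≤ 2 := (mul_le_of_le_one_left (norm_nonneg _) he).trans hξ
    nlinarith [norm_nonneg (holPart T A)]
  have hr2 : 0 ≤ s * r ^ 2 := by positivity
  have hΛr : 0 ≤ Λ * (s * r ^ 2) := by positivity
  have hs2 : s * s * r ^ 2 ≤ 1 / 4 * (s * r ^ 2) := by nlinarith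
  have hΛs2 : Λ * (s * s * r ^ 2) ≤ Λ * (1 / 4 * (s * r ^ 2)) := mul_le_mul_of_nonneg_left hs2 hΛ0
  have hκr : 0 ≤ κ * r ^ 2 := by positivity
  obtain ⟨ht1, ht2⟩ := hT _ hvR
  refine ⟨hvR, ?_, fun e he => ?_⟩
  · have e1 : T (ξ • A + ξ ^ 2 • B) = (1 * ξ * holPart T A).re - 1 / 2 * (ξ * ξ * holHess H A A).re
        := by
      rw [map_add, ← re_mul_holPart T ξ, ← re_mul_holPart T (ξ ^ 2), haB, one_mul, sub_eq_add_neg]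
      congr 1
      rw [show ξ ^ 2 * (-(1 / 2) * holHess H A A) = ((-(1 / 2) : ℝ) : ℂ) * (ξ * ξ * holHess H A A)
          by
        push_cast; ring, Complex.re_ofReal_mul]
      ring
    have e2 : H (ξ • A + ξ ^ 2 • B) (ξ • A + ξ ^ 2 • B) = H (ξ • A) (ξ • A) +
        2 * H (ξ • A) (ξ ^ 2 • B) + H (ξ ^ 2 • B) (ξ ^ 2 • B) := by
      simp only [map_add, _root_.add_apply, hsym (ξ ^ 2 • B) (ξ • A)]
      ring
    have e3 := hH _ _ _ _ hnA hnB
    have e4 := hH _ _ _ _ hnB hnB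
    have e5 := hκ' 1 (by simp)
    rw [e1, e2, apply_smul_smul hsym, ← h7] at ht1
    have e6 : κ * ‖ξ • A + ξ ^ 2 • B‖ ^ 2 ≤ κ * (3 * r) ^ 2 := by gcongr
    rw [levi_eq]
    rw [abs_le] at ht1 e3 e4 e5 ⊢
    constructor <;> linarith
  · set X := ξ • A + (2 * ξ ^ 2) • B with hX
    have hX' : X = ξ • A + (2 : ℝ) • (ξ ^ 2 • B) := by
      rw [hX, mul_smul]; norm_cast
    have hnX : ‖X‖ ≤ 4 * r := by
      rw [hX']
      refine (norm_add_le _ _).trans ?_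
      rw [norm_smul (2 : ℝ)]
      norm_num
      linarith
    have hneX : ‖e • X‖ ≤ 4 * r := by
      rw [norm_smul]; exact (mul_le_of_le_one_left (norm_nonneg _) he).trans hnX
    have hneB : ‖e • (ξ ^ 2 • B)‖ ≤ 4 * (s * r) := by
      rw [norm_smul]; exact (mul_le_of_le_one_left (norm_nonneg _) he).trans hnB
    have heX : e • X = (e * ξ) • A + (2 : ℝ) • (e • (ξ ^ 2 • B)) := by
      rw [hX', smul_add, smul_smul, smul_comm e (2 : ℝ)]
    have e1 : T (e • X) = (e * ξ * holPart T A).re - (ξ * (e * ξ) * holHess H A A).re := by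
      rw [heX, map_add, map_smul T (2 : ℝ), ← re_mul_holPart, smul_smul, ← re_mul_holPart T
          (e * ξ ^ 2), haB,
        show e * ξ ^ 2 * (-(1 / 2) * holHess H A A) =
          ((-(1 / 2) : ℝ) : ℂ) * (ξ * (e * ξ) * holHess H A A) by push_cast; ring,
        Complex.re_ofReal_mul, smul_eq_mul]
      ring
    have e2 : H (ξ • A + ξ ^ 2 • B) (e • X) = H (ξ • A) ((e * ξ) • A) +
        2 * H (ξ • A) (e • (ξ ^ 2 • B)) + H (ξ ^ 2 • B) (e • X) := by
      rw [map_add, _root_.add_apply]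
      congr 1
      rw [heX, map_add, map_smul (H (ξ • A)) (2 : ℝ), smul_eq_mul]
    have e3 := hH _ _ _ _ hnA hneB
    have e4 := hH _ _ _ _ hnB hneX
    have e5 := hκ' e he
    have h1 := ht2 (e • X)
    have h8 : ξ.re * (e * ξ).re + ξ.im * (e * ξ).im = e.re * ‖ξ‖ ^ 2 := by
      rw [h7]; simp; ring
    rw [e1, e2, apply_smul_smul hsym, h8] at h1
    have e6 : κ * ‖ξ • A + ξ ^ 2 • B‖ * ‖e • X‖ ≤ κ * (3 * r) * (4 * r) := by gcongr
    rw [levi_eq]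
    rw [abs_le] at h1 e3 e4 e5 ⊢
    constructor <;> linarith

end DiscExpansion

section LaurentApproximation

variable {E : Type*} [NormedAddCommGroup E] [NormedSpace ℂ E]

/-- `u` agrees on the unit circle with an entire function divided by a power of `ζ`. -/
def IsLaurentOnCircle (u : ℂ → E) : Prop :=
  ∃ (m : ℕ) (P : ℂ → E), Differentiable ℂ P ∧ ∀ ζ : ℂ, ‖ζ‖ = 1 → u ζ = (ζ ^ m)⁻¹ • P ζ

theorem IsLaurentOnCircle.add {u v : ℂ → E} (hu : IsLaurentOnCircle u) (hv : IsLaurentOnCircle v) :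
    IsLaurentOnCircle (u + v) := by
  obtain ⟨m, P, hP, h⟩ := hu
  obtain ⟨k, Q, hQ, h'⟩ := hv
  refine ⟨m + k, fun ζ => ζ ^ k • P ζ + ζ ^ m • Q ζ, by fun_prop, fun ζ hζ => ?_⟩
  have h0 : ζ ≠ 0 := by rintro rfl; simp at hζ
  rw [Pi.add_apply, h ζ hζ, h' ζ hζ, smul_add, smul_smul, smul_smul]
  congr 2 <;> (rw [pow_add]; field_simp)

theorem IsLaurentOnCircle.smul_vec {u : ℂ → ℂ} (hu : IsLaurentOnCircle u) (e : E) :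
    IsLaurentOnCircle fun ζ => u ζ • e := by
  obtain ⟨m, P, hP, h⟩ := hu
  refine ⟨m, fun ζ => P ζ • e, by fun_prop, fun ζ hζ => ?_⟩
  simp only [h ζ hζ, smul_smul, smul_eq_mul]

theorem exists_scalar_laurent_approx {a : ℂ → ℂ} (ha : ContinuousOn a (sphere 0 1)) {δ : ℝ}
    (hδ : 0 < δ) : ∃ u : ℂ → ℂ, IsLaurentOnCircle u ∧ ∀ ζ : ℂ, ‖ζ‖ = 1 → ‖u ζ - a ζ‖ < δ := by
  have : Fact (0 < 2 * Real.pi) := ⟨Real.two_pi_pos⟩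
  have hmem : ∀ x : AddCircle (2 * Real.pi), ((x.toCircle : Circle) : ℂ) ∈ sphere (0 : ℂ) 1 :=
    fun x => by simpa using Circle.norm_coe x.toCircle
  let α : C(AddCircle (2 * Real.pi), ℂ) :=
    ⟨fun x => a x.toCircle, ha.comp_continuous
      (continuous_subtype_val.comp AddCircle.continuous_toCircle) hmem⟩
  have hspan : ∀ g ∈ Submodule.span ℂ (range (@fourier (2 * Real.pi))),
      ∃ (m : ℕ) (P : ℂ → ℂ), Differentiable ℂ P ∧ ∀ x : AddCircle (2 * Real.pi),
        g x = ((x.toCircle : ℂ) ^ m)⁻¹ * P x.toCircle := by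
    intro g hg
    induction hg using Submodule.span_induction with
    | mem g hg =>
      obtain ⟨n, rfl⟩ := hg
      rcases Int.eq_nat_or_neg n with ⟨k, rfl | rfl⟩
      · refine ⟨0, fun z => z ^ k, by fun_prop, fun x => ?_⟩
        rw [fourier_apply, AddCircle.toCircle_zsmul]
        simp
      · refine ⟨k, fun z => 1, by fun_prop, fun x => ?_⟩
        rw [fourier_apply, AddCircle.toCircle_zsmul]
        simp
    | zero => exact ⟨0, 0, by fun_prop, fun x => by simp⟩
    | add g h _ _ hg hh =>
      obtain ⟨m, P, hP, h1⟩ := hg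
      obtain ⟨k, Q, hQ, h2⟩ := hh
      refine ⟨m + k, fun ζ => ζ ^ k * P ζ + ζ ^ m * Q ζ, by fun_prop, fun x => ?_⟩
      have h0 : (x.toCircle : ℂ) ≠ 0 := Circle.coe_ne_zero _
      rw [ContinuousMap.add_apply, h1, h2, pow_add]
      field_simp
    | smul c g _ hg =>
      obtain ⟨m, P, hP, h1⟩ := hg
      refine ⟨m, fun ζ => c * P ζ, by fun_prop, fun x => ?_⟩
      rw [ContinuousMap.smul_apply, h1, smul_eq_mul]
      ring
  have hα : α ∈ (Submodule.span ℂ (range (@fourier (2 * Real.pi)))).topologicalClosure := by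
    rw [span_fourier_closure_eq_top]; trivial
  obtain ⟨g, hg, hgα⟩ := Metric.mem_closure_iff.1 hα δ hδ
  obtain ⟨m, P, hP, h⟩ := hspan g hg
  refine ⟨fun ζ => (ζ ^ m)⁻¹ * P ζ, ⟨m, P, hP, fun _ _ => rfl⟩, fun ζ hζ => ?_⟩
  obtain ⟨t, rfl⟩ := exists_exp_eq_of_norm_eq_one hζ
  have hx : ((AddCircle.toCircle (t : AddCircle (2 * Real.pi)) : Circle) : ℂ) = exp (t * I) := by
    rw [AddCircle.toCircle_apply_mk, Circle.coe_exp]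
    congr 2
    rw [div_self Real.two_pi_pos.ne', one_mul]
  have h1 := (ContinuousMap.dist_lt_iff hδ).1 hgα (t : AddCircle (2 * Real.pi))
  rw [dist_comm, dist_eq_norm, h, hx] at h1
  change ‖_ - a _‖ < δ at h1
  rwa [hx] at h1

theorem exists_laurent_approx [FiniteDimensional ℂ E] {A : ℂ → E}
    (hA : ContinuousOn A (sphere 0 1)) {δ : ℝ} (hδ : 0 < δ) :
    ∃ u : ℂ → E, IsLaurentOnCircle u ∧ ∀ ζ : ℂ, ‖ζ‖ = 1 → ‖u ζ - A ζ‖ < δ := by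
  let b := Module.finBasis ℂ E
  set S : ℝ := ∑ j, ‖b j‖ with hS
  have hS0 : 0 ≤ S := Finset.sum_nonneg fun _ _ => norm_nonneg _
  have hcoord : ∀ j, ContinuousOn (fun ζ => b.equivFunL (A ζ) j) (sphere 0 1) := fun j =>
    (continuous_apply j).comp_continuousOn (b.equivFunL.continuous.comp_continuousOn hA)
  choose u hu hua using fun j => exists_scalar_laurent_approx (hcoord j)
    (div_pos hδ (by linarith : (0 : ℝ) < S + 1))
  refine ⟨∑ j, fun ζ => u j ζ • b j, ?_, fun ζ hζ => ?_⟩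
  · refine Finset.sum_induction _ _ (fun _ _ => IsLaurentOnCircle.add)
      ⟨0, 0, by fun_prop, fun _ _ => by simp⟩ fun j _ => (hu j).smul_vec (b j)
  · have h1 : A ζ = ∑ j, b.equivFunL (A ζ) j • b j := (b.sum_equivFun (A ζ)).symm
    rw [h1, Finset.sum_apply, ← Finset.sum_sub_distrib]
    calc ‖∑ j, (u j ζ • b j - b.equivFunL (A ζ) j • b j)‖
        ≤ ∑ j, δ / (S + 1) * ‖b j‖ := by
          refine norm_sum_le_of_le _ fun j _ => ?_
          rw [← sub_smul, norm_smul]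
          exact mul_le_mul_of_nonneg_right (hua j ζ hζ).le (norm_nonneg _)
      _ = δ * (S / (S + 1)) := by rw [← Finset.mul_sum]; ring
      _ < δ * 1 := by
          refine mul_lt_mul_of_pos_left ?_ hδ
          rw [div_lt_one (by linarith)]; linarith
      _ = δ := mul_one δ

theorem exists_laurent_mem [FiniteDimensional ℂ E] {A : ℂ → E} (hA : ContinuousOn A (sphere 0 1))
    {W : Set (ℂ × E)} (hW : IsOpen W) (hAW : ∀ ζ : ℂ, ‖ζ‖ = 1 → (ζ, A ζ) ∈ W) :
    ∃ (m : ℕ) (P : ℂ → E), Differentiable ℂ P ∧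
      ∀ ζ : ℂ, ‖ζ‖ = 1 → (ζ, (ζ ^ m)⁻¹ • P ζ) ∈ W := by
  have hK : IsCompact ((fun ζ => (ζ, A ζ)) '' sphere (0 : ℂ) 1) :=
    (isCompact_sphere 0 1).image_of_continuousOn (continuousOn_id.prodMk hA)
  obtain ⟨δ, hδ, hsub⟩ := hK.exists_thickening_subset_open hW
    (image_subset_iff.2 fun ζ hζ => hAW ζ (by simpa using hζ))
  obtain ⟨u, ⟨m, P, hP, hu⟩, hua⟩ := exists_laurent_approx hA hδ
  refine ⟨m, P, hP, fun ζ hζ => hsub ?_⟩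
  refine mem_thickening_iff.2 ⟨(ζ, A ζ), mem_image_of_mem _ (by simpa using hζ), ?_⟩
  rw [Prod.dist_eq, dist_self, ← hu ζ hζ, max_eq_right dist_nonneg, dist_eq_norm]
  exact hua ζ hζ

end LaurentApproximation

section Tubes

theorem isOpen_forall_mem {X Y Z : Type*} [TopologicalSpace X] [TopologicalSpace Y]
    [TopologicalSpace Z] {K : Set Y} (hK : IsCompact K) {V : Set Z} (hV : IsOpen V)
    {Φ : X × Y → Z} (hΦ : Continuous Φ) : IsOpen {x | ∀ y ∈ K, Φ (x, y) ∈ V} := by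
  rw [isOpen_iff_mem_nhds]
  intro x hx
  exact hK.eventually_forall_of_forall_eventually fun y hy =>
    hΦ.continuousAt.preimage_mem_nhds (hV.mem_nhds (hx y hy))

theorem exists_annulus_subset {S : Set ℂ} (hS : IsOpen S) (h : ∀ ζ : ℂ, ‖ζ‖ = 1 → ζ ∈ S) :
    ∃ δ > 0, δ < 1 ∧ ∀ ζ : ℂ, 1 - δ ≤ ‖ζ‖ → ‖ζ‖ ≤ 1 + δ → ζ ∈ S := by
  obtain ⟨δ, hδ, hsub⟩ := (isCompact_sphere (0 : ℂ) 1).exists_cthickening_subset_open hS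
    fun ζ hζ => h ζ (by simpa using hζ)
  refine ⟨min δ (1 / 2), by positivity, (min_le_right _ _).trans_lt (by norm_num),
    fun ζ h1 h2 => hsub ?_⟩
  have hδ' := min_le_right δ (1 / 2)
  have hδ'' := min_le_left δ (1 / 2)
  have h0 : 0 < ‖ζ‖ := by linarith
  refine mem_cthickening_of_dist_le ζ ((‖ζ‖⁻¹ : ℝ) • ζ) δ _ ?_ ?_
  · simp [h0.ne']
  · have : ζ - (‖ζ‖⁻¹ : ℝ) • ζ = ((1 - ‖ζ‖⁻¹ : ℝ)) • ζ := by rw [sub_smul, one_smul]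
    rw [dist_eq_norm, this, norm_smul, Real.norm_eq_abs, ← abs_of_pos h0, ← abs_mul, abs_of_pos h0,
      sub_mul, one_mul, inv_mul_cancel₀ h0.ne', abs_le]
    constructor <;> linarith

end Tubes

section NullDirections

variable {E : Type*} [NormedAddCommGroup E] [NormedSpace ℂ E]

theorem ContDiff.holPart {T : ℝ → E →L[ℝ] ℝ} {v : ℝ → E} {n : WithTop ℕ∞} (hT : ContDiff ℝ n T)
    (hv : ContDiff ℝ n v) : ContDiff ℝ n fun t => holPart (T t) (v t) := by
  have h1 : ContDiff ℝ n fun t => I • v t := hv.const_smul I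
  exact (ofRealCLM.contDiff.comp (hT.clm_apply hv)).sub
    (contDiff_const.mul (ofRealCLM.contDiff.comp (hT.clm_apply h1)))

theorem ContDiff.holHess {H : ℝ → E →L[ℝ] E →L[ℝ] ℝ} {v w : ℝ → E} {n : WithTop ℕ∞}
    (hH : ContDiff ℝ n H) (hv : ContDiff ℝ n v) (hw : ContDiff ℝ n w) :
    ContDiff ℝ n fun t => holHess (H t) (v t) (w t) := by
  have h1 : ContDiff ℝ n fun t => I • v t := hv.const_smul I
  exact contDiff_const.mul (((hH.clm_apply hv).holPart hw).sub
    (contDiff_const.mul ((hH.clm_apply h1).holPart hw)))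

theorem exists_shift_ne_zero {u : ℝ → ℂ} (hu : ContDiff ℝ 1 u) {δ : ℝ} (hδ : 0 < δ) :
    ∃ c : ℂ, ‖c‖ < δ ∧ ∀ t, u t + c ≠ 0 := by
  have h := hu.dense_compl_range_of_finrank_lt_finrank (by simp)
  obtain ⟨c, hc, hcδ⟩ := h.exists_dist_lt 0 hδ
  refine ⟨-c, by simpa [dist_eq_norm] using hcδ, fun t ht => hc ⟨t, ?_⟩⟩
  linear_combination ht

theorem exists_pos_le_norm {u : ℝ → ℂ} (hu : Continuous u) (h : ∀ t, u t ≠ 0) (a b : ℝ) :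
    ∃ m > 0, ∀ t ∈ Icc a b, m ≤ ‖u t‖ := by
  obtain ⟨m, hm, hle⟩ := (isCompact_Icc (a := a) (b := b)).exists_forall_le'
    hu.norm.continuousOn (a := 0) fun t _ => norm_pos_iff.2 (h t)
  exact ⟨m, hm, hle⟩

theorem exists_almost_null_direction {T : ℝ → E →L[ℝ] ℝ} {H : ℝ → E →L[ℝ] E →L[ℝ] ℝ}
    (hT : ContDiff ℝ 1 T) (hH : ContDiff ℝ 1 H) (hsym : ∀ t v w, H t v w = H t w v)
    {e₀ e₁ e₂ : E} (he : ∀ x y z : ℂ, ‖x‖ ≤ ‖x • e₀ + y • e₁ + z • e₂‖ ∧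
      ‖y‖ ≤ ‖x • e₀ + y • e₁ + z • e₂‖ ∧ ‖z‖ ≤ ‖x • e₀ + y • e₁ + z • e₂‖) (b c : ℝ)
    {κ : ℝ} (hκ : 0 < κ) :
    ∃ w : ℝ → E, Continuous w ∧ (∀ t, ‖w t‖ = 1) ∧ ∀ t ∈ Icc b c,
      ‖holPart (T t) (w t)‖ ≤ κ ∧ ‖holHess (H t) (w t) (w t)‖ ≤ κ := by
  have ha : ∀ e : E, ContDiff ℝ 1 fun t => holPart (T t) e := fun e => hT.holPart contDiff_const
  obtain ⟨c₀, hc₀, h₀⟩ := exists_shift_ne_zero (ha e₂) hκ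
  set A : ℝ → ℂ := fun t => holPart (T t) e₂ + c₀ with hA
  have hAd : ContDiff ℝ 1 A := (ha e₂).add contDiff_const
  set f₀ : ℝ → E := fun t => A t • e₀ - holPart (T t) e₀ • e₂ with hf₀
  set f₁ : ℝ → E := fun t => A t • e₁ - holPart (T t) e₁ • e₂ with hf₁
  have hf₀d : ContDiff ℝ 1 f₀ := (hAd.smul contDiff_const).sub ((ha e₀).smul contDiff_const)
  have hf₁d : ContDiff ℝ 1 f₁ := (hAd.smul contDiff_const).sub ((ha e₁).smul contDiff_const)
  obtain ⟨m, hm, hmA⟩ := exists_pos_le_norm hAd.continuous h₀ b c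
  obtain ⟨c₁, hc₁, h₁⟩ := exists_shift_ne_zero (hH.holHess hf₀d hf₀d)
    (by positivity : 0 < κ * m ^ 2 / 2)
  set y : ℝ → ℂ := fun t => holHess (H t) (f₀ t) (f₀ t) + c₁ with hy
  have hyd : ContDiff ℝ 1 y := (hH.holHess hf₀d hf₀d).add contDiff_const
  obtain ⟨m₁, hm₁, hmy⟩ := exists_pos_le_norm hyd.continuous h₁ b c
  have hDd : ContDiff ℝ 1 fun t => holHess (H t) (f₀ t) (f₁ t) ^ 2 -
      y t * holHess (H t) (f₁ t) (f₁ t) :=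
    ((hH.holHess hf₀d hf₁d).pow 2).sub (hyd.mul (hH.holHess hf₁d hf₁d))
  obtain ⟨c₂, hc₂, h₂⟩ := exists_shift_ne_zero hDd (by positivity : 0 < κ * m ^ 2 * m₁ / 2)
  obtain ⟨s, hsc, hs⟩ := Complex.exists_continuousOn_pow_eq (X := ℝ) (U := univ)
    (by
      have := (convex_univ (𝕜 := ℝ) (E := ℝ)).contractibleSpace univ_nonempty
      exact (inferInstance : SimplyConnectedSpace (univ : Set ℝ)))
    isOpen_univ (hDd.continuous.add continuous_const).continuousOn
    (by rintro ⟨t, -, ht⟩; exact h₂ t ht) two_ne_zero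
  set x : ℝ → ℂ := fun t => -holHess (H t) (f₀ t) (f₁ t) + s t with hx
  have hxc : Continuous x := (hH.holHess hf₀d hf₁d).continuous.neg.add (continuousOn_univ.1 hsc)
  set v : ℝ → E := fun t => x t • f₀ t + y t • f₁ t with hv
  have hvc : Continuous v := (hxc.smul hf₀d.continuous).add (hyd.continuous.smul hf₁d.continuous)
  have hv' : ∀ t, v t = (x t * A t) • e₀ + (y t * A t) • e₁ +
      (-(x t * holPart (T t) e₀ + y t * holPart (T t) e₁)) • e₂ := fun t => by
    simp only [hv, hf₀, hf₁]; module
  have hvn : ∀ t, ‖x t * A t‖ ≤ ‖v t‖ ∧ ‖y t * A t‖ ≤ ‖v t‖ ∧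
      ‖-(x t * holPart (T t) e₀ + y t * holPart (T t) e₁)‖ ≤ ‖v t‖ := fun t => by
    rw [hv']; exact he _ _ _
  have hv0 : ∀ t, 0 < ‖v t‖ := fun t =>
    (norm_pos_iff.2 (mul_ne_zero (h₁ t) (h₀ t))).trans_le (hvn t).2.1
  have hav : ∀ t, holPart (T t) (v t) = -c₀ * -(x t * holPart (T t) e₀ + y t * holPart (T t) e₁) :=
      by
    intro t
    rw [hv', holPart_add, holPart_add, holPart_smul, holPart_smul, holPart_smul, hA]
    ring
  have hQv : ∀ t, holHess (H t) (v t) (v t) = -c₁ * x t ^ 2 + y t * c₂ := by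
    intro t
    rw [hv]
    simp only
    rw [holHess_lincomb (hsym t)]
    have h3 : s t ^ 2 = holHess (H t) (f₀ t) (f₁ t) ^ 2 -
      y t * holHess (H t) (f₁ t) (f₁ t) + c₂ := hs t
    have h4 : x t = -holHess (H t) (f₀ t) (f₁ t) + s t := rfl
    have h5 : y t = holHess (H t) (f₀ t) (f₀ t) + c₁ := rfl
    linear_combination y t * h3 - x t ^ 2 * h5 +
      y t * (x t + holHess (H t) (f₀ t) (f₁ t) + s t) * h4
  refine ⟨fun t => ((‖v t‖⁻¹ : ℝ) : ℂ) • v t, ?_, fun t => ?_, fun t ht => ⟨?_, ?_⟩⟩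
  · exact (continuous_ofReal.comp (hvc.norm.inv₀ fun t => (hv0 t).ne')).smul hvc
  · rw [norm_smul, norm_real, norm_inv, norm_norm, inv_mul_cancel₀ (hv0 t).ne']
  · rw [holPart_smul, hav, norm_mul, norm_mul, norm_neg c₀, norm_real, norm_inv, norm_norm,
      inv_mul_le_iff₀ (hv0 t), mul_comm (‖v t‖)]
    exact mul_le_mul hc₀.le (hvn t).2.2 (norm_nonneg _) hκ.le
  · rw [holHess_smul_smul (hsym t), hQv, norm_mul, norm_pow, norm_real, norm_inv, norm_norm,
        inv_pow,
      inv_mul_le_iff₀ (pow_pos (hv0 t) 2)]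
    have hA1 := hmA t ht
    have hy1 := hmy t ht
    obtain ⟨k1, k2, -⟩ := hvn t
    rw [norm_mul] at k1 k2
    have l1 : ‖x t‖ * m ≤ ‖v t‖ := (mul_le_mul_of_nonneg_left hA1 (norm_nonneg _)).trans k1
    have l2 : ‖y t‖ * m ≤ ‖v t‖ := (mul_le_mul_of_nonneg_left hA1 (norm_nonneg _)).trans k2
    have l3 : (‖x t‖ * m) ^ 2 ≤ ‖v t‖ ^ 2 := by gcongr
    have l4 : (‖y t‖ * m) ^ 2 ≤ ‖v t‖ ^ 2 := by gcongr
    have l5 : ‖y t‖ * m₁ ≤ ‖y t‖ ^ 2 := by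
      rw [pow_two]; exact mul_le_mul_of_nonneg_left hy1 (norm_nonneg _)
    calc ‖-c₁ * x t ^ 2 + y t * c₂‖ ≤ ‖c₁‖ * ‖x t‖ ^ 2 + ‖y t‖ * ‖c₂‖ := by
          refine (norm_add_le _ _).trans_eq ?_
          rw [norm_mul, norm_neg, norm_pow, norm_mul]
      _ ≤ κ * m ^ 2 / 2 * ‖x t‖ ^ 2 + ‖y t‖ * (κ * m ^ 2 * m₁ / 2) := by gcongr
      _ = κ / 2 * (‖x t‖ * m) ^ 2 + κ / 2 * m ^ 2 * (‖y t‖ * m₁) := by ring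
      _ ≤ κ / 2 * ‖v t‖ ^ 2 + κ / 2 * m ^ 2 * ‖y t‖ ^ 2 := by gcongr
      _ = κ / 2 * ‖v t‖ ^ 2 + κ / 2 * (‖y t‖ * m) ^ 2 := by ring
      _ ≤ κ / 2 * ‖v t‖ ^ 2 + κ / 2 * ‖v t‖ ^ 2 := by gcongr
      _ = ‖v t‖ ^ 2 * κ := by ring

end NullDirections

section Push

variable {E : Type*} [NormedAddCommGroup E] [NormedSpace ℂ E]

theorem exists_entire_push [FiniteDimensional ℂ E] {Ω : Set E} {G : Set (ℂ × E)} {f A : ℂ → E}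
    (hΩ : IsOpen Ω) (hG : IsOpen G) (hf : Differentiable ℂ f)
    (hfΩ : ∀ ζ, ‖ζ‖ ≤ 1 → f ζ ∈ Ω) (hA : ContinuousOn A (sphere 0 1))
    (hAΩ : ∀ ζ, ‖ζ‖ = 1 → ∀ ξ : ℂ, ‖ξ‖ ≤ 1 → f ζ + ξ • A ζ ∈ Ω)
    (hAG : ∀ ζ, ‖ζ‖ = 1 → ∀ ξ : ℂ, ‖ξ‖ = 1 → (ζ, f ζ + ξ • A ζ) ∈ G)
    {r ε : ℝ} (hr : r < 1) (hε : 0 < ε) :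
    ∃ g : ℂ → E, Differentiable ℂ g ∧ (∀ ζ, ‖ζ‖ ≤ 1 → g ζ ∈ Ω) ∧
      (∀ ζ, ‖ζ‖ ≤ r → ‖g ζ - f ζ‖ < ε) ∧ ∀ ζ, ‖ζ‖ = 1 → (ζ, g ζ) ∈ G := by
  have hfc := hf.continuous
  have hΦ : Continuous fun x : (ℂ × E) × ℂ => f x.1.1 + x.2 • x.1.2 := by fun_prop
  have hW : IsOpen ({x : ℂ × E | ∀ ξ ∈ closedBall (0:ℂ) 1, f x.1 + ξ • x.2 ∈ Ω} ∩
      {x : ℂ × E | ∀ ξ ∈ sphere (0:ℂ) 1, (x.1, f x.1 + ξ • x.2) ∈ G}) :=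
    (isOpen_forall_mem (isCompact_closedBall 0 1) hΩ hΦ).inter
      (isOpen_forall_mem (isCompact_sphere 0 1) hG
        (Φ := fun x : (ℂ × E) × ℂ => (x.1.1, f x.1.1 + x.2 • x.1.2)) (by fun_prop))
  obtain ⟨m, P, hP, hPW⟩ := exists_laurent_mem hA hW fun ζ hζ =>
    ⟨fun ξ hξ => hAΩ ζ hζ ξ (by simpa using hξ), fun ξ hξ => hAG ζ hζ ξ (by simpa using hξ)⟩
  have hc : ContinuousOn (fun ζ : ℂ => (ζ, (ζ ^ m)⁻¹ • P ζ)) {0}ᶜ :=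
    continuousOn_id.prodMk (((continuous_pow m).continuousOn.inv₀ fun ζ hζ => pow_ne_zero m hζ).smul
      hP.continuous.continuousOn)
  obtain ⟨δ, hδ, hδ1, hann⟩ := exists_annulus_subset (hc.isOpen_inter_preimage
    isOpen_compl_singleton hW) fun ζ hζ =>
      ⟨by rintro rfl; simp at hζ, hPW ζ hζ⟩
  obtain ⟨ε₀, hε₀, hth⟩ := ((isCompact_closedBall (0:ℂ) 1).image hfc).exists_thickening_subset_open
    hΩ (by rintro _ ⟨ζ, hζ, rfl⟩; exact hfΩ ζ (by simpa using hζ))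
  obtain ⟨M, hM, hPM⟩ := exists_norm_bound_of_continuousOn (isCompact_closedBall (0:ℂ) 1)
    hP.continuous.continuousOn
  have hr' : max 0 (max r (1 - δ)) < 1 := by simp [hr, hδ]
  obtain ⟨k, hk⟩ := exists_pow_lt_of_lt_one (by positivity : 0 < min ε ε₀ / M) hr'
  have hsmall : ∀ ζ : ℂ, ‖ζ‖ ≤ max r (1 - δ) → ‖ζ ^ k • P ζ‖ < min ε ε₀ := fun ζ hζ => by
    rw [norm_smul, norm_pow]
    refine lt_of_le_of_lt ?_ ((lt_div_iff₀ hM).1 hk)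
    have h1 : ‖ζ‖ ≤ 1 := hζ.trans (le_max_right 0 _ |>.trans hr'.le)
    refine mul_le_mul (pow_le_pow_left₀ (norm_nonneg _) (hζ.trans (le_max_right _ _)) k)
      (hPM ζ (by simpa using h1)) (norm_nonneg _) (by positivity)
  have hout : ∀ ζ : ℂ, 1 - δ ≤ ‖ζ‖ → ‖ζ‖ ≤ 1 → ζ ^ k • P ζ = ζ ^ (k + m) • ((ζ ^ m)⁻¹ • P ζ) :=
    fun ζ h1 _ => by
      have : ζ ≠ 0 := norm_pos_iff.1 (by linarith)
      rw [smul_smul, pow_add, mul_assoc, mul_inv_cancel₀ (pow_ne_zero m this), mul_one]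
  refine ⟨fun ζ => f ζ + ζ ^ k • P ζ, by fun_prop, fun ζ hζ => ?_, fun ζ hζ => ?_, fun ζ hζ => ?_⟩
  · rcases le_total ‖ζ‖ (1 - δ) with h | h
    · refine hth (mem_thickening_iff.2 ⟨f ζ, mem_image_of_mem f (by simpa using hζ), ?_⟩)
      rw [dist_eq_norm, add_sub_cancel_left]
      exact (hsmall ζ (h.trans (le_max_right _ _))).trans_le (min_le_right _ _)
    · simp only
      rw [hout ζ h hζ]
      refine (hann ζ h (by linarith)).2.1 _ ?_
      simpa using pow_le_one₀ (norm_nonneg ζ) hζ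
  · simp only [add_sub_cancel_left]
    exact (hsmall ζ (hζ.trans (le_max_left _ _))).trans_le (min_le_left _ _)
  · simp only
    rw [hout ζ (by linarith) hζ.le]
    refine (hann ζ (by linarith) (by linarith)).2.2 _ ?_
    simp [hζ]

/-- A continuous cutoff on the unit circle vanishing near `-1`. -/
noncomputable def rightCutoff (ζ : ℂ) : ℝ := max 0 (min 1 (1 + 2 * ζ.re))

theorem continuous_rightCutoff : Continuous rightCutoff := by
  unfold rightCutoff; fun_prop

theorem rightCutoff_nonneg (ζ : ℂ) : 0 ≤ rightCutoff ζ := le_max_left _ _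

theorem rightCutoff_le_one (ζ : ℂ) : rightCutoff ζ ≤ 1 := by simp [rightCutoff]

theorem rightCutoff_eq_one {ζ : ℂ} (h : 0 ≤ ζ.re) : rightCutoff ζ = 1 := by
  rw [rightCutoff, min_eq_left (by linarith), max_eq_right zero_le_one]

theorem rightCutoff_eq_zero {ζ : ℂ} (h : ζ.re ≤ -1 / 2) : rightCutoff ζ = 0 := by
  rw [rightCutoff, max_eq_left ((min_le_right _ _).trans (by linarith))]

theorem continuousOn_rightCutoff_smul_arg {w : ℝ → E} (hw : Continuous w) {σ : ℂ → ℝ}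
    (hσ : ∀ ζ, ‖ζ‖ = 1 → ContinuousAt σ ζ) :
    ContinuousOn (fun ζ => ((rightCutoff ζ * σ ζ : ℝ) : ℂ) • w (arg ζ)) (sphere 0 1) := by
  intro ζ hζ
  have hζ1 : ‖ζ‖ = 1 := by simpa using hζ
  refine ContinuousAt.continuousWithinAt ?_
  by_cases h : ζ.re < -1 / 2
  · refine (continuousAt_const (y := (0:E))).congr ?_
    filter_upwards [(isOpen_lt continuous_re continuous_const).mem_nhds h] with z hz
    rw [rightCutoff_eq_zero (le_of_lt hz)]; simp
  · have hs : ζ ∈ slitPlane := by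
      rw [mem_slitPlane_iff]
      by_contra! hcon
      have h1 : ζ = ((ζ.re : ℝ) : ℂ) := Complex.ext (by simp) (by simp [hcon.2])
      have h2 : ‖ζ‖ = -ζ.re := by rw [h1, norm_real, ofReal_re, Real.norm_of_nonpos hcon.1]
      linarith
    exact (continuous_ofReal.continuousAt.comp
      (continuous_rightCutoff.continuousAt.mul (hσ ζ hζ1))).smul
        (hw.continuousAt.comp (continuousAt_arg hs))

theorem exists_half_circle_push [FiniteDimensional ℂ E] {Ω U : Set E} {ρ : E → ℝ} {f : ℂ → E}
    {e₀ e₁ e₂ : E} (he : ∀ x y z : ℂ, ‖x‖ ≤ ‖x • e₀ + y • e₁ + z • e₂‖ ∧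
      ‖y‖ ≤ ‖x • e₀ + y • e₁ + z • e₂‖ ∧ ‖z‖ ≤ ‖x • e₀ + y • e₁ + z • e₂‖)
    (hU : IsOpen U) (hΩ : IsOpen Ω) (hΩU : Ω = {z ∈ U | ρ z < 0}) (hρ : ContDiffOn ℝ 3 ρ U)
    {Λ κ c₀ r₀ : ℝ} (hκ : 0 < κ) (hc₀ : 0 < c₀) (hr₀ : 0 < r₀) (hc : c₀ * (Λ + κ) ≤ 1 / 2)
    (hcr : ∀ p ∈ Ω, c₀ * -ρ p ≤ r₀ ^ 2)
    (hT : ∀ p ∈ Ω, ∀ v, ‖v‖ ≤ r₀ → p + v ∈ U ∧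
      |ρ (p + v) - ρ p - fderiv ℝ ρ p v - (1 / 2) * fderiv ℝ (fderiv ℝ ρ) p v v| ≤ κ * ‖v‖ ^ 2)
    (hL : ∀ p ∈ Ω, ∀ v, 2 * κ * ‖v‖ ^ 2 ≤ levi ρ p v ∧ levi ρ p v ≤ Λ * ‖v‖ ^ 2)
    (hf : Differentiable ℂ f) (hfΩ : ∀ ζ, ‖ζ‖ ≤ 1 → f ζ ∈ Ω) {r ε : ℝ} (hr : r < 1) (hε : 0 < ε) :
    ∃ g : ℂ → E, Differentiable ℂ g ∧ (∀ ζ, ‖ζ‖ ≤ 1 → g ζ ∈ Ω) ∧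
      (∀ ζ, ‖ζ‖ ≤ r → ‖g ζ - f ζ‖ < ε) ∧
      ∀ ζ, ‖ζ‖ = 1 → -ρ (g ζ) < (1 - c₀ * κ * rightCutoff ζ ^ 2) * -ρ (f ζ) + ε := by
  have hsubU : Ω ⊆ U := by rw [hΩU]; exact fun z hz => hz.1
  have hneg : ∀ p ∈ Ω, ρ p < 0 := by rw [hΩU]; exact fun z hz => hz.2
  have hρΩ : ContDiffOn ℝ 3 ρ Ω := hρ.mono hsubU
  have hD1 : ContDiffOn ℝ 2 (fderiv ℝ ρ) Ω := hρΩ.fderiv_of_isOpen hΩ (by norm_num)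
  have hD2 : ContDiffOn ℝ 1 (fderiv ℝ (fderiv ℝ ρ)) Ω := hD1.fderiv_of_isOpen hΩ (by norm_num)
  have hfR : ContDiff ℝ 1 f := (hf.contDiff (n := 1)).restrict_scalars ℝ
  have hexp : ContDiff ℝ 1 fun t : ℝ => exp (t * I) :=
    (contDiff_exp (𝕜 := ℝ)).comp (ofRealCLM.contDiff.mul contDiff_const)
  have hz : ContDiff ℝ 1 fun t : ℝ => f (exp (t * I)) := hfR.comp hexp
  have hzΩ : ∀ t : ℝ, f (exp (t * I)) ∈ Ω := fun t => hfΩ _ (norm_exp_ofReal_mul_I t).le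
  have hTd : ContDiff ℝ 1 fun t : ℝ => fderiv ℝ ρ (f (exp (t * I))) :=
    contDiff_iff_contDiffAt.2 fun t => (((hD1.of_le (by norm_num)).contDiffAt
      (hΩ.mem_nhds (hzΩ t))).comp t hz.contDiffAt)
  have hHd : ContDiff ℝ 1 fun t : ℝ => fderiv ℝ (fderiv ℝ ρ) (f (exp (t * I))) :=
    contDiff_iff_contDiffAt.2 fun t => ((hD2.contDiffAt (hΩ.mem_nhds (hzΩ t))).comp t hz.contDiffAt)
  have hρc : ∀ ζ, ‖ζ‖ = 1 → ContinuousAt (fun ζ => ρ (f ζ)) ζ := fun ζ hζ =>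
    (hρΩ.continuousOn.continuousAt (hΩ.mem_nhds (hfΩ ζ hζ.le))).comp hf.continuous.continuousAt
  have hsym : ∀ p ∈ Ω, ∀ v w, fderiv ℝ (fderiv ℝ ρ) p v w = fderiv ℝ (fderiv ℝ ρ) p w v :=
    fun p hp v w => fderiv_fderiv_symm hU (hρ.of_le (by norm_num)) (hsubU hp) v w
  obtain ⟨m, hm, hmle⟩ := (isCompact_sphere (0:ℂ) 1).exists_forall_le' (a := 0)
    (f := fun ζ => -ρ (f ζ))
    (fun ζ hζ => (hρc ζ (by simpa using hζ)).neg.continuousWithinAt)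
    fun ζ hζ => by
      have := hneg _ (hfΩ ζ (by simpa using (mem_sphere_zero_iff_norm.1 hζ).le))
      linarith
  obtain ⟨κ', hκ', hκ'lt⟩ : ∃ κ' > 0, κ' * (r₀ + r₀ ^ 2) < min (m / 2) ε :=
    ⟨min (m / 2) ε / (2 * (r₀ + r₀ ^ 2)), by positivity, by
      have : 0 < min (m / 2) ε := by positivity
      field_simp; linarith⟩
  obtain ⟨w, hwc, hw1, hw⟩ := exists_almost_null_direction hTd hHd
    (fun t => hsym _ (hzΩ t)) he (-Real.pi) Real.pi hκ'
  set σ : ℂ → ℝ := fun ζ => √(c₀ * -ρ (f ζ)) with hσ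
  have hσc : ∀ ζ, ‖ζ‖ = 1 → ContinuousAt σ ζ := fun ζ hζ =>
    Real.continuous_sqrt.continuousAt.comp (continuousAt_const.mul (hρc ζ hζ).neg)
  set A : ℂ → E := fun ζ => ((rightCutoff ζ * σ ζ : ℝ) : ℂ) • w (arg ζ) with hA
  have hAc : ContinuousOn A (sphere 0 1) := continuousOn_rightCutoff_smul_arg hwc hσc
  have key : ∀ ζ, ‖ζ‖ = 1 → ∀ ξ : ℂ, ‖ξ‖ ≤ 1 → f ζ + ξ • A ζ ∈ Ω ∧
      (‖ξ‖ = 1 → -ρ (f ζ + ξ • A ζ) < (1 - c₀ * κ * rightCutoff ζ ^ 2) * -ρ (f ζ) + ε) := by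
    intro ζ hζ ξ hξ
    have hp := hfΩ ζ hζ.le
    have hn := hneg _ hp
    have hχ0 := rightCutoff_nonneg ζ
    have hχ1 := rightCutoff_le_one ζ
    have harg : exp (arg ζ * I) = ζ := by
      have := norm_mul_exp_arg_mul_I ζ; rwa [hζ, ofReal_one, one_mul] at this
    obtain ⟨ha, hQ⟩ := hw (arg ζ) ⟨(neg_pi_lt_arg ζ).le, arg_le_pi ζ⟩
    rw [harg] at ha hQ
    set s : ℝ := rightCutoff ζ * σ ζ with hs
    have hs0 : 0 ≤ s := mul_nonneg hχ0 (Real.sqrt_nonneg _)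
    have hs2 : s ^ 2 = rightCutoff ζ ^ 2 * (c₀ * -ρ (f ζ)) := by
      rw [hs, mul_pow, hσ, Real.sq_sqrt (mul_nonneg hc₀.le (by linarith))]
    have hχ2 : rightCutoff ζ ^ 2 ≤ 1 := pow_le_one₀ hχ0 hχ1
    have hs2' : s ^ 2 ≤ c₀ * -ρ (f ζ) := by
      rw [hs2]
      exact mul_le_of_le_one_left (mul_nonneg hc₀.le (by linarith)) hχ2
    have hsr : s ≤ r₀ := (pow_le_pow_iff_left₀ hs0 hr₀.le two_ne_zero).1 (hs2'.trans (hcr _ hp))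
    have hAn : ‖A ζ‖ = s := by
      rw [hA]; simp only
      rw [norm_smul, norm_real, hw1, mul_one, Real.norm_of_nonneg hs0]
    have haA : ‖holPart (fderiv ℝ ρ (f ζ)) (A ζ)‖ ≤ r₀ * κ' := by
      rw [hA]; simp only
      rw [holPart_smul, norm_mul, norm_real, Real.norm_of_nonneg hs0]
      exact mul_le_mul hsr ha (norm_nonneg _) hr₀.le
    have hQA : ‖holHess (fderiv ℝ (fderiv ℝ ρ) (f ζ)) (A ζ) (A ζ)‖ ≤ r₀ ^ 2 * κ' := by
      rw [hA]; simp only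
      rw [holHess_smul_smul (hsym _ hp), norm_mul, norm_pow, norm_real, Real.norm_of_nonneg hs0]
      exact mul_le_mul (pow_le_pow_left₀ hs0 hsr 2) hQ (norm_nonneg _) (by positivity)
    have hξA : ‖ξ • A ζ‖ ≤ r₀ := by
      rw [norm_smul, hAn]
      exact (mul_le_of_le_one_left hs0 hξ).trans hsr
    have hmain := abs_le.1 (abs_sub_levi_le (hsym _ hp) (fun v hv => (hT _ hp v hv).2) hκ.le
      (hAn.trans_le hsr) hξ)
    obtain ⟨hL1, hL2⟩ := hL _ hp (A ζ)
    rw [hAn] at hmain hL1 hL2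
    have hmm := hmle ζ (by simpa using hζ)
    have hk1 : κ' * (r₀ + r₀ ^ 2) < m / 2 := hκ'lt.trans_le (min_le_left _ _)
    have hk2 : κ' * (r₀ + r₀ ^ 2) < ε := hκ'lt.trans_le (min_le_right _ _)
    have hr2 : 0 ≤ r₀ ^ 2 * κ' := by positivity
    refine ⟨?_, fun hξ1 => ?_⟩
    · rw [hΩU]
      refine ⟨(hT _ hp _ hξA).1, ?_⟩
      have h1 : ‖ξ‖ ^ 2 * levi ρ (f ζ) (A ζ) ≤ Λ * s ^ 2 := by
        refine (mul_le_of_le_one_left ?_ (pow_le_one₀ (norm_nonneg _) hξ)).trans hL2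
        exact le_trans (by positivity) hL1
      have h2 : Λ * s ^ 2 + κ * s ^ 2 ≤ 1 / 2 * -ρ (f ζ) := by
        by_cases hΛ : 0 ≤ Λ + κ
        · calc Λ * s ^ 2 + κ * s ^ 2 = (Λ + κ) * s ^ 2 := by ring
            _ ≤ (Λ + κ) * (c₀ * -ρ (f ζ)) := by gcongr
            _ = c₀ * (Λ + κ) * -ρ (f ζ) := by ring
            _ ≤ 1 / 2 * -ρ (f ζ) := by gcongr; linarith
        · have : (Λ + κ) * s ^ 2 ≤ 0 := mul_nonpos_of_nonpos_of_nonneg (by linarith) (by positivity)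
          linarith
      linarith [hmain.2]
    · have h1 : κ * s ^ 2 = c₀ * κ * rightCutoff ζ ^ 2 * -ρ (f ζ) := by rw [hs2]; ring
      rw [hξ1] at hmain
      linarith [hmain.1]
  have hGo : IsOpen ({x : ℂ × E | x.2 ∈ Ω ∧ f x.1 ∈ Ω} ∩ (fun x : ℂ × E => -ρ x.2 -
      ((1 - c₀ * κ * rightCutoff x.1 ^ 2) * -ρ (f x.1) + ε)) ⁻¹' Iio 0) := by
    refine ContinuousOn.isOpen_inter_preimage ?_ ?_ isOpen_Iio
    · have h1 : ContinuousOn (fun x : ℂ × E => ρ x.2) {x : ℂ × E | x.2 ∈ Ω ∧ f x.1 ∈ Ω} :=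
        hρΩ.continuousOn.comp continuous_snd.continuousOn fun x hx => hx.1
      have h2 : ContinuousOn (fun x : ℂ × E => ρ (f x.1)) {x : ℂ × E | x.2 ∈ Ω ∧ f x.1 ∈ Ω} :=
        hρΩ.continuousOn.comp (hf.continuous.comp continuous_fst).continuousOn fun x hx => hx.2
      have h3 := continuous_rightCutoff
      exact h1.neg.sub (((by fun_prop : Continuous fun x : ℂ × E =>
        1 - c₀ * κ * rightCutoff x.1 ^ 2).continuousOn.mul h2.neg).add continuousOn_const)
    · exact (hΩ.preimage continuous_snd).inter (hΩ.preimage (hf.continuous.comp continuous_fst))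
  obtain ⟨g, hg, hgΩ, hgr, hgG⟩ := exists_entire_push hΩ hGo hf hfΩ hAc
    (fun ζ hζ ξ hξ => (key ζ hζ ξ hξ).1)
    (fun ζ hζ ξ hξ => ⟨⟨(key ζ hζ ξ hξ.le).1, hfΩ ζ hζ.le⟩, by
      have := (key ζ hζ ξ hξ.le).2 hξ
      change _ - _ < (0:ℝ); linarith⟩) hr hε
  refine ⟨g, hg, hgΩ, hgr, fun ζ hζ => ?_⟩
  have : _ - _ < (0:ℝ) := (hgG ζ hζ).2
  linarith

end Push

section Iteration

variable {E : Type*} [NormedAddCommGroup E] [NormedSpace ℂ E]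

theorem exists_entire_approx [CompleteSpace E] {f₀ : ℂ → E} (hc : ContinuousOn f₀ (closedBall 0 1))
    (hd : DifferentiableOn ℂ f₀ (ball 0 1)) {ε : ℝ} (hε : 0 < ε) :
    ∃ f : ℂ → E, Differentiable ℂ f ∧ ∀ ζ, ‖ζ‖ ≤ 1 → ‖f ζ - f₀ ζ‖ < ε := by
  obtain ⟨δ, hδ, hδε⟩ := Metric.uniformContinuousOn_iff.1
    ((isCompact_closedBall (0:ℂ) 1).uniformContinuousOn_of_continuous hc) (ε / 2) (by positivity)
  obtain ⟨s, hs0, hs1, hsδ⟩ : ∃ s : ℝ, 0 < s ∧ s < 1 ∧ 1 - s < δ :=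
    ⟨max (1 / 2) (1 - δ / 2), by positivity, by simp; norm_num; exact hδ, by
      have := le_max_right (1 / 2) (1 - δ / 2); linarith⟩
  obtain ⟨R, hsR, hR1⟩ := exists_between hs1
  obtain ⟨r, hsr, hrR⟩ := exists_between hsR
  lift R to NNReal using by linarith
  lift r to NNReal using by linarith
  have hR0 : 0 < R := by
    have : (0:ℝ) < R := by linarith
    exact_mod_cast this
  have hps := (hd.mono (closedBall_subset_ball hR1)).hasFPowerSeriesOnBall hR0
  have hu := hps.tendstoUniformlyOn (r' := r) (by exact_mod_cast hrR)
  obtain ⟨N, hN⟩ := (Metric.tendstoUniformlyOn_iff.1 hu (ε / 2) (by positivity)).exists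
  refine ⟨fun ζ => (cauchyPowerSeries f₀ 0 R).partialSum N ((s : ℂ) * ζ), ?_, fun ζ hζ => ?_⟩
  · unfold FormalMultilinearSeries.partialSum
    simp only [FormalMultilinearSeries.apply_eq_pow_smul_coeff]
    fun_prop
  · have hsζ : ‖(s : ℂ) * ζ‖ ≤ s := by
      rw [norm_mul, norm_real, Real.norm_of_nonneg hs0.le]
      exact mul_le_of_le_one_right hs0.le hζ
    have h1 := hN ((s : ℂ) * ζ) (by simpa using lt_of_le_of_lt hsζ hsr)
    have h2 := hδε ((s : ℂ) * ζ) (by simpa using hsζ.trans hs1.le) ζ (by simpa using hζ) (by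
      rw [dist_eq_norm, show (s : ℂ) * ζ - ζ = -(((1 - s : ℝ) : ℂ) * ζ) by push_cast; ring,
          norm_neg,
        norm_mul, norm_real, Real.norm_of_nonneg (by linarith)]
      exact (mul_le_of_le_one_right (by linarith) hζ).trans_lt hsδ)
    rw [zero_add] at h1
    rw [← dist_eq_norm]
    have := dist_triangle_left ((cauchyPowerSeries f₀ 0 R).partialSum N ((s : ℂ) * ζ)) (f₀ ζ)
      (f₀ ((s : ℂ) * ζ))
    linarith

theorem exists_circle_push {Ω : Set E} {ρ : E → ℝ} (hneg : ∀ p ∈ Ω, ρ p < 0) {c : ℝ} (hc₀ : 0 ≤ c)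
    (hc₁ : c ≤ 1)
    (H : ∀ f : ℂ → E, Differentiable ℂ f → (∀ ζ, ‖ζ‖ ≤ 1 → f ζ ∈ Ω) → ∀ r ε : ℝ, r < 1 → 0 < ε →
      ∃ g : ℂ → E, Differentiable ℂ g ∧ (∀ ζ, ‖ζ‖ ≤ 1 → g ζ ∈ Ω) ∧
        (∀ ζ, ‖ζ‖ ≤ r → ‖g ζ - f ζ‖ < ε) ∧
        ∀ ζ, ‖ζ‖ = 1 → -ρ (g ζ) < (1 - c * rightCutoff ζ ^ 2) * -ρ (f ζ) + ε)
    {f : ℂ → E} (hf : Differentiable ℂ f) (hfΩ : ∀ ζ, ‖ζ‖ ≤ 1 → f ζ ∈ Ω) {r ε : ℝ} (hr : r < 1)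
    (hε : 0 < ε) :
    ∃ g : ℂ → E, Differentiable ℂ g ∧ (∀ ζ, ‖ζ‖ ≤ 1 → g ζ ∈ Ω) ∧
      (∀ ζ, ‖ζ‖ ≤ r → ‖g ζ - f ζ‖ < ε) ∧
      ∀ ζ, ‖ζ‖ = 1 → -ρ (g ζ) ≤ (1 - c) * -ρ (f ζ) + ε := by
  obtain ⟨g₁, hg₁, hg₁Ω, hg₁r, hg₁ρ⟩ := H f hf hfΩ r (ε / 2) hr (by positivity)
  obtain ⟨g₂, hg₂, hg₂Ω, hg₂r, hg₂ρ⟩ := H (fun ζ => g₁ (-ζ)) (by fun_prop)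
    (fun ζ hζ => hg₁Ω _ (by simpa using hζ)) r (ε / 2) hr (by positivity)
  refine ⟨fun ζ => g₂ (-ζ), by fun_prop, fun ζ hζ => hg₂Ω _ (by simpa using hζ), fun ζ hζ => ?_,
    fun ζ hζ => ?_⟩
  · have h1 := hg₂r (-ζ) (by simpa using hζ)
    have h2 := hg₁r ζ hζ
    simp only [neg_neg] at h1
    have := norm_sub_le_norm_sub_add_norm_sub (g₂ (-ζ)) (g₁ ζ) (f ζ)
    simp only; linarith
  · have h1 := hg₂ρ (-ζ) (by simpa using hζ)
    have h2 := hg₁ρ ζ hζ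
    have hf0 : 0 ≤ -ρ (f ζ) := by have := hneg _ (hfΩ ζ hζ.le); linarith
    have hg0 : 0 ≤ -ρ (g₁ ζ) := by have := hneg _ (hg₁Ω ζ hζ.le); linarith
    simp only [neg_neg] at h1
    have hχ : ∀ z, 0 ≤ c * rightCutoff z ^ 2 := fun z => by positivity
    rcases le_total 0 ζ.re with h | h
    · rw [rightCutoff_eq_one h] at h2
      have h3 := mul_nonneg (hχ (-ζ)) hg0
      simp only; linarith
    · rw [rightCutoff_eq_one (ζ := -ζ) (by simpa using h)] at h1
      have h3 := mul_nonneg (hχ ζ) hf0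
      have h4 : (1 - c) * -ρ (g₁ ζ) ≤ (1 - c) * (-ρ (f ζ) + ε / 2) :=
        mul_le_mul_of_nonneg_left (by linarith) (by linarith)
      have h5 : 0 ≤ c * (ε / 2) := by positivity
      simp only; linarith

theorem exists_iterated_push {Ω : Set E} {ρ : E → ℝ} {c P : ℝ} (hc₀ : 0 < c)
    (hc₁ : c ≤ 1) (hP : ∀ p ∈ Ω, -ρ p ≤ P)
    (H : ∀ f : ℂ → E, Differentiable ℂ f → (∀ ζ, ‖ζ‖ ≤ 1 → f ζ ∈ Ω) → ∀ r ε : ℝ, r < 1 → 0 < ε →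
      ∃ g : ℂ → E, Differentiable ℂ g ∧ (∀ ζ, ‖ζ‖ ≤ 1 → g ζ ∈ Ω) ∧
        (∀ ζ, ‖ζ‖ ≤ r → ‖g ζ - f ζ‖ < ε) ∧
        ∀ ζ, ‖ζ‖ = 1 → -ρ (g ζ) ≤ (1 - c) * -ρ (f ζ) + ε)
    {f : ℂ → E} (hf : Differentiable ℂ f) (hfΩ : ∀ ζ, ‖ζ‖ ≤ 1 → f ζ ∈ Ω) {r ε δ : ℝ} (hr : r < 1)
    (hε : 0 < ε) (hδ : 0 < δ) :
    ∃ g : ℂ → E, Differentiable ℂ g ∧ (∀ ζ, ‖ζ‖ ≤ 1 → g ζ ∈ Ω) ∧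
      (∀ ζ, ‖ζ‖ ≤ r → ‖g ζ - f ζ‖ < ε) ∧ ∀ ζ, ‖ζ‖ = 1 → -ρ (g ζ) < δ := by
  have main : ∀ k : ℕ, ∀ ε > 0, ∃ g : ℂ → E, Differentiable ℂ g ∧ (∀ ζ, ‖ζ‖ ≤ 1 → g ζ ∈ Ω) ∧
      (∀ ζ, ‖ζ‖ ≤ r → ‖g ζ - f ζ‖ < ε) ∧ ∀ ζ, ‖ζ‖ = 1 → -ρ (g ζ) ≤ (1 - c) ^ k * P + ε := by
    intro k
    induction k with
    | zero =>
      refine fun ε hε => ⟨f, hf, hfΩ, fun ζ _ => by simpa using hε, fun ζ hζ => ?_⟩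
      have := hP _ (hfΩ ζ hζ.le)
      rw [pow_zero, one_mul]; linarith
    | succ k ih =>
      intro ε hε
      obtain ⟨g₁, hg₁, hg₁Ω, hg₁r, hg₁ρ⟩ := ih (ε / 2) (by positivity)
      obtain ⟨g, hg, hgΩ, hgr, hgρ⟩ := H g₁ hg₁ hg₁Ω r (ε / 2) hr (by positivity)
      refine ⟨g, hg, hgΩ, fun ζ hζ => ?_, fun ζ hζ => (hgρ ζ hζ).trans ?_⟩
      · have := norm_sub_le_norm_sub_add_norm_sub (g ζ) (g₁ ζ) (f ζ)
        linarith [hgr ζ hζ, hg₁r ζ hζ]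
      · have h1 : (1 - c) * -ρ (g₁ ζ) ≤ (1 - c) * ((1 - c) ^ k * P + ε / 2) :=
          mul_le_mul_of_nonneg_left (hg₁ρ ζ hζ) (by linarith)
        have h2 : 0 ≤ c * (ε / 2) := by positivity
        rw [pow_succ']; linarith
  have hlim : Filter.Tendsto (fun k : ℕ => (1 - c) ^ k * P) Filter.atTop (nhds (0 * P)) :=
    (tendsto_pow_atTop_nhds_zero_of_lt_one (by linarith) (by linarith)).mul_const P
  rw [zero_mul] at hlim
  obtain ⟨k, hk⟩ := (hlim.eventually_lt_const (half_pos hδ)).exists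
  obtain ⟨g, hg, hgΩ, hgr, hgρ⟩ := main k (min ε (δ / 4)) (by positivity)
  refine ⟨g, hg, hgΩ, fun ζ hζ => (hgr ζ hζ).trans_le (min_le_left _ _), fun ζ hζ => ?_⟩
  linarith [hgρ ζ hζ, min_le_right ε (δ / 4)]

theorem levi_le_norm_fderiv (ρ : E → ℝ) (p v : E) :
    levi ρ p v ≤ ‖fderiv ℝ (fderiv ℝ ρ) p‖ * ‖v‖ ^ 2 := by
  have h : ∀ v, fderiv ℝ (fderiv ℝ ρ) p v v ≤ ‖fderiv ℝ (fderiv ℝ ρ) p‖ * ‖v‖ ^ 2 := fun v =>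
    ((le_abs_self _).trans ((fderiv ℝ (fderiv ℝ ρ) p).le_opNorm₂ v v)).trans_eq (by ring)
  have h1 := h v
  have h2 := h (I • v)
  rw [norm_smul, norm_I, one_mul] at h2
  have h3 : 0 ≤ ‖fderiv ℝ (fderiv ℝ ρ) p‖ * ‖v‖ ^ 2 :=
    mul_nonneg (norm_nonneg (fderiv ℝ (fderiv ℝ ρ) p)) (by positivity)
  unfold levi D2
  linarith

theorem exists_entire_near_boundary [FiniteDimensional ℂ E] {Ω U : Set E} {ρ : E → ℝ}
    {e₀ e₁ e₂ : E} (he : ∀ x y z : ℂ, ‖x‖ ≤ ‖x • e₀ + y • e₁ + z • e₂‖ ∧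
      ‖y‖ ≤ ‖x • e₀ + y • e₁ + z • e₂‖ ∧ ‖z‖ ≤ ‖x • e₀ + y • e₁ + z • e₂‖)
    (hU : IsOpen U) (hbd : IsBounded Ω) (hcl : closure Ω ⊆ U) (hΩ : Ω = {z ∈ U | ρ z < 0})
    (hρ : ContDiffOn ℝ 3 ρ U) (hpsh : ∀ z ∈ U, ∀ w : E, w ≠ 0 → 0 < levi ρ z w)
    {f₀ : ℂ → E} (hc : ContinuousOn f₀ (closedBall 0 1))
    (hd : DifferentiableOn ℂ f₀ (ball 0 1)) (hf₀Ω : MapsTo f₀ (closedBall 0 1) Ω)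
    {r ε δ : ℝ} (hr : r < 1) (hε : 0 < ε) (hδ : 0 < δ) :
    ∃ f : ℂ → E, Differentiable ℂ f ∧ (∀ ζ, ‖ζ‖ ≤ 1 → f ζ ∈ Ω) ∧
      (∀ ζ, ‖ζ‖ ≤ r → ‖f ζ - f₀ ζ‖ < ε) ∧ ∀ ζ, ‖ζ‖ = 1 → -ρ (f ζ) < δ := by
  have : ProperSpace E := FiniteDimensional.proper ℂ E
  have : CompleteSpace E := FiniteDimensional.complete ℂ E
  have hC : IsCompact (closure Ω) := hbd.isCompact_closure
  have hρ2 : ContDiffOn ℝ 2 ρ U := hρ.of_le (by norm_num)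
  have hΩo : IsOpen Ω := by
    rw [hΩ]; exact hρ.continuousOn.isOpen_inter_preimage hU isOpen_Iio
  obtain ⟨l, hl, hlev⟩ := exists_levi_lower_bound hU hC hcl hρ2 hpsh
  obtain ⟨Λ, hΛ, hH⟩ := exists_norm_bound_of_continuousOn (F := E →L[ℝ] E →L[ℝ] ℝ) hC
    ((continuousOn_fderiv_fderiv hU hρ2).mono hcl)
  obtain ⟨r₀, hr₀, hT⟩ := exists_uniform_taylor hU hC hcl hρ2 (half_pos hl)
  obtain ⟨P, hP, hρP⟩ := exists_norm_bound_of_continuousOn hC (hρ.continuousOn.mono hcl)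
  have hρP' : ∀ p ∈ Ω, -ρ p ≤ P := fun p hp =>
    (neg_le_abs (ρ p)).trans (hρP p (subset_closure hp))
  obtain ⟨c₀, hc₀, hc1, hc2⟩ : ∃ c₀ > 0, c₀ * (Λ + l / 2) ≤ 1 / 2 ∧ c₀ * P ≤ r₀ ^ 2 := by
    refine ⟨min (1 / 2 / (Λ + l / 2)) (r₀ ^ 2 / P), by positivity, ?_, ?_⟩
    · rw [← le_div_iff₀ (by positivity)]; exact min_le_left _ _
    · rw [← le_div_iff₀ (by positivity)]; exact min_le_right _ _
  have hc3 : c₀ * (l / 2) ≤ 1 := by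
    have : 0 < c₀ * Λ := by positivity
    linarith
  obtain ⟨ε₀, hε₀, hth⟩ := ((isCompact_closedBall (0:ℂ) 1).image_of_continuousOn
    hc).exists_thickening_subset_open hΩo (by rintro _ ⟨ζ, hζ, rfl⟩; exact hf₀Ω hζ)
  obtain ⟨f₁, hf₁, hf₁ε⟩ := exists_entire_approx hc hd (ε := min ε₀ (ε / 2)) (by positivity)
  have hf₁Ω : ∀ ζ, ‖ζ‖ ≤ 1 → f₁ ζ ∈ Ω := fun ζ hζ =>
    hth (mem_thickening_iff.2 ⟨f₀ ζ, mem_image_of_mem _ (by simpa using hζ), by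
      rw [dist_eq_norm]; exact (hf₁ε ζ hζ).trans_le (min_le_left _ _)⟩)
  obtain ⟨f, hf, hfΩ, hfr, hfρ⟩ := exists_iterated_push (c := c₀ * (l / 2)) (by positivity) hc3 hρP'
    (fun f hf hfΩ r ε hr hε => exists_circle_push (fun p hp => (hΩ.subset hp).2) (by positivity) hc3
      (fun f hf hfΩ r ε hr hε => exists_half_circle_push he hU hΩo hΩ hρ (half_pos hl) hc₀ hr₀ hc1
        (fun p hp => (mul_le_mul_of_nonneg_left (hρP' p hp) hc₀.le).trans hc2)
        (fun p hp v hv => have h := hT p (subset_closure hp) v hv; ⟨h.1, h.2.1⟩)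
        (fun p hp v => ⟨by have := hlev p (subset_closure hp) v; linarith,
          (levi_le_norm_fderiv ρ p v).trans (mul_le_mul_of_nonneg_right
            (hH p (subset_closure hp)) (by positivity))⟩) hf hfΩ hr hε) hf hfΩ hr hε)
    hf₁ hf₁Ω hr (half_pos hε) hδ
  refine ⟨f, hf, hfΩ, fun ζ hζ => ?_, hfρ⟩
  have h1 := hf₁ε ζ (hζ.trans hr.le)
  have := norm_sub_le_norm_sub_add_norm_sub (f ζ) (f₁ ζ) (f₀ ζ)
  linarith [hfr ζ hζ, min_le_right ε₀ (ε / 2)]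

end Iteration

section QuadraticDiscs

variable {E : Type*} [NormedAddCommGroup E] [NormedSpace ℂ E]

theorem exists_collar_bound {X : Type*} [TopologicalSpace X] {C : Set X} (hC : IsCompact C)
    {ρ g : X → ℝ} (hρ : ContinuousOn ρ C) (hg : ContinuousOn g C)
    (h : ∀ p ∈ C, 0 ≤ ρ p → 0 < g p) : ∃ m > 0, ∀ p ∈ C, -ρ p < m → m ≤ g p := by
  obtain ⟨m, hm, hle⟩ := hC.exists_forall_le' (hρ.neg.sup hg) (a := 0) fun p hp => by
    rcases le_or_gt 0 (ρ p) with h0 | h0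
    · exact lt_sup_of_lt_right (h p hp h0)
    · exact lt_sup_of_lt_left (by simpa using h0)
  refine ⟨m, hm, fun p hp hlt => ?_⟩
  rcases le_sup_iff.1 (hle p hp) with h1 | h1
  · exact absurd h1 (not_le.2 hlt)
  · exact h1

theorem exists_almost_tangent_direction {T : ℂ → E →L[ℝ] ℝ} (hTc : ContinuousOn T (sphere 0 1))
    (hT : ContDiff ℝ 1 fun t : ℝ => T (exp (t * I)))
    {e₀ e₁ : E} (he : ∀ x y : ℂ, ‖x‖ ≤ ‖x • e₀ + y • e₁‖ ∧ ‖y‖ ≤ ‖x • e₀ + y • e₁‖)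
    {κ : ℝ} (hκ : 0 < κ) :
    ∃ w : ℂ → E, ContinuousOn w (sphere 0 1) ∧ ∀ ζ, ‖ζ‖ = 1 →
      ‖w ζ‖ = 1 ∧ ‖holPart (T ζ) (w ζ)‖ ≤ κ := by
  have ha : ContDiff ℝ 1 fun t : ℝ => holPart (T (exp (t * I))) e₁ := hT.holPart contDiff_const
  obtain ⟨c, hc, hne⟩ := exists_shift_ne_zero ha hκ
  set v : ℂ → E := fun ζ => (holPart (T ζ) e₁ + c) • e₀ + (-holPart (T ζ) e₀) • e₁ with hv
  have hac : ∀ e : E, ContinuousOn (fun ζ => holPart (T ζ) e) (sphere 0 1) := fun e => by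
    unfold holPart
    have h1 : ∀ e : E, ContinuousOn (fun ζ => ((T ζ e : ℝ) : ℂ)) (sphere 0 1) := fun e =>
      continuous_ofReal.comp_continuousOn (hTc.clm_apply continuousOn_const)
    exact (h1 e).sub (continuousOn_const.mul (h1 (I • e)))
  have hvc : ContinuousOn v (sphere 0 1) :=
    (((hac e₁).add continuousOn_const).smul continuousOn_const).add
      ((hac e₀).neg.smul continuousOn_const)
  have hv0 : ∀ ζ, ‖ζ‖ = 1 → 0 < ‖v ζ‖ := fun ζ hζ => by
    obtain ⟨t, rfl⟩ := exists_exp_eq_of_norm_eq_one hζ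
    exact (norm_pos_iff.2 (hne t)).trans_le (he _ _).1
  refine ⟨fun ζ => ((‖v ζ‖⁻¹ : ℝ) : ℂ) • v ζ, ?_, fun ζ hζ => ⟨?_, ?_⟩⟩
  · exact (continuous_ofReal.comp_continuousOn
      (hvc.norm.inv₀ fun ζ hζ => (hv0 ζ (by simpa using hζ)).ne')).smul hvc
  · rw [norm_smul, norm_real, norm_inv, norm_norm, inv_mul_cancel₀ (hv0 ζ hζ).ne']
  · have h1 : holPart (T ζ) (v ζ) = c * holPart (T ζ) e₀ := by
      rw [hv]; simp only
      rw [holPart_add, holPart_smul, holPart_smul]; ring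
    rw [holPart_smul, h1, norm_mul, norm_mul, norm_real, norm_inv, norm_norm,
      inv_mul_le_iff₀ (hv0 ζ hζ), mul_comm (‖v ζ‖)]
    refine mul_le_mul hc.le ?_ (norm_nonneg _) hκ.le
    exact (norm_neg _).symm.trans_le (he (holPart (T ζ) e₁ + c) (-holPart (T ζ) e₀)).2

theorem ContinuousOn.holHess {X : Type*} [TopologicalSpace X] {S : Set X}
    {H : X → E →L[ℝ] E →L[ℝ] ℝ} {w : X → E} (hH : ContinuousOn H S) (hw : ContinuousOn w S) :
    ContinuousOn (fun x => holHess (H x) (w x) (w x)) S := by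
  unfold _root_.holHess holPart
  have hI : ContinuousOn (fun x => I • w x) S := hw.const_smul I
  have h1 := continuous_ofReal.comp_continuousOn ((hH.clm_apply hw).clm_apply hw)
  have h2 := continuous_ofReal.comp_continuousOn ((hH.clm_apply hw).clm_apply hI)
  have h3 := continuous_ofReal.comp_continuousOn ((hH.clm_apply hI).clm_apply hw)
  have h4 := continuous_ofReal.comp_continuousOn ((hH.clm_apply hI).clm_apply hI)
  exact continuousOn_const.mul ((h1.sub (continuousOn_const.mul h2)).sub
    (continuousOn_const.mul (h3.sub (continuousOn_const.mul h4))))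

/-- The disc `ξ ↦ p + ξ A + ξ² B` starts well inside `{ρ < 0}`, leaves it through radius two, and
`ρ` increases radially along it at a rate dominating the angular derivative. -/
structure CrossingDisc (U : Set E) (ρ : E → ℝ) (p A B : E) : Prop where
  mem : ∀ ξ : ℂ, ‖ξ‖ ≤ 2 → p + (ξ • A + ξ ^ 2 • B) ∈ U
  neg : ∀ ξ : ℂ, ‖ξ‖ ≤ 1 / 2 → ρ (p + (ξ • A + ξ ^ 2 • B)) < 0
  pos : ∀ ξ : ℂ, ‖ξ‖ = 2 → 0 < ρ (p + (ξ • A + ξ ^ 2 • B))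
  cone : ∀ ξ : ℂ, 1 / 2 ≤ ‖ξ‖ → ‖ξ‖ ≤ 2 →
    8 * |fderiv ℝ ρ (p + (ξ • A + ξ ^ 2 • B)) (I • (ξ • A + (2 * ξ ^ 2) • B))| <
      fderiv ℝ ρ (p + (ξ • A + ξ ^ 2 • B)) (ξ • A + (2 * ξ ^ 2) • B)

theorem exists_crossingDiscs [FiniteDimensional ℂ E] {Ω U : Set E} {ρ : E → ℝ}
    {e₀ e₁ : E} (he : ∀ x y : ℂ, ‖x‖ ≤ ‖x • e₀ + y • e₁‖ ∧ ‖y‖ ≤ ‖x • e₀ + y • e₁‖)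
    (hU : IsOpen U) (hbd : IsBounded Ω) (hcl : closure Ω ⊆ U) (hΩ : Ω = {z ∈ U | ρ z < 0})
    (hρ : ContDiffOn ℝ 3 ρ U) (hpsh : ∀ z ∈ U, ∀ w : E, w ≠ 0 → 0 < levi ρ z w)
    {v : E → E} (hv : ContinuousOn v U)
    (hva : ∀ p, holPart (fderiv ℝ ρ p) (v p) = (‖v p‖ : ℂ) ^ 2)
    (hv0 : ∀ p ∈ frontier Ω, v p ≠ 0) :
    ∃ δ > 0, ∀ f : ℂ → E, Differentiable ℂ f → (∀ ζ, ‖ζ‖ = 1 → f ζ ∈ Ω) →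
      (∀ ζ, ‖ζ‖ = 1 → -ρ (f ζ) < δ) →
      ∃ A B : ℂ → E, ContinuousOn A (sphere 0 1) ∧ ContinuousOn B (sphere 0 1) ∧
        ∀ ζ, ‖ζ‖ = 1 → CrossingDisc U ρ (f ζ) (A ζ) (B ζ) := by
  have : ProperSpace E := FiniteDimensional.proper ℂ E
  have hC : IsCompact (closure Ω) := hbd.isCompact_closure
  have hρ2 : ContDiffOn ℝ 2 ρ U := hρ.of_le (by norm_num)
  have hsubU : Ω ⊆ U := subset_closure.trans hcl
  have hΩo : IsOpen Ω := by
    rw [hΩ]; exact hρ.continuousOn.isOpen_inter_preimage hU isOpen_Iio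
  have hneg : ∀ p ∈ Ω, ρ p < 0 := fun p hp => (hΩ.subset hp).2
  obtain ⟨l, hl, hlev⟩ := exists_levi_lower_bound hU hC hcl hρ2 hpsh
  obtain ⟨Λ, hΛ, hH⟩ := exists_norm_bound_of_continuousOn (F := E →L[ℝ] E →L[ℝ] ℝ) hC
    ((continuousOn_fderiv_fderiv hU hρ2).mono hcl)
  obtain ⟨m, hm, hmv⟩ := exists_collar_bound hC (hρ.continuousOn.mono hcl) (hv.mono hcl).norm
    fun p hp h0 => norm_pos_iff.2 (hv0 p ⟨hp, fun h => by
      rw [hΩo.interior_eq] at h; exact absurd (hneg p h) (not_lt.2 h0)⟩)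
  have hκ : 0 < l / 4800 := by positivity
  obtain ⟨R, hR, hT⟩ := exists_uniform_taylor hU hC hcl hρ2 hκ
  obtain ⟨r₁, hr₁, hr₁R, hr₁s, hr₁l⟩ : ∃ r₁ > 0, 3 * r₁ ≤ R ∧ r₁ * (Λ / m) ≤ 1 / 4 ∧
      32 * Λ * (r₁ * (Λ / m)) ≤ l / 400 := by
    refine ⟨min (R / 3) (min (1 / 4 / (Λ / m)) (l / 400 / (32 * Λ) / (Λ / m))), by positivity,
      ?_, ?_, ?_⟩
    · have := min_le_left (R / 3) (min (1 / 4 / (Λ / m)) (l / 400 / (32 * Λ) / (Λ / m)))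
      linarith
    · rw [← le_div_iff₀ (by positivity)]
      exact (min_le_right _ _).trans (min_le_left _ _)
    · rw [← le_div_iff₀' (by positivity), ← le_div_iff₀ (by positivity)]
      exact (min_le_right _ _).trans (min_le_right _ _)
  refine ⟨min m (l * r₁ ^ 2), by positivity, fun f hf hfΩ hfδ => ?_⟩
  have hfR : ContDiff ℝ 1 f := (hf.contDiff (n := 1)).restrict_scalars ℝ
  have hexp : ContDiff ℝ 1 fun t : ℝ => exp (t * I) :=
    (contDiff_exp (𝕜 := ℝ)).comp (ofRealCLM.contDiff.mul contDiff_const)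
  have hzΩ : ∀ t : ℝ, f (exp (t * I)) ∈ Ω := fun t => hfΩ _ (norm_exp_ofReal_mul_I t)
  have hD1 : ContDiffOn ℝ 1 (fderiv ℝ ρ) U := hρ2.fderiv_of_isOpen hU (by norm_num)
  have hTd : ContDiff ℝ 1 fun t : ℝ => fderiv ℝ ρ (f (exp (t * I))) :=
    contDiff_iff_contDiffAt.2 fun t => ((hD1.contDiffAt
      (hU.mem_nhds (hsubU (hzΩ t)))).comp t (hfR.comp hexp).contDiffAt)
  have hmaps : MapsTo f (sphere 0 1) U := fun ζ hζ => hsubU (hfΩ ζ (by simpa using hζ))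
  have hfc : ContinuousOn f (sphere 0 1) := hf.continuous.continuousOn
  have hρfc : ContinuousOn (fun ζ => ρ (f ζ)) (sphere 0 1) := hρ.continuousOn.comp hfc hmaps
  have hTc : ContinuousOn (fun ζ => fderiv ℝ ρ (f ζ)) (sphere 0 1) :=
    (continuousOn_fderiv hU hρ2).comp hfc hmaps
  have hHc : ContinuousOn (fun ζ => fderiv ℝ (fderiv ℝ ρ) (f ζ)) (sphere 0 1) :=
    (continuousOn_fderiv_fderiv hU hρ2).comp hfc hmaps
  have hvc : ContinuousOn (fun ζ => v (f ζ)) (sphere 0 1) := hv.comp hfc hmaps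
  obtain ⟨τ, hτ, hτle⟩ := (isCompact_sphere (0:ℂ) 1).exists_forall_le' hρfc.neg (a := 0)
    fun ζ hζ => by
      have := hneg _ (hfΩ ζ (by simpa using hζ))
      simpa using this
  obtain ⟨w, hwc, hw⟩ := exists_almost_tangent_direction hTc hTd he
    (by positivity : 0 < l / 800 * √(τ / Λ))
  have hLc : ContinuousOn (fun ζ => levi ρ (f ζ) (w ζ)) (sphere 0 1) := by
    unfold levi D2
    have hI : ContinuousOn (fun ζ => I • w ζ) (sphere 0 1) := hwc.const_smul I
    exact continuousOn_const.mul (((hHc.clm_apply hwc).clm_apply hwc).add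
      ((hHc.clm_apply hI).clm_apply hI))
  have hLl : ∀ ζ, ‖ζ‖ = 1 → l ≤ levi ρ (f ζ) (w ζ) := fun ζ hζ => by
    simpa [(hw ζ hζ).1] using hlev _ (subset_closure (hfΩ ζ hζ)) (w ζ)
  have hLΛ : ∀ ζ, ‖ζ‖ = 1 → levi ρ (f ζ) (w ζ) ≤ Λ := fun ζ hζ => by
    have h1 := levi_le_norm_fderiv ρ (f ζ) (w ζ)
    rw [(hw ζ hζ).1, one_pow, mul_one] at h1
    exact h1.trans (hH _ (subset_closure (hfΩ ζ hζ)))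
  set r : ℂ → ℝ := fun ζ => √(-ρ (f ζ) / levi ρ (f ζ) (w ζ)) with hr
  have hrc : ContinuousOn r (sphere 0 1) := Real.continuous_sqrt.comp_continuousOn
    (hρfc.neg.div hLc fun ζ hζ => (hl.trans_le (hLl ζ (by simpa using hζ))).ne')
  set A : ℂ → E := fun ζ => ((r ζ : ℝ) : ℂ) • w ζ with hA
  set B : ℂ → E := fun ζ => (((r ζ : ℝ) : ℂ) ^ 2 *
    (-(1 / 2) * holHess (fderiv ℝ (fderiv ℝ ρ) (f ζ)) (w ζ) (w ζ) / (‖v (f ζ)‖ : ℂ) ^ 2)) •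
      v (f ζ) with hB
  have hvm : ∀ ζ, ‖ζ‖ = 1 → m ≤ ‖v (f ζ)‖ := fun ζ hζ =>
    hmv _ (subset_closure (hfΩ ζ hζ)) ((hfδ ζ hζ).trans_le (min_le_left _ _))
  have hAc : ContinuousOn A (sphere 0 1) := (continuous_ofReal.comp_continuousOn hrc).smul hwc
  have hBc : ContinuousOn B (sphere 0 1) := by
    refine ContinuousOn.smul (((continuous_ofReal.comp_continuousOn hrc).pow 2).mul
      ((continuousOn_const.mul (hHc.holHess hwc)).div
        ((continuous_ofReal.comp_continuousOn hvc.norm).pow 2) fun ζ hζ => ?_)) hvc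
    exact pow_ne_zero 2 (ofReal_ne_zero.2 (hm.trans_le (hvm ζ (by simpa using hζ))).ne')
  refine ⟨A, B, hAc, hBc, fun ζ hζ => ?_⟩
  have hp := hfΩ ζ hζ
  have hpc := subset_closure hp
  have hpn := hneg _ hp
  have hsym : ∀ v w, fderiv ℝ (fderiv ℝ ρ) (f ζ) v w = fderiv ℝ (fderiv ℝ ρ) (f ζ) w v :=
    fun v w => fderiv_fderiv_symm hU hρ2 (hsubU hp) v w
  obtain ⟨hw1, hwa⟩ := hw ζ hζ
  have hL := hLl ζ hζ
  have hL0 : 0 < levi ρ (f ζ) (w ζ) := hl.trans_le hL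
  have hr0 : 0 ≤ r ζ := Real.sqrt_nonneg _
  have hr2 : r ζ ^ 2 * levi ρ (f ζ) (w ζ) = -ρ (f ζ) := by
    rw [hr]; simp only
    rw [Real.sq_sqrt (div_nonneg (by linarith) hL0.le), div_mul_cancel₀ _ hL0.ne']
  have hrr : r ζ ≤ r₁ := by
    rw [hr]
    refine Real.sqrt_le_iff.2 ⟨hr₁.le, ?_⟩
    rw [div_le_iff₀ hL0]
    have h1 := (hfδ ζ hζ).trans_le (min_le_right _ _)
    have h2 : l * r₁ ^ 2 ≤ r₁ ^ 2 * levi ρ (f ζ) (w ζ) := by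
      rw [mul_comm]; exact mul_le_mul_of_nonneg_left hL (by positivity)
    linarith
  have hrτ : √(τ / Λ) ≤ r ζ := by
    refine Real.sqrt_le_sqrt ?_
    have h1 := hτle ζ (by simpa using hζ)
    exact div_le_div₀ (by linarith) h1 hL0 (hLΛ ζ hζ)
  have hAn : ‖A ζ‖ = r ζ := by
    rw [hA]; simp only
    rw [norm_smul, norm_real, hw1, mul_one, Real.norm_of_nonneg hr0]
  have hv1 := hvm ζ hζ
  have hvpos : 0 < ‖v (f ζ)‖ := hm.trans_le hv1
  have hBn : ‖B ζ‖ ≤ (r ζ * (Λ / m)) * r ζ := by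
    have hQ := norm_holHess_le (fderiv ℝ (fderiv ℝ ρ) (f ζ)) (w ζ)
    rw [hw1, one_pow, mul_one] at hQ
    have hHb := hH _ hpc
    rw [hB]; simp only
    rw [norm_smul, norm_mul, norm_div, norm_mul, norm_pow, norm_pow, norm_real, norm_real,
      norm_norm, Real.norm_of_nonneg hr0, norm_neg]
    rw [show r ζ * (Λ / m) * r ζ = r ζ ^ 2 * (Λ / m) by ring, mul_assoc]
    refine mul_le_mul_of_nonneg_left ?_ (by positivity)
    have hhalf : ‖(1 / 2 : ℂ)‖ = 1 / 2 := by norm_num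
    rw [hhalf]
    have h3 : 1 / 2 * ‖holHess (fderiv ℝ (fderiv ℝ ρ) (f ζ)) (w ζ) (w ζ)‖ / ‖v (f ζ)‖ ^ 2 *
      ‖v (f ζ)‖ = 1 / 2 * ‖holHess (fderiv ℝ (fderiv ℝ ρ) (f ζ)) (w ζ) (w ζ)‖ / ‖v (f ζ)‖ := by
      field_simp
    rw [h3]
    exact div_le_div₀ hΛ.le (by linarith) hm hv1
  have haA : ‖holPart (fderiv ℝ ρ (f ζ)) (A ζ)‖ ≤ l / 800 * r ζ ^ 2 := by
    rw [hA]; simp only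
    rw [holPart_smul, norm_mul, norm_real, Real.norm_of_nonneg hr0]
    calc r ζ * ‖holPart (fderiv ℝ ρ (f ζ)) (w ζ)‖ ≤ r ζ * (l / 800 * r ζ) := by
          refine mul_le_mul_of_nonneg_left (hwa.trans ?_) hr0
          gcongr
      _ = _ := by ring
  have haB : holPart (fderiv ℝ ρ (f ζ)) (B ζ) =
      -(1 / 2) * holHess (fderiv ℝ (fderiv ℝ ρ) (f ζ)) (A ζ) (A ζ) := by
    rw [hB, hA]; simp only
    rw [holPart_smul, holHess_smul_smul hsym, hva]
    have : (‖v (f ζ)‖ : ℂ) ≠ 0 := ofReal_ne_zero.2 hvpos.ne'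
    field_simp
  have hLA : levi ρ (f ζ) (A ζ) = -ρ (f ζ) := by
    rw [← hr2, ← levi_real_smul]; rfl
  have hs1 : r ζ * (Λ / m) ≤ r₁ * (Λ / m) := by gcongr
  have hest := fun ξ hξ => quadratic_disc_estimates (ξ := ξ) hsym (hH _ hpc) hκ.le
    (fun v hv => ⟨(hT _ hpc v hv).2.1, (hT _ hpc v hv).2.2⟩) hr0 hAn hBn (by positivity)
    (hs1.trans hr₁s) (by linarith) haA haB hξ
  have herr : (2 * (l / 800) + 12 * (l / 4800) + 32 * Λ * (r ζ * (Λ / m))) * r ζ ^ 2 ≤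
      -ρ (f ζ) / 100 := by
    have h1 : 32 * Λ * (r ζ * (Λ / m)) ≤ 32 * Λ * (r₁ * (Λ / m)) := by gcongr
    have h2 : l * r ζ ^ 2 ≤ -ρ (f ζ) := by
      rw [← hr2, mul_comm]; exact mul_le_mul_of_nonneg_left hL (by positivity)
    calc _ ≤ (l / 100) * r ζ ^ 2 := by
          refine mul_le_mul_of_nonneg_right ?_ (by positivity)
          linarith
      _ ≤ _ := by linarith
  simp only [hLA] at hest
  refine ⟨fun ξ hξ => (hT _ hpc _ (hest ξ hξ).1).1, fun ξ hξ => ?_, fun ξ hξ => ?_,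
    fun ξ hξ1 hξ2 => ?_⟩
  · have h1 := (abs_le.1 ((hest ξ (by linarith)).2.1.trans herr)).2
    have h2 : ‖ξ‖ ^ 2 * -ρ (f ζ) ≤ (1 / 2) ^ 2 * -ρ (f ζ) :=
      mul_le_mul_of_nonneg_right (pow_le_pow_left₀ (norm_nonneg _) hξ 2) (by linarith)
    linarith
  · have h1 := (abs_le.1 ((hest ξ hξ.le).2.1.trans herr)).1
    rw [hξ] at h1
    linarith
  · have h1 := (abs_le.1 (((hest ξ hξ2).2.2 1 (by simp)).trans herr)).1
    have h2 := ((hest ξ hξ2).2.2 I (by simp)).trans herr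
    have h3 : (1 / 2) ^ 2 * -ρ (f ζ) ≤ ‖ξ‖ ^ 2 * -ρ (f ζ) :=
      mul_le_mul_of_nonneg_right (pow_le_pow_left₀ (by norm_num) hξ1 2) (by linarith)
    rw [I_re, mul_zero, zero_mul, zero_mul, sub_zero] at h2
    rw [one_smul, one_re, mul_one] at h1
    linarith

end QuadraticDiscs

section Generic

variable {E : Type*} [NormedAddCommGroup E] [NormedSpace ℂ E]

theorem exists_injective_immersion_shift [FiniteDimensional ℂ E] (hE : 4 < Module.finrank ℝ E)
    {h : ℂ → E} (hh : Differentiable ℂ h) {δ : ℝ} (hδ : 0 < δ) :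
    ∃ c : E, ‖c‖ < δ ∧ Function.Injective (fun ζ => h ζ + ζ • c) ∧ ∀ ζ, deriv h ζ + c ≠ 0 := by
  have : FiniteDimensional ℝ E := FiniteDimensional.complexToReal E
  have : CompleteSpace E := FiniteDimensional.complete ℂ E
  have hhR : ContDiff ℝ 2 h := (hh.contDiff (n := 2)).restrict_scalars ℝ
  have hd : ContDiff ℝ 1 (deriv h) := by
    have h1 : Differentiable ℂ (deriv h) :=
      differentiableOn_univ.1 (hh.differentiableOn.deriv isOpen_univ)
    exact (h1.contDiff (n := 1)).restrict_scalars ℝ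
  set s : Set (ℂ × ℂ) := {x | x.1 ≠ x.2} with hs
  set q : ℂ × ℂ → E := fun x => (x.1 - x.2)⁻¹ • (h x.1 - h x.2) with hq
  have hso : IsOpen s := isOpen_ne_fun continuous_fst continuous_snd
  have hqd : ∀ x ∈ s, ContDiffAt ℝ 1 q x := fun x hx => by
    have h1 : ContDiffAt ℝ 1 (fun x : ℂ × ℂ => (x.1 - x.2)⁻¹) x :=
      (contDiffAt_fst.sub contDiffAt_snd).inv (sub_ne_zero.2 hx)
    exact h1.smul (((hhR.of_le (by norm_num)).contDiffAt.comp x contDiffAt_fst).sub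
      ((hhR.of_le (by norm_num)).contDiffAt.comp x contDiffAt_snd))
  have hq4 : dimH (q '' s) ≤ 4 := by
    refine (dimH_image_le_of_locally_lipschitzOn fun x hx => ?_).trans
      ((dimH_mono (subset_univ s)).trans_eq ?_)
    · obtain ⟨K, t, ht, hK⟩ := (hqd x hx).exists_lipschitzOnWith
      exact ⟨K, t, mem_nhdsWithin_of_mem_nhds ht, hK⟩
    · rw [Real.dimH_univ_eq_finrank]; norm_num
  have hd4 : dimH (range (deriv h)) ≤ 4 := by
    refine hd.dimH_range_le.trans ?_
    simp; norm_num
  have hlt : dimH (q '' s ∪ range (deriv h)) < Module.finrank ℝ E := by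
    rw [dimH_union]
    exact (max_le hq4 hd4).trans_lt (by exact_mod_cast hE)
  obtain ⟨c, hc, hcδ⟩ := (dense_compl_of_dimH_lt_finrank hlt).exists_dist_lt 0 hδ
  refine ⟨-c, by simpa [dist_eq_norm] using hcδ, fun x y hxy => ?_, fun ζ h0 => ?_⟩
  · by_contra hne
    refine hc (Or.inl ⟨(x, y), hne, ?_⟩)
    simp only [hq]
    rw [inv_smul_eq_iff₀ (sub_ne_zero.2 hne), sub_smul]
    simp only [smul_neg] at hxy
    rw [← sub_eq_add_neg, ← sub_eq_add_neg] at hxy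
    rw [sub_eq_sub_iff_add_eq_add] at hxy ⊢
    rw [hxy]; abel
  · exact hc (Or.inr ⟨ζ, by rwa [← sub_eq_add_neg, sub_eq_zero] at h0⟩)

theorem exists_annulus_prod_subset {F : Type*} [SeminormedAddCommGroup F] {S : Set (ℂ × F)}
    (hS : IsOpen S) (h : ∀ ζ, ‖ζ‖ = 1 → (ζ, 0) ∈ S) :
    ∃ δ > 0, δ < 1 ∧ ∀ ζ y, 1 - δ ≤ ‖ζ‖ → ‖ζ‖ ≤ 1 + δ → ‖y‖ ≤ δ → (ζ, y) ∈ S := by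
  obtain ⟨u, v, hu, hv, hsu, h0v, huv⟩ := generalized_tube_lemma (isCompact_sphere (0:ℂ) 1)
    (isCompact_singleton (x := (0:F))) hS (by
      rintro ⟨ζ, y⟩ ⟨hζ, hy⟩
      obtain rfl : y = 0 := hy
      exact h ζ (by simpa using hζ))
  obtain ⟨δ, hδ, hδ1, hann⟩ := exists_annulus_subset hu fun ζ hζ => hsu (by simpa using hζ)
  obtain ⟨δ', hδ', hball⟩ := Metric.isOpen_iff.1 hv 0 (h0v rfl)
  refine ⟨min δ (δ' / 2), by positivity, (min_le_left _ _).trans_lt hδ1, fun ζ y h1 h2 h3 =>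
    huv ⟨hann ζ ?_ ?_, hball ?_⟩⟩
  · linarith [min_le_left δ (δ' / 2)]
  · linarith [min_le_left δ (δ' / 2)]
  · rw [mem_ball_zero_iff]; linarith [min_le_right δ (δ' / 2)]

end Generic

section Crossing

variable {E : Type*} [NormedAddCommGroup E] [NormedSpace ℂ E]

theorem isOpen_coneSet {U : Set E} {ρ : E → ℝ} (hU : IsOpen U) (hρ : ContDiffOn ℝ 2 ρ U) :
    IsOpen {x : E × E | x.1 ∈ U ∧ 8 * |fderiv ℝ ρ x.1 (I • x.2)| < fderiv ℝ ρ x.1 x.2} := by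
  have h1 : ContinuousOn (fun x : E × E => fderiv ℝ ρ x.1) {x | x.1 ∈ U} :=
    (continuousOn_fderiv hU hρ).comp continuousOn_fst fun x hx => hx
  have h2 : ContinuousOn (fun x : E × E => 8 * |fderiv ℝ ρ x.1 (I • x.2)| - fderiv ℝ ρ x.1 x.2)
      {x | x.1 ∈ U} :=
    (continuousOn_const.mul (h1.clm_apply (continuous_snd.const_smul I).continuousOn).abs).sub
      (h1.clm_apply continuousOn_snd)
  convert! h2.isOpen_inter_preimage (hU.preimage continuous_fst) isOpen_Iio (t := Iio 0) using 1
  ext x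
  simp

theorem smul_deriv_quadratic {f p q : ℂ → E} (hf : Differentiable ℂ f) (hp : Differentiable ℂ p)
    (hq : Differentiable ℂ q) (k m : ℕ) (c : E) {ζ : ℂ} (hζ : ζ ≠ 0) :
    ζ • (deriv (fun z => f z + z ^ k • p z + z ^ (m + k + k) • q z) ζ + c) =
      ((m + k : ℕ) : ℂ) • (ζ ^ (m + k) • (ζ ^ m)⁻¹ • p ζ +
        (2 * (ζ ^ (m + k)) ^ 2) • (ζ ^ m)⁻¹ • q ζ) +
      ((ζ • deriv f ζ + ζ • c) + ζ ^ (m + k) • (ζ ^ m)⁻¹ • (ζ • deriv p ζ - (m : ℂ) • p ζ) +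
        (ζ ^ (m + k)) ^ 2 • (ζ ^ m)⁻¹ • (ζ • deriv q ζ - (m : ℂ) • q ζ)) := by
  have hpow : ∀ j : ℕ, ζ * ((j : ℂ) * ζ ^ (j - 1)) = j * ζ ^ j := fun j => by
    cases j with
    | zero => simp
    | succ j => rw [Nat.add_sub_cancel, pow_succ]; ring
  have hd := ((hf ζ).hasDerivAt.add ((hasDerivAt_pow k ζ).smul (hp ζ).hasDerivAt)).add
    ((hasDerivAt_pow (m + k + k) ζ).smul (hq ζ).hasDerivAt)
  have hd' : deriv (fun z => f z + z ^ k • p z + z ^ (m + k + k) • q z) ζ = _ := hd.deriv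
  rw [hd']
  have h1 : ζ ^ (m + k) * (ζ ^ m)⁻¹ = ζ ^ k := by
    have := pow_ne_zero m hζ
    rw [pow_add]; field_simp
  have h2 : (ζ ^ (m + k)) ^ 2 * (ζ ^ m)⁻¹ = ζ ^ (m + k + k) := by
    rw [pow_two, mul_assoc, h1, ← pow_add]
  have h3 : 2 * (ζ ^ (m + k)) ^ 2 * (ζ ^ m)⁻¹ = 2 * ζ ^ (m + k + k) := by rw [← h2]; ring
  simp only [smul_smul (ζ ^ (m + k)), smul_smul (2 * (ζ ^ (m + k)) ^ 2),
    smul_smul ((ζ ^ (m + k)) ^ 2), h1, h2, h3]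
  simp only [smul_add, smul_sub, smul_smul, hpow]
  push_cast
  module

theorem exists_entire_crossing [FiniteDimensional ℂ E] (hE : 4 < Module.finrank ℝ E) {U : Set E}
    {ρ : E → ℝ} (hU : IsOpen U) (hρ : ContDiffOn ℝ 2 ρ U) {f A B : ℂ → E}
    (hf : Differentiable ℂ f) (hfΩ : ∀ ζ, ‖ζ‖ ≤ 1 → f ζ ∈ {z ∈ U | ρ z < 0})
    (hA : ContinuousOn A (sphere 0 1)) (hB : ContinuousOn B (sphere 0 1))
    (hAB : ∀ ζ, ‖ζ‖ = 1 → CrossingDisc U ρ (f ζ) (A ζ) (B ζ)) {r ε η₀ : ℝ} (hr : r < 1)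
    (hε : 0 < ε) (hη₀ : 0 < η₀) :
    ∃ (F : ℂ → E) (η : ℝ), Differentiable ℂ F ∧ 0 < η ∧ η ≤ η₀ ∧
      (∀ ζ, ‖ζ‖ ≤ r → ‖F ζ - f ζ‖ < ε) ∧ Function.Injective F ∧ (∀ ζ, deriv F ζ ≠ 0) ∧
      (∀ s : ℂ, |s.re| ≤ η → F (exp s) ∈ U ∧
        8 * |fderiv ℝ ρ (F (exp s)) (I • exp s • deriv F (exp s))| <
          fderiv ℝ ρ (F (exp s)) (exp s • deriv F (exp s))) ∧
      (∀ z : ℂ, ‖z‖ ≤ Real.exp (-η) → F z ∈ U ∧ ρ (F z) < 0) ∧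
      (∀ z : ℂ, ‖z‖ = Real.exp η → 0 < ρ (F z)) := by
  have hfc := hf.continuous
  have hΩ : IsOpen {z ∈ U | ρ z < 0} := hρ.continuousOn.isOpen_inter_preimage hU isOpen_Iio
  have hΩ' : IsOpen {z ∈ U | 0 < ρ z} := hρ.continuousOn.isOpen_inter_preimage hU isOpen_Ioi
  set W : Set (ℂ × ((E × E) × (E × E))) :=
    {x | ∀ ξ ∈ closedBall (0:ℂ) (1 / 2),
      f x.1 + x.2.2.1 + (ξ • x.2.1.1 + ξ ^ 2 • x.2.1.2) ∈ {z ∈ U | ρ z < 0}} ∩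
    ({x | ∀ ξ ∈ sphere (0:ℂ) 2,
      f x.1 + x.2.2.1 + (ξ • x.2.1.1 + ξ ^ 2 • x.2.1.2) ∈ {z ∈ U | 0 < ρ z}} ∩
    {x | ∀ ξ ∈ closedBall (0:ℂ) 2 \ ball 0 (1 / 2),
      (f x.1 + x.2.2.1 + (ξ • x.2.1.1 + ξ ^ 2 • x.2.1.2),
        ξ • x.2.1.1 + (2 * ξ ^ 2) • x.2.1.2 + x.2.2.2) ∈
        {x : E × E | x.1 ∈ U ∧ 8 * |fderiv ℝ ρ x.1 (I • x.2)| < fderiv ℝ ρ x.1 x.2}}) with hWdef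
  have hW : IsOpen W := by
    refine (isOpen_forall_mem (isCompact_closedBall 0 (1 / 2)) hΩ
      (Φ := fun x : (ℂ × ((E × E) × (E × E))) × ℂ =>
        f x.1.1 + x.1.2.2.1 + (x.2 • x.1.2.1.1 + x.2 ^ 2 • x.1.2.1.2)) (by fun_prop)).inter
      ((isOpen_forall_mem (isCompact_sphere 0 2) hΩ'
      (Φ := fun x : (ℂ × ((E × E) × (E × E))) × ℂ =>
        f x.1.1 + x.1.2.2.1 + (x.2 • x.1.2.1.1 + x.2 ^ 2 • x.1.2.1.2)) (by fun_prop)).inter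
      (isOpen_forall_mem ((isCompact_closedBall 0 2).diff isOpen_ball) (isOpen_coneSet hU hρ)
      (Φ := fun x : (ℂ × ((E × E) × (E × E))) × ℂ =>
        (f x.1.1 + x.1.2.2.1 + (x.2 • x.1.2.1.1 + x.2 ^ 2 • x.1.2.1.2),
          x.2 • x.1.2.1.1 + (2 * x.2 ^ 2) • x.1.2.1.2 + x.1.2.2.2)) (by fun_prop)))
  have hW₀ : IsOpen {x : ℂ × (E × E) | (x.1, x.2, (0 : E × E)) ∈ W} :=
    hW.preimage (by fun_prop : Continuous fun x : ℂ × (E × E) => (x.1, x.2, (0 : E × E)))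
  obtain ⟨m, P, hP, hPW⟩ := exists_laurent_mem (A := fun ζ => (A ζ, B ζ)) (hA.prodMk hB) hW₀
    fun ζ hζ => by
      have h := hAB ζ hζ
      refine ⟨fun ξ hξ => ?_, fun ξ hξ => ?_, fun ξ hξ => ?_⟩
      · have hξ' : ‖ξ‖ ≤ 1 / 2 := by simpa using hξ
        simpa using ⟨h.mem ξ (by linarith), h.neg ξ hξ'⟩
      · have hξ' : ‖ξ‖ = 2 := by simpa using hξ
        simpa using ⟨h.mem ξ hξ'.le, h.pos ξ hξ'⟩
      · have hξ1 : ‖ξ‖ ≤ 2 := by simpa using hξ.1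
        have hξ2 : 1 / 2 ≤ ‖ξ‖ := by simpa using hξ.2
        simp only [mem_ofPred_eq, Prod.fst_zero, Prod.snd_zero, add_zero]
        exact ⟨h.mem ξ hξ1, h.cone ξ hξ2 hξ1⟩
  set p : ℂ → E := fun ζ => (P ζ).1 with hp
  set q : ℂ → E := fun ζ => (P ζ).2 with hq
  have hpd : Differentiable ℂ p := hP.fst
  have hqd : Differentiable ℂ q := hP.snd
  have hc : ContinuousOn (fun x : ℂ × (E × E) => (x.1, (x.1 ^ m)⁻¹ • P x.1, x.2)) {x | x.1 ≠ 0} :=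
    continuousOn_fst.prodMk ((((continuous_fst.pow m).continuousOn.inv₀
      fun x hx => pow_ne_zero m hx).smul (hP.continuous.comp continuous_fst).continuousOn).prodMk
        continuousOn_snd)
  obtain ⟨δ, hδ, hδ1, htube⟩ := exists_annulus_prod_subset (hc.isOpen_inter_preimage
    (isOpen_ne_fun continuous_fst continuous_const) hW) fun ζ hζ =>
      ⟨by rintro (rfl : ζ = 0); simp at hζ, hPW ζ hζ⟩
  obtain ⟨ε₀, hε₀, hth⟩ := ((isCompact_closedBall (0:ℂ) 1).image hfc).exists_thickening_subset_open
    hΩ (by rintro _ ⟨ζ, hζ, rfl⟩; exact hfΩ ζ (by simpa using hζ))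
  obtain ⟨M₁, hM₁, hpM⟩ := exists_norm_bound_of_continuousOn (isCompact_closedBall (0:ℂ) 1)
    hpd.continuous.continuousOn
  obtain ⟨M₂, hM₂, hqM⟩ := exists_norm_bound_of_continuousOn (isCompact_closedBall (0:ℂ) 1)
    hqd.continuous.continuousOn
  have hderiv : ∀ {u : ℂ → E}, Differentiable ℂ u → Continuous (deriv u) := fun {u} hu =>
    (hu.contDiff (n := 1)).continuous_deriv le_rfl
  have hannc : IsCompact (closedBall (0:ℂ) 2 \ ball 0 (1 - δ)) :=
    (isCompact_closedBall 0 2).diff isOpen_ball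
  have hne : ∀ ζ ∈ closedBall (0:ℂ) 2 \ ball 0 (1 - δ), ζ ≠ 0 := by
    rintro ζ hζ rfl
    exact hζ.2 (by simpa using hδ1)
  have hcu : ∀ {u : ℂ → E}, Differentiable ℂ u → ContinuousOn
      (fun ζ => (ζ ^ m)⁻¹ • (ζ • deriv u ζ - (m : ℂ) • u ζ)) (closedBall (0:ℂ) 2 \ ball 0 (1 - δ))
          :=
    fun {u} hu => ((continuous_pow m).continuousOn.inv₀ fun ζ hζ => pow_ne_zero m (hne ζ hζ)).smul
      ((continuous_id.smul (hderiv hu)).sub (hu.continuous.const_smul _)).continuousOn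
  obtain ⟨L₁, hL₁, hpL⟩ := exists_norm_bound_of_continuousOn hannc (hcu hpd)
  obtain ⟨L₂, hL₂, hqL⟩ := exists_norm_bound_of_continuousOn hannc (hcu hqd)
  obtain ⟨L₀, hL₀, hfL⟩ := exists_norm_bound_of_continuousOn hannc
    (continuous_id.smul (hderiv hf)).continuousOn
  have hr' : max 0 (max r (1 - δ)) < 1 := by simp [hr, hδ]
  have hlim1 := (tendsto_pow_atTop_nhds_zero_of_lt_one (le_max_left 0 (max r (1 - δ)))
    hr').eventually_lt_const (by positivity : 0 < min ε ε₀ / 2 / (M₁ + M₂))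
  have hlim2 : Filter.Tendsto (fun k : ℕ => Real.log 2 / ((m + k : ℕ) : ℝ)) Filter.atTop (nhds 0) :=
    (tendsto_natCast_atTop_atTop.comp (Filter.tendsto_atTop_mono (fun k => Nat.le_add_left k m)
      Filter.tendsto_id)).const_div_atTop _
  have hlim3 : Filter.Tendsto (fun k : ℕ => (L₀ + 2 + 2 * L₁ + 4 * L₂) / ((m + k : ℕ) : ℝ))
      Filter.atTop (nhds 0) :=
    (tendsto_natCast_atTop_atTop.comp (Filter.tendsto_atTop_mono (fun k => Nat.le_add_left k m)
      Filter.tendsto_id)).const_div_atTop _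
  have hη₁ : 0 < min η₀ (min (Real.log (1 + δ)) (-Real.log (1 - δ))) := by
    have h1 : 0 < Real.log (1 + δ) := Real.log_pos (by linarith)
    have h2 : 0 < -Real.log (1 - δ) := neg_pos.2 (Real.log_neg (by linarith) (by linarith))
    positivity
  obtain ⟨k, ⟨⟨hk1, hk2⟩, hk3⟩, hk0⟩ := (((hlim1.and (hlim2.eventually_lt_const hη₁)).and
    (hlim3.eventually_lt_const hδ)).and (Filter.eventually_gt_atTop 0)).exists
  have hN : (0:ℝ) < ((m + k : ℕ) : ℝ) := by exact_mod_cast (by omega : 0 < m + k)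
  set η : ℝ := Real.log 2 / ((m + k : ℕ) : ℝ) with hη
  have hη0 : 0 < η := div_pos (Real.log_pos (by norm_num)) hN
  have hηδ1 : Real.exp η ≤ 1 + δ := by
    rw [← Real.le_log_iff_exp_le (by linarith)]
    exact hk2.le.trans ((min_le_right _ _).trans (min_le_left _ _))
  have hηδ2 : 1 - δ ≤ Real.exp (-η) := by
    rw [← Real.log_le_iff_le_exp (by linarith)]
    have := hk2.le.trans ((min_le_right _ _).trans (min_le_right _ _))
    linarith
  have hexpη : Real.exp η ^ (m + k) = 2 := by
    rw [← Real.exp_nat_mul, hη, mul_div_cancel₀ _ hN.ne', Real.exp_log (by norm_num)]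
  have hexpη' : Real.exp (-η) ^ (m + k) = 1 / 2 := by
    rw [Real.exp_neg, inv_pow, hexpη]; norm_num
  set h : ℂ → E := fun z => f z + z ^ k • p z + z ^ (m + k + k) • q z with hh
  have hhd : Differentiable ℂ h := by fun_prop
  obtain ⟨c, hcs, hinj, himm⟩ := exists_injective_immersion_shift hE hhd
    (by positivity : 0 < min (min ε ε₀ / 2) (min 1 (δ / 2)))
  have hc1 : ‖c‖ < min ε ε₀ / 2 := hcs.trans_le (min_le_left _ _)
  have hc2 : ‖c‖ < 1 := hcs.trans_le ((min_le_right _ _).trans (min_le_left _ _))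
  have hc3 : ‖c‖ < δ / 2 := hcs.trans_le ((min_le_right _ _).trans (min_le_right _ _))
  have hFderiv : ∀ ζ, deriv (fun ζ => h ζ + ζ • c) ζ = deriv h ζ + c := fun ζ => by
    have := ((hhd ζ).hasDerivAt.add ((hasDerivAt_id ζ).smul_const c)).deriv
    rw [one_smul] at this
    exact this
  have hsmall : ∀ ζ : ℂ, ‖ζ‖ ≤ max r (1 - δ) → ‖(h ζ + ζ • c) - f ζ‖ < min ε ε₀ := fun ζ hζ => by
    have h1 : ‖ζ‖ ≤ 1 := hζ.trans (le_max_right 0 _ |>.trans hr'.le)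
    have h2 : ‖ζ‖ ^ k ≤ max 0 (max r (1 - δ)) ^ k :=
      pow_le_pow_left₀ (norm_nonneg _) (hζ.trans (le_max_right _ _)) k
    have h3 : ‖ζ ^ k • p ζ‖ ≤ max 0 (max r (1 - δ)) ^ k * M₁ := by
      rw [norm_smul, norm_pow]
      exact mul_le_mul h2 (hpM ζ (by simpa using h1)) (norm_nonneg _) (by positivity)
    have h4 : ‖ζ ^ (m + k + k) • q ζ‖ ≤ max 0 (max r (1 - δ)) ^ k * M₂ := by
      rw [norm_smul, norm_pow]
      refine mul_le_mul (le_trans ?_ h2) (hqM ζ (by simpa using h1)) (norm_nonneg _) (by positivity)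
      exact pow_le_pow_of_le_one (norm_nonneg _) h1 (by omega)
    have h5 : ‖ζ • c‖ ≤ ‖c‖ := by
      rw [norm_smul]; exact mul_le_of_le_one_left (norm_nonneg _) h1
    have h6 := (lt_div_iff₀ (by positivity)).1 hk1
    have h7 : h ζ + ζ • c - f ζ = ζ ^ k • p ζ + ζ ^ (m + k + k) • q ζ + ζ • c := by
      simp only [hh]; abel
    rw [h7]
    refine (norm_add₃_le).trans_lt ?_
    linarith
  have hform : ∀ ζ : ℂ, ζ ≠ 0 → h ζ + ζ • c = f ζ + ζ • c +
      (ζ ^ (m + k) • (ζ ^ m)⁻¹ • p ζ + (ζ ^ (m + k)) ^ 2 • (ζ ^ m)⁻¹ • q ζ) := fun ζ hζ => by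
    have h1 : ζ ^ (m + k) * (ζ ^ m)⁻¹ = ζ ^ k := by
      have := pow_ne_zero m hζ
      rw [pow_add]; field_simp
    have h2 : (ζ ^ (m + k)) ^ 2 * (ζ ^ m)⁻¹ = ζ ^ (m + k + k) := by
      rw [pow_two, mul_assoc, h1, ← pow_add]
    rw [smul_smul, smul_smul, h1, h2]
    simp only [hh]; abel
  have hζc : ∀ ζ : ℂ, ‖ζ‖ ≤ 2 → ‖ζ • c‖ ≤ δ := fun ζ hζ => by
    rw [norm_smul]
    have := mul_le_mul hζ hc3.le (norm_nonneg _) zero_le_two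
    linarith
  have hmemW : ∀ (ζ : ℂ) (y : E), 1 - δ ≤ ‖ζ‖ → ‖ζ‖ ≤ 1 + δ → ‖y‖ ≤ δ →
      ζ ≠ 0 ∧ (ζ, (ζ ^ m)⁻¹ • P ζ, (ζ • c, y)) ∈ W := fun ζ y h1 h2 h3 =>
    htube ζ (ζ • c, y) h1 h2 (max_le (hζc ζ (by linarith)) h3)
  refine ⟨fun ζ => h ζ + ζ • c, η, by fun_prop, hη0, hk2.le.trans (min_le_left _ _),
    fun ζ hζ => (hsmall ζ (hζ.trans (le_max_left _ _))).trans_le (min_le_left _ _), hinj,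
    fun ζ => by rw [hFderiv]; exact himm ζ, fun s hs => ?_, fun ζ hζ => ?_, fun ζ hζ => ?_⟩
  · set ζ : ℂ := exp s with hζdef
    have hs' := abs_le.1 hs
    have hζ1 : Real.exp (-η) ≤ ‖ζ‖ := by rw [hζdef, norm_exp]; exact Real.exp_le_exp.2 hs'.1
    have hζ2 : ‖ζ‖ ≤ Real.exp η := by rw [hζdef, norm_exp]; exact Real.exp_le_exp.2 hs'.2
    have hζ3 : ‖ζ‖ ≤ 2 := by linarith
    have hζ0 : ζ ≠ 0 := exp_ne_zero s
    have hζann : ζ ∈ closedBall (0:ℂ) 2 \ ball 0 (1 - δ) :=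
      ⟨by simpa using hζ3, by simpa using hηδ2.trans hζ1⟩
    have hξ1 : 1 / 2 ≤ ‖ζ ^ (m + k)‖ := by
      rw [norm_pow, ← hexpη']; exact pow_le_pow_left₀ (Real.exp_pos _).le hζ1 _
    have hξ2 : ‖ζ ^ (m + k)‖ ≤ 2 := by
      rw [norm_pow, ← hexpη]; exact pow_le_pow_left₀ (norm_nonneg _) hζ2 _
    set D : E := (ζ • deriv f ζ + ζ • c) +
      ζ ^ (m + k) • (ζ ^ m)⁻¹ • (ζ • deriv p ζ - (m : ℂ) • p ζ) +
      (ζ ^ (m + k)) ^ 2 • (ζ ^ m)⁻¹ • (ζ • deriv q ζ - (m : ℂ) • q ζ) with hD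
    have hDn : ‖D‖ ≤ L₀ + 2 + 2 * L₁ + 4 * L₂ := by
      have h1 : ‖ζ • deriv f ζ‖ ≤ L₀ := hfL ζ hζann
      have h2 : ‖ζ • c‖ ≤ 2 := by
        rw [norm_smul]
        have := mul_le_mul hζ3 hc2.le (norm_nonneg _) zero_le_two
        linarith
      have h3 : ‖ζ ^ (m + k) • (ζ ^ m)⁻¹ • (ζ • deriv p ζ - (m : ℂ) • p ζ)‖ ≤ 2 * L₁ := by
        rw [norm_smul]
        exact mul_le_mul hξ2 (hpL ζ hζann) (norm_nonneg _) zero_le_two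
      have h4 : ‖(ζ ^ (m + k)) ^ 2 • (ζ ^ m)⁻¹ • (ζ • deriv q ζ - (m : ℂ) • q ζ)‖ ≤ 4 * L₂ := by
        rw [norm_smul, norm_pow]
        refine mul_le_mul ?_ (hqL ζ hζann) (norm_nonneg _) (by norm_num)
        exact (pow_le_pow_left₀ (norm_nonneg _) hξ2 2).trans (by norm_num)
      have h5 := norm_add₃_le (a := ζ • deriv f ζ + ζ • c)
        (b := ζ ^ (m + k) • (ζ ^ m)⁻¹ • (ζ • deriv p ζ - (m : ℂ) • p ζ))
        (c := (ζ ^ (m + k)) ^ 2 • (ζ ^ m)⁻¹ • (ζ • deriv q ζ - (m : ℂ) • q ζ))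
      have h6 := norm_add_le (ζ • deriv f ζ) (ζ • c)
      linarith
    set Y : E := ((m + k : ℕ) : ℂ)⁻¹ • D with hY
    have hYn : ‖Y‖ ≤ δ := by
      rw [hY, norm_smul, norm_inv, Complex.norm_natCast, inv_mul_le_iff₀ hN]
      have := ((div_lt_iff₀ hN).1 hk3).le
      linarith
    have hw := ((hmemW ζ Y (hηδ2.trans hζ1) (hζ2.trans hηδ1) hYn).2.2.2 (ζ ^ (m + k))
      ⟨by simpa using hξ2, by simpa using hξ1⟩)
    rw [mem_ofPred_eq] at hw
    simp only [Prod.smul_fst, Prod.smul_snd] at hw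
    rw [← hform ζ hζ0] at hw
    have hζF : ζ • deriv (fun ζ => h ζ + ζ • c) ζ = (((m + k : ℕ) : ℝ)) •
        (ζ ^ (m + k) • (ζ ^ m)⁻¹ • p ζ + (2 * (ζ ^ (m + k)) ^ 2) • (ζ ^ m)⁻¹ • q ζ + Y) := by
      rw [hFderiv, hh, smul_deriv_quadratic hf hpd hqd k m c hζ0, ← hD, hY]
      have hN' : ((m + k : ℕ) : ℂ) ≠ 0 := by exact_mod_cast (by omega : m + k ≠ 0)
      rw [show (((m + k : ℕ) : ℝ)) • (ζ ^ (m + k) • (ζ ^ m)⁻¹ • p ζ +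
        (2 * (ζ ^ (m + k)) ^ 2) • (ζ ^ m)⁻¹ • q ζ + ((m + k : ℕ) : ℂ)⁻¹ • D) =
        (((m + k : ℕ) : ℂ)) • (ζ ^ (m + k) • (ζ ^ m)⁻¹ • p ζ +
        (2 * (ζ ^ (m + k)) ^ 2) • (ζ ^ m)⁻¹ • q ζ + ((m + k : ℕ) : ℂ)⁻¹ • D) from ?_,
        smul_add _ (_ + _), smul_inv_smul₀ hN']
      exact (RCLike.real_smul_eq_coe_smul (K := ℂ) _ _).trans (by simp)
    refine ⟨hw.1, ?_⟩
    have hw2 := hw.2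
    set T : E →L[ℝ] ℝ := fderiv ℝ ρ (h ζ + ζ • c)
    change 8 * |T (I • ζ • deriv (fun ζ => h ζ + ζ • c) ζ)| <
      T (ζ • deriv (fun ζ => h ζ + ζ • c) ζ)
    rw [hζF, smul_comm I (((m + k : ℕ) : ℝ)), map_smul T (((m + k : ℕ) : ℝ)),
      map_smul T (((m + k : ℕ) : ℝ)), smul_eq_mul, smul_eq_mul, abs_mul, abs_of_pos hN]
    have := mul_lt_mul_of_pos_left hw2 hN
    linarith
  · rcases le_total ‖ζ‖ (1 - δ) with h1 | h1
    · refine hth (mem_thickening_iff.2 ⟨f ζ, mem_image_of_mem f (by simp; linarith), ?_⟩)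
      rw [dist_eq_norm]
      exact (hsmall ζ (h1.trans (le_max_right _ _))).trans_le (min_le_right _ _)
    · have h2 : Real.exp (-η) ≤ 1 := Real.exp_le_one_iff.2 (by linarith)
      obtain ⟨h0, hw⟩ := hmemW ζ 0 h1 (by linarith) (by simpa using hδ.le)
      have hξ : ‖ζ ^ (m + k)‖ ≤ 1 / 2 := by
        rw [norm_pow, ← hexpη']; exact pow_le_pow_left₀ (norm_nonneg _) hζ _
      have h3 := hw.1 (ζ ^ (m + k)) (by simpa using hξ)
      simp only [Prod.smul_fst, Prod.smul_snd] at h3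
      rw [← hform ζ h0] at h3
      exact h3
  · have h2 : 1 ≤ Real.exp η := Real.one_le_exp hη0.le
    obtain ⟨h0, hw⟩ := hmemW ζ 0 (by linarith) (by linarith) (by simpa using hδ.le)
    have hξ : ‖ζ ^ (m + k)‖ = 2 := by rw [norm_pow, hζ, hexpη]
    have h3 := hw.2.1 (ζ ^ (m + k)) (by simpa using hξ)
    simp only [Prod.smul_fst, Prod.smul_snd] at h3
    rw [← hform ζ h0] at h3
    exact h3.2

end Crossing

section Assembly

theorem norm_le_norm_smul_single_add {n : ℕ} {i j k : Fin n} (hij : i ≠ j) (hik : i ≠ k)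
    (hjk : j ≠ k) (x y z : ℂ) :
    let u : EuclideanSpace ℂ (Fin n) := x • EuclideanSpace.single i 1 +
      y • EuclideanSpace.single j 1 + z • EuclideanSpace.single k 1
    ‖x‖ ≤ ‖u‖ ∧ ‖y‖ ≤ ‖u‖ ∧ ‖z‖ ≤ ‖u‖ := by
  intro u
  refine ⟨?_, ?_, ?_⟩
  · simpa [u, hij, hik, hjk] using PiLp.norm_apply_le u i
  · simpa [u, hij.symm, hik, hjk] using PiLp.norm_apply_le u j
  · simpa [u, hij, hik.symm, hjk.symm] using PiLp.norm_apply_le u k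

/-- The vector `v` dual to the complex linear form with real part `T`. -/
noncomputable def dualVector {n : ℕ} (T : EuclideanSpace ℂ (Fin n) →L[ℝ] ℝ) :
    EuclideanSpace ℂ (Fin n) :=
  WithLp.toLp 2 fun j => starRingEnd ℂ (holPart T (EuclideanSpace.single j 1))

theorem holPart_eq_sum {n : ℕ} (T : EuclideanSpace ℂ (Fin n) →L[ℝ] ℝ)
    (u : EuclideanSpace ℂ (Fin n)) :
    holPart T u = ∑ j, u j * holPart T (EuclideanSpace.single j 1) := by
  let L : EuclideanSpace ℂ (Fin n) →ₗ[ℂ] ℂ :=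
    { toFun := holPart T
      map_add' := holPart_add T
      map_smul' := holPart_smul T }
  have hu : u = ∑ j, u j • EuclideanSpace.single j (1 : ℂ) := by
    ext i
    simp [Finset.sum_apply, Pi.single_apply]
  have h : L u = ∑ j, u j * L (EuclideanSpace.single j 1) := by
    conv_lhs => rw [hu, map_sum]
    simp
  exact h

theorem holPart_dualVector {n : ℕ} (T : EuclideanSpace ℂ (Fin n) →L[ℝ] ℝ) :
    holPart T (dualVector T) = (‖dualVector T‖ : ℂ) ^ 2 := by
  rw [holPart_eq_sum, ← ofReal_pow, EuclideanSpace.norm_sq_eq, ofReal_sum]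
  refine Finset.sum_congr rfl fun j _ => ?_
  simp [dualVector, Complex.conj_mul']

theorem eq_zero_of_dualVector_eq_zero {n : ℕ} {T : EuclideanSpace ℂ (Fin n) →L[ℝ] ℝ}
    (h : dualVector T = 0) : T = 0 := by
  have hj : ∀ j, holPart T (EuclideanSpace.single j 1) = 0 := fun j => by
    have := congrArg (fun u : EuclideanSpace ℂ (Fin n) => u j) h
    simpa [dualVector] using this
  ext u
  have h1 := re_mul_holPart T 1 u
  rw [holPart_eq_sum] at h1
  simpa [hj] using h1.symm

theorem ContinuousOn.dualVector {X : Type*} [TopologicalSpace X] {n : ℕ} {s : Set X}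
    {T : X → EuclideanSpace ℂ (Fin n) →L[ℝ] ℝ} (hT : ContinuousOn T s) :
    ContinuousOn (fun p => dualVector (T p)) s := by
  have h1 : ∀ e, ContinuousOn (fun p => ((T p e : ℝ) : ℂ)) s := fun e =>
    continuous_ofReal.comp_continuousOn (hT.clm_apply continuousOn_const)
  refine (PiLp.continuous_toLp 2 _).comp_continuousOn (continuousOn_pi.2 fun j => ?_)
  exact continuous_conj.comp_continuousOn ((h1 _).sub (continuousOn_const.mul (h1 _)))

theorem norm_mul_exp_sub_self_le {z g : ℂ} (hz : ‖z‖ ≤ 1) (hg : ‖g‖ ≤ 1) :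
    ‖z * exp g - z‖ ≤ 2 * ‖g‖ := by
  have h := norm_exp_sub_one_le hg
  rw [show z * exp g - z = z * (exp g - 1) by ring, norm_mul]
  exact (mul_le_of_le_one_left (norm_nonneg _) hz).trans h

theorem exists_lt_one_subset_closedBall {K : Set ℂ} (hKc : IsCompact K) (hKD : K ⊆ ball 0 1) :
    ∃ r, 0 < r ∧ r < 1 ∧ K ⊆ closedBall 0 r := by
  obtain ⟨r, hr, hK⟩ := exists_pos_lt_subset_ball one_pos hKc.isClosed hKD
  exact ⟨r, hr.1, hr.2, hK.trans ball_subset_closedBall⟩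

end Assembly

/-- For `n ≥ 3` the proper holomorphic disc in a bounded strongly pseudoconvex domain
`Ω ⊂ ℂⁿ` can be chosen an immersion up to the boundary, and for `n ≥ 4` in addition an
embedding (injective) on the closed disc. -/
theorem immersed_embedded_disc_in_spsc_domain (n : ℕ) (hn : 3 ≤ n)
    (Ω U : Set (EuclideanSpace ℂ (Fin n))) (ρ : EuclideanSpace ℂ (Fin n) → ℝ)
    (hΩbd : IsBounded Ω) (hUopen : IsOpen U) (hΩU : closure Ω ⊆ U)
    (hρC : ContDiffOn ℝ 4 ρ U)
    (hpsh : ∀ z ∈ U, ∀ w : EuclideanSpace ℂ (Fin n), w ≠ 0 → 0 < levi ρ z w)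
    (hΩdef : Ω = {z ∈ U | ρ z < 0})
    (hDρ : ∀ z ∈ frontier Ω, fderiv ℝ ρ z ≠ 0)
    (f₀ : ℂ → EuclideanSpace ℂ (Fin n))
    (hf₀c : ContinuousOn f₀ (closedBall 0 1))
    (hf₀h : DifferentiableOn ℂ f₀ (ball 0 1))
    (hf₀Ω : Set.MapsTo f₀ (closedBall 0 1) Ω)
    (K : Set ℂ) (hKc : IsCompact K) (hKD : K ⊆ ball 0 1)
    (ε : ℝ) (hε : 0 < ε) :
    ∃ f : ℂ → EuclideanSpace ℂ (Fin n),
      ContinuousOn f (closedBall 0 1) ∧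
      DifferentiableOn ℂ f (ball 0 1) ∧
      Set.MapsTo f (ball 0 1) Ω ∧
      (∀ ζ : ℂ, ‖ζ‖ = 1 → ρ (f ζ) = 0) ∧
      (∀ ζ ∈ K, ‖f ζ - f₀ ζ‖ < ε) ∧
      -- the complex derivative extends continuously to the closed disc and the
      -- extension is nonvanishing there: f is an immersion up to the boundary
      (∃ g : ℂ → EuclideanSpace ℂ (Fin n),
        ContinuousOn g (closedBall 0 1) ∧
        (∀ ζ ∈ ball (0:ℂ) 1, g ζ = deriv f ζ) ∧
        (∀ ζ ∈ closedBall (0:ℂ) 1, g ζ ≠ 0)) ∧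
      -- if moreover n ≥ 4, f can be chosen injective on the closed disc
      (4 ≤ n → Set.InjOn f (closedBall 0 1)) := by
  have hρ2 : ContDiffOn ℝ 2 ρ U := hρC.of_le (by norm_num)
  have hρ3 : ContDiffOn ℝ 3 ρ U := hρC.of_le (by norm_num)
  have he := norm_le_norm_smul_single_add (i := (⟨0, by omega⟩ : Fin n)) (j := ⟨1, by omega⟩)
    (k := ⟨2, by omega⟩) (by simp) (by simp) (by simp)
  have hfin : 4 < Module.finrank ℝ (EuclideanSpace ℂ (Fin n)) := by
    rw [finrank_real_of_complex, finrank_euclideanSpace_fin]; omega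
  obtain ⟨δ, hδ, hcross⟩ := exists_crossingDiscs
    (fun x y => by simpa using And.intro (he x y 0).1 (he x y 0).2.1) hUopen hΩbd hΩU hΩdef hρ3
    hpsh (continuousOn_fderiv hUopen hρ2).dualVector
    (fun p => holPart_dualVector (fderiv ℝ ρ p))
    (fun p hp h => hDρ p hp (eq_zero_of_dualVector_eq_zero h))
  obtain ⟨r, hr0, hr1, hK⟩ := exists_lt_one_subset_closedBall hKc hKD
  obtain ⟨f, hf, hfΩ, hff₀, hfδ⟩ := exists_entire_near_boundary he hUopen hΩbd hΩU hΩdef hρ3 hpsh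
    hf₀c hf₀h hf₀Ω hr1 (ε := ε / 3) (by positivity) hδ
  obtain ⟨A, B, hA, hB, hAB⟩ := hcross f hf (fun ζ hζ => hfΩ ζ hζ.le) hfδ
  obtain ⟨δ', hδ', hfu⟩ := Metric.uniformContinuousOn_iff.1
    ((isCompact_closedBall (0:ℂ) 1).uniformContinuousOn_of_continuous hf.continuous.continuousOn)
    (ε / 3) (by positivity)
  set c : ℝ := 1 + 2 / (1 - r) with hc
  have hr1' : 0 < 1 - r := by linarith
  have hc0 : 0 < c := by positivity
  set τ : ℝ := min 1 (min (δ' / 3) ((1 - r) / 4)) with hτ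
  have hτ0 : 0 < τ := by positivity
  have hτ1 : τ ≤ 1 := min_le_left _ _
  have hτ2 : τ ≤ δ' / 3 := (min_le_right _ _).trans (min_le_left _ _)
  have hτ3 : τ ≤ (1 - r) / 4 := (min_le_right _ _).trans (min_le_right _ _)
  obtain ⟨F, η, hF, hη, hηle, hFf, hFinj, hF', hFcone, hFin, hFpos⟩ :=
    exists_entire_crossing hfin hUopen hρ2 hf
    (fun ζ hζ => hΩdef ▸ hfΩ ζ hζ) hA hB hAB (r := (1 + r) / 2) (by linarith) (ε := ε / 3)
    (by positivity) (η₀ := τ / c) (by positivity)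
  obtain ⟨φ, ψ, g, hφc, hψc, hφψ, hψ0, hφinj, hφ0, hφΩ, hφg, hg⟩ :=
    exists_reparametrization hUopen hρ2 hF hη (fun s hs => (hFcone s hs).1)
      (fun s hs => (hFcone s hs).2) hFin hFpos
  have hd : ∀ ζ ∈ ball (0:ℂ) 1, HasDerivAt (fun z => F (φ z)) (ψ ζ • deriv F (φ ζ)) ζ :=
    fun ζ hζ => HasDerivAt.scomp ζ (hF _).hasDerivAt (hφψ ζ (by simpa using hζ))
  refine ⟨fun z => F (φ z), hF.continuous.comp_continuousOn hφc,
    fun ζ hζ => (hd ζ hζ).differentiableAt.differentiableWithinAt, fun ζ hζ => ?_, hφ0,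
    fun ζ hζ => ?_, ⟨fun ζ => ψ ζ • deriv F (φ ζ), ?_, fun ζ hζ => (hd ζ hζ).deriv.symm,
      fun ζ hζ => smul_ne_zero (hψ0 ζ (by simpa using hζ)) (hF' _)⟩,
    fun _ => hFinj.comp_injOn hφinj⟩
  · rw [hΩdef]
    exact hφΩ ζ (by simpa using hζ)
  · have hζr : ‖ζ‖ ≤ r := by simpa using hK hζ
    have hgτ : ‖g ζ‖ ≤ τ := by
      have h1 : 1 + 2 / (1 - ‖ζ‖) ≤ c := by rw [hc]; gcongr
      have h2 : 0 ≤ 1 + 2 / (1 - ‖ζ‖) := by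
        have : 0 < 1 - ‖ζ‖ := by linarith
        positivity
      calc ‖g ζ‖ ≤ η * (1 + 2 / (1 - ‖ζ‖)) := hg ζ (by linarith)
        _ ≤ τ / c * c := mul_le_mul hηle h1 h2 (by positivity)
        _ = τ := div_mul_cancel₀ _ hc0.ne'
    have hφζ : ‖φ ζ - ζ‖ ≤ 2 * τ := by
      rw [hφg]
      exact (norm_mul_exp_sub_self_le (by linarith) (hgτ.trans hτ1)).trans (by linarith)
    have hφn : ‖φ ζ‖ ≤ (1 + r) / 2 := by
      have := norm_le_norm_add_norm_sub' (φ ζ) ζ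
      linarith
    have h1 := hFf (φ ζ) hφn
    have h2 : ‖f (φ ζ) - f ζ‖ < ε / 3 := by
      rw [← dist_eq_norm]
      refine hfu _ (by simp; linarith) _ (by simp; linarith) ?_
      rw [dist_eq_norm]; linarith
    have h3 := hff₀ ζ hζr
    have h4 := norm_add₃_le (a := F (φ ζ) - f (φ ζ)) (b := f (φ ζ) - f ζ) (c := f ζ - f₀ ζ)
    rw [show F (φ ζ) - f (φ ζ) + (f (φ ζ) - f ζ) + (f ζ - f₀ ζ) = F (φ ζ) - f₀ ζ by abel] at h4
    change ‖F (φ ζ) - f₀ ζ‖ < ε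
    linarith
  · exact hψc.smul ((hF.contDiff (n := 1)).continuous_deriv_one.comp_continuousOn hφc)
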